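/- Let w = w_1 ⋯ w_{n²} be a square word of order n, let ŵ = w_2 ⋯ w_{n²}, and let ē = e_1 ∘ ⋯ ∘ e_{n−1} (applying e_{n−1} first). Then p(Q(w)) = Q(ē(ŵ)1) and p(Q'(w)) = Q'(ē(ŵ)1), where p is promotion, Q is the RSK recording tableau and Q' the shifted mixed insertion recording tableau. Consequently, Haiman's bijection H : SYT(n×n) → SYT'(2n−1, 2n−3, …, 1), defined by H(Q(w)) = Q'(w) for square words w, commutes with promotion: p(H(Q)) = H(p(Q)) for every Q ∈ SYT(n×n). -/

import Mathlib

/-! ### Tableau machinery: fillings as functions `ℕ × ℕ → ℕ` (entry `0` = empty/absent cell) -/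

/-- One jeu de taquin slide: starting from an empty box at position `c`, repeatedly swap the
empty box with the smaller of the entries directly to its right and directly below it
(`0` denotes an empty/absent cell), until neither exists.  Returns the resulting filling
together with the final position of the empty box; `fuel` bounds the number of steps. -/
def jdtSlide : ℕ → ((ℕ × ℕ) → ℕ) → (ℕ × ℕ) → (((ℕ × ℕ) → ℕ) × (ℕ × ℕ))
  | 0, f, c => (f, c)
  | fuel+1, f, c =>
    let a := c.1
    let b := c.2
    let r := f (a, b+1)
    let d := f (a+1, b)
    if r = 0 ∧ d = 0 then (f, c)
    else if d = 0 ∨ (r ≠ 0 ∧ r < d) then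
      jdtSlide fuel (Function.update (Function.update f (a, b+1) 0) (a, b) r) (a, b+1)
    else
      jdtSlide fuel (Function.update (Function.update f (a+1, b) 0) (a, b) d) (a+1, b)

/-- Jeu de taquin promotion of a standard filling with `N` boxes: delete the entry `1`
(in the upper left corner `(0,0)`), decrease every other entry by `1`, slide the empty box
by jeu de taquin, and fill the final empty box with `N`. -/
def promote (N : ℕ) (f : (ℕ × ℕ) → ℕ) : (ℕ × ℕ) → ℕ :=
  let s := jdtSlide N (fun c => f c - 1) (0, 0)
  Function.update s.1 s.2 N

/-- The cells of the (straight-shape) Young diagram of a partition `lam`: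
row `a` consists of the cells `(a, b)` with `b < lam a`. -/
def strCell (lam : List ℕ) (c : ℕ × ℕ) : Prop := c.2 < lam.getD c.1 0

/-- The cells of the shifted Young diagram of a strict partition `lam`:
row `a` consists of the cells `(a, b)` with `a ≤ b < a + lam a`. -/
def shiftCell (lam : List ℕ) (c : ℕ × ℕ) : Prop :=
  c.1 ≤ c.2 ∧ c.2 < c.1 + lam.getD c.1 0

/-- `IsStdFilling cells N f` : `f` is a standard tableau on the cell set `cells` with
entries `1, …, N`: it vanishes off `cells`, restricts to a bijection `cells → {1, …, N}`,
and is strictly increasing along rows and columns. -/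
def IsStdFilling (cells : ℕ × ℕ → Prop) (N : ℕ) (f : (ℕ × ℕ) → ℕ) : Prop :=
  (∀ c, ¬ cells c → f c = 0) ∧
  (∀ c, cells c → 1 ≤ f c ∧ f c ≤ N) ∧
  (∀ c c', cells c → cells c' → f c = f c' → c = c') ∧
  (∀ v, 1 ≤ v → v ≤ N → ∃ c, cells c ∧ f c = v) ∧
  (∀ a b, cells (a, b) → cells (a, b+1) → f (a, b) < f (a, b+1)) ∧
  (∀ a b, cells (a, b) → cells (a+1, b) → f (a, b) < f (a+1, b))

/-- The rectangular partition with `b` rows and `n` columns. -/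
def rectShape (b n : ℕ) : List ℕ := List.replicate b n

/-- The square partition with `n` rows and `n` columns. -/
def sqShape (n : ℕ) : List ℕ := List.replicate n n

/-- The doubled staircase strict partition `(2n-1, 2n-3, …, 1)`. -/
def dblStair (n : ℕ) : List ℕ := (List.range n).map (fun i => 2*n - 1 - 2*i)

/-- The index of the row containing the entry `v` of a filling
(rows numbered `0, 1, 2, …` from the top). -/
noncomputable def rowOf (f : (ℕ × ℕ) → ℕ) (v : ℕ) : ℕ := sInf {a | ∃ b, f (a, b) = v}

/-! ### Insertion machinery: tableaux as lists of rows of naturals -/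

/-- Set position `j` of the list `l` to `v`, padding with `0`s if necessary. -/
def padSet (l : List ℕ) (j v : ℕ) : List ℕ :=
  if j < l.length then l.set j v else l ++ List.replicate (j - l.length) 0 ++ [v]

/-- Set the box in row `r`, (row-relative) position `j`, of the tableau `T` to `v`,
adding new rows if necessary. -/
def setBox (T : List (List ℕ)) (r j v : ℕ) : List (List ℕ) :=
  let T' := if r < T.length then T else T ++ List.replicate (r + 1 - T.length) ([] : List ℕ)
  T'.set r (padSet (T'.getD r []) j v)

/-- The number of boxes of a tableau. -/
def tsize (T : List (List ℕ)) : ℕ := (T.map List.length).sum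

/-- RSK row insertion of a letter `x` into a tableau: `x` bumps the leftmost entry of the
first row that is strictly greater than `x`; the bumped entry is inserted into the next row,
and so on; a letter bumping nothing is placed at the end of the row. -/
def rskInsert (x : ℕ) : List (List ℕ) → List (List ℕ)
  | [] => [[x]]
  | row :: rest =>
    match row.findIdx? (fun z => decide (x < z)) with
    | none => (row ++ [x]) :: rest
    | some j => row.set j x :: rskInsert (row.getD j 0) rest

/-- The (unique) cell where the shapes of the tableaux `T` and `T'` differ,
when `T'` is obtained from `T` by one insertion. -/
def newCell (T T' : List (List ℕ)) : ℕ × ℕ :=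
  let r := (List.range T'.length).findIdx
    (fun r => decide ((T.getD r []).length ≠ (T'.getD r []).length))
  (r, (T.getD r []).length)

/-- The RSK insertion tableau `P(w)` and recording tableau `Q(w)` of a word `w`. -/
def rskPQ (w : List ℕ) : List (List ℕ) × List (List ℕ) :=
  w.foldl
    (fun PQ x =>
      let P' := rskInsert x PQ.1
      let c := newCell PQ.1 P'
      (P', setBox PQ.2 c.1 c.2 (tsize PQ.2 + 1)))
    ([], [])

/-- The RSK insertion tableau `P(w)` of the word `w`. -/
def rskP (w : List ℕ) : List (List ℕ) := (rskPQ w).1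

/-- The RSK recording tableau `Q(w)` of the word `w`. -/
def rskQ (w : List ℕ) : List (List ℕ) := (rskPQ w).2

/-! Shifted mixed insertion (Haiman; semistandard version of Serrano).

A shifted tableau is stored as a list of rows, row `r` occupying the (absolute) columns
`r, r+1, …`.  Entries are encoded so that primed letters can be handled: the unprimed
letter `k` is stored as `2k` and the primed letter `k'` is stored as `2k - 1`; this
encoding is order-preserving for the alphabet `1' < 1 < 2' < 2 < ⋯`. -/

/-- The entry of a shifted tableau `T` in row `r` and (absolute) column `c`, with `0`
meaning that there is no such box. -/
def sEntry (T : List (List ℕ)) (r c : ℕ) : ℕ := (T.getD r []).getD (c - r) 0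

/-- One step of shifted mixed insertion, with `fuel` bounding the bumping chain.
If `isRow = true`, the (unprimed) value `v` is inserted into row `i`, bumping the leftmost
entry strictly greater than `v`; if `isRow = false`, the (primed) value `v` is inserted into
column `i`, bumping the topmost entry strictly greater than `v`; a value bumping nothing is
placed at the end of the row resp. the bottom of the column, ending the insertion.
An entry bumped from the main diagonal becomes primed.  A bumped unprimed entry is inserted
into the next row; a bumped primed entry is inserted into the next column.
Returns the new tableau and the cell `(row, column)` where the insertion terminated. -/
def mixedIns : ℕ → List (List ℕ) → Bool → ℕ → ℕ → List (List ℕ) × (ℕ × ℕ)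
  | 0, T, _, _, _ => (T, (0, 0))
  | fuel+1, T, true, r, v =>
    let row := T.getD r []
    match row.findIdx? (fun z => decide (v < z)) with
    | none => (setBox T r row.length v, (r, r + row.length))
    | some j =>
      let z := row.getD j 0
      let T' := T.set r (row.set j v)
      let z' := if j = 0 ∧ z % 2 = 0 then z - 1 else z
      if z' % 2 = 0 then mixedIns fuel T' true (r+1) z'
      else mixedIns fuel T' false (r + j + 1) z'
  | fuel+1, T, false, c, v =>
    match (List.range (c+1)).find? (fun r =>
        decide (c - r < (T.getD r []).length) && decide (v < sEntry T r c)) with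
    | some r =>
      let z := sEntry T r c
      let T' := setBox T r (c - r) v
      let z' := if r = c ∧ z % 2 = 0 then z - 1 else z
      if z' % 2 = 0 then mixedIns fuel T' true (r+1) z'
      else mixedIns fuel T' false (c+1) z'
    | none =>
      let r := (List.range (c+1)).findIdx (fun r => decide ((T.getD r []).length ≤ c - r))
      (setBox T r (c - r) v, (r, c))

/-- Shifted mixed insertion of the letter `x` into the shifted tableau `T`:
the new insertion tableau together with the new cell. -/
def mixedInsLetter (T : List (List ℕ)) (x : ℕ) : List (List ℕ) × (ℕ × ℕ) :=
  mixedIns (tsize T + 2) T true 0 (2 * x)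

/-- The shifted mixed insertion tableau `P'(w)` (with primed entries encoded as above) and
the standard shifted recording tableau `Q'(w)` of a word `w`. -/
def mixedPQ (w : List ℕ) : List (List ℕ) × List (List ℕ) :=
  w.foldl
    (fun PQ x =>
      let s := mixedInsLetter PQ.1 x
      (s.1, setBox PQ.2 s.2.1 (s.2.2 - s.2.1) (tsize PQ.2 + 1)))
    ([], [])

/-- The shifted mixed insertion tableau `P'(w)` of the word `w`. -/
def mixedP (w : List ℕ) : List (List ℕ) := (mixedPQ w).1

/-- The shifted mixed insertion recording tableau `Q'(w)` of the word `w`. -/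
def mixedQ (w : List ℕ) : List (List ℕ) := (mixedPQ w).2

/-- View a straight-shape tableau (list of rows) as a filling `ℕ × ℕ → ℕ`. -/
def toFunStraight (T : List (List ℕ)) : (ℕ × ℕ) → ℕ := fun c => (T.getD c.1 []).getD c.2 0

/-- View a shifted tableau (list of rows, row `r` starting in column `r`) as a filling
`ℕ × ℕ → ℕ`. -/
def toFunShifted (T : List (List ℕ)) : (ℕ × ℕ) → ℕ :=
  fun c => if c.1 ≤ c.2 then (T.getD c.1 []).getD (c.2 - c.1) 0 else 0

/-! ### Words, crystal operators, and the major index -/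

/-- The position (if any) of the rightmost letter `j` of `w` that is unpaired in the
bracket pairing of the letters `j+1` (opening brackets) and `j` (closing brackets) of `w`. -/
def unpairedPos (j : ℕ) (w : List ℕ) : Option ℕ :=
  (((List.range w.length).zip w).foldl
    (fun (s : ℕ × Option ℕ) p =>
      if p.2 = j + 1 then (s.1 + 1, s.2)
      else if p.2 = j then (if 0 < s.1 then (s.1 - 1, s.2) else (0, some p.1))
      else s)
    (0, none)).2

/-- The crystal raising operator `e_j` on words: in the subword of `w` formed by the letters
`j` and `j+1`, pair each `j+1` (opening bracket) with a `j` (closing bracket); the unpaired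
letters form a subword `j^r (j+1)^s`, and `e_j` changes this subword into
`j^(r-1) (j+1)^(s+1)`, i.e. it turns the last unpaired `j` into a `j+1`, leaving the rest
of `w` unchanged.  (If `r = 0`, we let `e_j` fix `w`.) -/
def cryE (j : ℕ) (w : List ℕ) : List ℕ :=
  match unpairedPos j w with
  | none => w
  | some i => w.set i (j + 1)

/-- The composite operator `ē = e_1 ∘ e_2 ∘ ⋯ ∘ e_(n-1)` (applying `e_(n-1)` first). -/
def cryEbar (n : ℕ) (w : List ℕ) : List ℕ :=
  (List.range (n - 1)).reverse.foldl (fun v i => cryE (i + 1) v) w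

/-- A square word of order `n`: a word with exactly `n` copies of each of the letters
`1, …, n` (and no other letters), such that every initial segment contains at least as
many letters `j+1` as letters `j`, for every `j`. -/
def IsSquareWord (n : ℕ) (w : List ℕ) : Prop :=
  w.length = n * n ∧
  (∀ j, 1 ≤ j → j ≤ n → w.count j = n) ∧
  (∀ k j, 1 ≤ j → j < n → (w.take k).count j ≤ (w.take k).count (j + 1))

/-- The major index of a word `v = v_1 v_2 ⋯ v_l`: the sum of the descent positions,
i.e. of the positions `i` (`1 ≤ i ≤ l - 1`) such that `v_i > v_(i+1)`. -/
def majW (v : List ℕ) : ℕ :=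
  ∑ i ∈ Finset.range v.length, if 0 < i ∧ v.getD i 0 < v.getD (i-1) 0 then i else 0


namespace HB

abbrev Cell := ℕ × ℕ

/-- finite order ideals of the shifted quadrant -/
def Idl (X : Finset Cell) : Prop :=
  (∀ r c, (r, c) ∈ X → r ≤ c) ∧
  ∀ r c r' c', (r, c) ∈ X → r' ≤ r → c' ≤ c → r' ≤ c' → (r', c') ∈ X

def Addable (X : Finset Cell) (s : Cell) : Prop :=
  s ∉ X ∧ s.1 ≤ s.2 ∧ (s.1 < s.2 → (s.1, s.2 - 1) ∈ X) ∧ (0 < s.1 → (s.1 - 1, s.2) ∈ X)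

def Corner (h : Cell) (X : Finset Cell) : Prop :=
  h ∈ X ∧ (h.1, h.2 + 1) ∉ X ∧ (h.1 + 1, h.2) ∉ X

theorem Idl.insert {X : Finset Cell} (hX : Idl X) {s : Cell} (hs : Addable X s) :
    Idl (insert s X) := by
  obtain ⟨a, b⟩ := s
  obtain ⟨h1, h2, h3, h4⟩ := hs
  simp only at h2 h3 h4
  constructor
  · intro r c h
    simp only [Finset.mem_insert, Prod.mk.injEq] at h
    rcases h with h | h
    · omega
    · exact hX.1 r c h
  · intro r c r' c' h hr hc hrc
    simp only [Finset.mem_insert, Prod.mk.injEq] at h ⊢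
    rcases h with ⟨rfl, rfl⟩ | h
    · by_cases e1 : r' = r
      · by_cases e2 : c' = c
        · left; exact ⟨e1, e2⟩
        · right
          exact hX.2 _ _ _ _ (h3 (by omega)) (by omega) (by omega) hrc
      · right
        exact hX.2 _ _ _ _ (h4 (by omega)) (by omega) (by omega) hrc
    · right; exact hX.2 _ _ _ _ h hr hc hrc

theorem Idl.erase {X : Finset Cell} (hX : Idl X) {h : Cell} (hh : Corner h X) :
    Idl (X.erase h) := by
  obtain ⟨a, b⟩ := h
  obtain ⟨h1, h2, h3⟩ := hh
  simp only at h2 h3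
  constructor
  · intro r c h
    exact hX.1 r c (Finset.mem_of_mem_erase h)
  · intro r c r' c' h hr hc hrc
    simp only [Finset.mem_erase, ne_eq, Prod.mk.injEq] at h ⊢
    refine ⟨?_, hX.2 _ _ _ _ h.2 hr hc hrc⟩
    rintro ⟨rfl, rfl⟩
    by_cases e1 : r = r'
    · subst e1
      by_cases e2 : c = c'
      · exact h.1 ⟨rfl, e2⟩
      · exact h2 (hX.2 _ _ _ _ h.2 (by omega) (by omega) (by omega))
    · have := hX.1 _ _ h.2
      by_cases e3 : r' + 1 ≤ c'
      · exact h3 (hX.2 _ _ _ _ h.2 (by omega) (by omega) (by omega))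
      · exact h2 (hX.2 _ _ _ _ h.2 (by omega) (by omega) (by omega))

noncomputable def rowEnd (X : Finset Cell) (r : ℕ) : Cell := (r, sInf {c | r ≤ c ∧ (r, c) ∉ X})
noncomputable def colEnd (X : Finset Cell) (c : ℕ) : Cell := (sInf {r | (r, c) ∉ X}, c)

theorem exists_row (X : Finset Cell) (r : ℕ) : {c | r ≤ c ∧ (r, c) ∉ X}.Nonempty := by
  by_contra hne
  rw [Set.not_nonempty_iff_eq_empty] at hne
  have hinf : (Set.Ici r).Infinite := Set.Ici_infinite r
  have : (Set.Ici r) ⊆ ((X.image Prod.snd : Finset ℕ) : Set ℕ) := by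
    intro c hc
    by_contra h
    have : c ∈ {c | r ≤ c ∧ (r, c) ∉ X} := by
      refine ⟨hc, fun hm => h ?_⟩
      simp only [Finset.coe_image, Set.mem_image, Finset.mem_coe]
      exact ⟨_, hm, rfl⟩
    rw [hne] at this
    exact this
  exact hinf ((Finset.finite_toSet _).subset this)

theorem exists_col (X : Finset Cell) (c : ℕ) : {r | (r, c) ∉ X}.Nonempty := by
  by_contra hne
  rw [Set.not_nonempty_iff_eq_empty] at hne
  have hinf : (Set.univ : Set ℕ).Infinite := Set.infinite_univ
  have : (Set.univ : Set ℕ) ⊆ ((X.image Prod.fst : Finset ℕ) : Set ℕ) := by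
    intro r _
    by_contra h
    have : r ∈ {r | (r, c) ∉ X} := by
      refine fun hm => h ?_
      simp only [Finset.coe_image, Set.mem_image, Finset.mem_coe]
      exact ⟨_, hm, rfl⟩
    rw [hne] at this
    exact this
  exact hinf ((Finset.finite_toSet _).subset this)

theorem rowEnd_spec (X : Finset Cell) (r : ℕ) :
    (rowEnd X r).1 = r ∧ r ≤ (rowEnd X r).2 ∧ (r, (rowEnd X r).2) ∉ X ∧
      ∀ c, r ≤ c → c < (rowEnd X r).2 → (r, c) ∈ X := by
  have := Nat.sInf_mem (exists_row X r)
  refine ⟨rfl, this.1, this.2, fun c hc hlt => ?_⟩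
  by_contra h
  exact Nat.notMem_of_lt_sInf hlt ⟨hc, h⟩

theorem colEnd_spec (X : Finset Cell) (c : ℕ) :
    (colEnd X c).2 = c ∧ ((colEnd X c).1, c) ∉ X ∧
      ∀ r, r < (colEnd X c).1 → (r, c) ∈ X := by
  have := Nat.sInf_mem (exists_col X c)
  refine ⟨rfl, this, fun r hlt => ?_⟩
  by_contra h
  exact Nat.notMem_of_lt_sInf hlt h

theorem rowEnd_eq {X : Finset Cell} (hX : Idl X) {s : Cell} (hs : Addable X s) {r : ℕ}
    (hr : s.1 = r) : rowEnd X r = s := by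
  obtain ⟨a, b⟩ := s
  obtain ⟨h1, h2, h3, h4⟩ := hs
  obtain ⟨e1, e2, e3, e4⟩ := rowEnd_spec X r
  simp only at h2 h3 hr
  subst hr
  ext
  · exact e1
  · simp only
    rcases lt_trichotomy (rowEnd X a).2 b with h | h | h
    · exact absurd (hX.2 _ _ _ _ (h3 (by omega)) le_rfl (by omega) e2) e3
    · exact h
    · exact absurd (e4 b h2 h) h1

theorem colEnd_eq {X : Finset Cell} (hX : Idl X) {s : Cell} (hs : Addable X s) {c : ℕ}
    (hr : s.2 = c) : colEnd X c = s := by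
  obtain ⟨a, b⟩ := s
  obtain ⟨h1, h2, h3, h4⟩ := hs
  obtain ⟨e1, e3, e4⟩ := colEnd_spec X c
  simp only at h2 h3 h4 hr
  subst hr
  ext
  · simp only
    rcases lt_trichotomy (colEnd X b).1 a with h | h | h
    · exact absurd (hX.2 _ _ _ _ (h4 (by omega)) (by omega) le_rfl (by omega)) e3
    · exact h
    · exact absurd (e4 a h) h1
  · exact e1

theorem addable_rowEnd_zero (X : Finset Cell) : Addable X (rowEnd X 0) := by
  obtain ⟨e1, e2, e3, e4⟩ := rowEnd_spec X 0
  refine ⟨e3, by rw [e1]; omega, fun h => ?_, fun h => ?_⟩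
  · exact e4 _ (by omega) (by omega)
  · omega

theorem addable_rowEnd_next {Y : Finset Cell} (hY : Idl Y) {p : Cell} (hp : Corner p Y)
    (hd : p.1 ≠ p.2) : Addable Y (rowEnd Y (p.1 + 1)) ∧ (rowEnd Y (p.1 + 1)).2 ≤ p.2 := by
  obtain ⟨a, b⟩ := p
  obtain ⟨h1, h2, h3⟩ := hp
  simp only at h1 h2 h3 hd ⊢
  obtain ⟨e1, e2, e3, e4⟩ := rowEnd_spec Y (a + 1)
  have hab := hY.1 _ _ h1
  have hle : (rowEnd Y (a + 1)).2 ≤ b := by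
    by_contra h
    exact h3 (e4 b (by omega) (by omega))
  refine ⟨⟨e3, by rw [e1]; exact e2, fun h => ?_, fun h => ?_⟩, hle⟩
  · rw [e1] at h ⊢
    exact e4 _ (by omega) (by omega)
  · rw [e1]
    exact hY.2 _ _ _ _ h1 (by omega) hle (by omega)

theorem addable_colEnd_next {Y : Finset Cell} (hY : Idl Y) {p : Cell} (hp : Corner p Y) :
    Addable Y (colEnd Y (p.2 + 1)) ∧ (colEnd Y (p.2 + 1)).1 ≤ p.1 := by
  obtain ⟨a, b⟩ := p
  obtain ⟨h1, h2, h3⟩ := hp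
  simp only at h1 h2 h3 ⊢
  obtain ⟨e1, e3, e4⟩ := colEnd_spec Y (b + 1)
  have hab := hY.1 _ _ h1
  have hle : (colEnd Y (b + 1)).1 ≤ a := by
    by_contra h
    exact h2 (e4 a (by omega))
  refine ⟨⟨e3, by rw [e1]; omega, fun h => ?_, fun h => ?_⟩, hle⟩
  · rw [e1]
    exact hY.2 _ _ _ _ h1 (by omega) (by omega) (by omega)
  · rw [e1]
    exact e4 _ (by omega)

theorem Addable.corner {X : Finset Cell} (hX : Idl X) {p : Cell} (hp : Addable X p) :
    Corner p (insert p X) := by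
  obtain ⟨a, b⟩ := p
  obtain ⟨h1, h2, h3, h4⟩ := hp
  simp only at h1 h2 h3 h4
  refine ⟨Finset.mem_insert_self _ _, ?_, ?_⟩
  · simp only [Finset.mem_insert, Prod.mk.injEq]
    rintro (h | h)
    · omega
    · exact h1 (hX.2 _ _ _ _ h (by omega) (by omega) h2)
  · simp only [Finset.mem_insert, Prod.mk.injEq]
    rintro (h | h)
    · omega
    · exact h1 (hX.2 _ _ _ _ h (by omega) (by omega) h2)

noncomputable def nxt (Y : Finset Cell) (p : Cell) (fl : Bool) : Cell :=
  if fl = true ∨ p.1 = p.2 then colEnd Y (p.2 + 1) else rowEnd Y (p.1 + 1)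

def nfl (p : Cell) (fl : Bool) : Bool := fl || decide (p.1 = p.2)

theorem addable_nxt {X : Finset Cell} (hX : Idl X) {p : Cell} (hp : Addable X p) (fl : Bool) :
    Addable (insert p X) (nxt (insert p X) p fl) := by
  unfold nxt
  split_ifs with h
  · exact (addable_colEnd_next (hX.insert hp) (hp.corner hX)).1
  · push Not at h
    exact (addable_rowEnd_next (hX.insert hp) (hp.corner hX) h.2).1

abbrev LSt := Option (Cell × Bool)
abbrev Stream' := ℕ → Option Cell

def addO (X : Finset Cell) : Option Cell → Finset Cell
  | none => X
  | some s => insert s X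

open Classical in
noncomputable def stp (X : Finset Cell) (ins : Prop) (st : LSt) (s : Option Cell) :
    LSt × Option Cell :=
  match st with
  | none => if ins then (some (rowEnd X 0, false), some (rowEnd X 0)) else (none, s)
  | some (p, fl) =>
    if s = some p then
      (some (nxt (insert p X) p fl, nfl p fl), some (nxt (insert p X) p fl))
    else (some (p, fl), s)

def jst (h : Cell) : Option Cell → Cell × Option Cell
  | none => (h, none)
  | some s => if s = (h.1, h.2 + 1) ∨ s = (h.1 + 1, h.2) then (s, some h) else (h, some s)

def shp (β : Finset Cell) (f : Stream') : ℕ → Finset Cell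
  | 0 => β
  | i + 1 => addO (shp β f i) (f i)

noncomputable def stA (t : ℕ) (β : Finset Cell) (f : Stream') : ℕ → LSt
  | 0 => none
  | i + 1 => (stp (shp β f i) (i = t) (stA t β f i) (f i)).1

noncomputable def outA (t : ℕ) (β : Finset Cell) (f : Stream') : Stream' :=
  fun i => (stp (shp β f i) (i = t) (stA t β f i) (f i)).2

def holeJ (h : Cell) (f : Stream') : ℕ → Cell
  | 0 => h
  | i + 1 => (jst (holeJ h f i) (f i)).1

def outJ (h : Cell) (f : Stream') : Stream' := fun i => (jst (holeJ h f i) (f i)).2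

def Valid (β : Finset Cell) (f : Stream') : Prop :=
  ∀ i s, f i = some s → Addable (shp β f i) s

theorem Valid.idl {β : Finset Cell} {f : Stream'} (hf : Valid β f) (hβ : Idl β) (i : ℕ) :
    Idl (shp β f i) := by
  induction i with
  | zero => exact hβ
  | succ i ih =>
    unfold shp
    rcases h : f i with _ | s
    · exact ih
    · exact ih.insert (hf i s h)

/-- letter-state addability -/
def LAdd (X : Finset Cell) : LSt → Prop
  | none => True
  | some (p, _) => Addable X p

def lAdd (X : Finset Cell) : LSt → Finset Cell
  | none => X
  | some (p, _) => insert p X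

theorem Addable.of_insert {X : Finset Cell} {p s : Cell} (hp : Addable X p)
    (hps : p ≠ s) : Addable (insert s X) p := by
  obtain ⟨h1, h2, h3, h4⟩ := hp
  exact ⟨by simp [h1, hps], h2, fun h => Finset.mem_insert_of_mem (h3 h),
    fun h => Finset.mem_insert_of_mem (h4 h)⟩

theorem stp_spec {X : Finset Cell} (hX : Idl X) {ins : Prop} {st : LSt} {s : Option Cell}
    (hs : ∀ x, s = some x → Addable X x) (hst : LAdd X st) (hi : ins → s = none) :
    LAdd (addO X s) (stp X ins st s).1 ∧
    (∀ x, (stp X ins st s).2 = some x → Addable (lAdd X st) x) ∧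
    lAdd (addO X s) (stp X ins st s).1 = addO (lAdd X st) (stp X ins st s).2 := by
  rcases st with _ | ⟨p, fl⟩
  · by_cases h : ins
    · have := hi h
      subst this
      simp only [stp, h, if_true, addO, LAdd, lAdd]
      refine ⟨addable_rowEnd_zero X, ?_, trivial⟩
      intro x hx
      cases hx
      exact addable_rowEnd_zero X
    · simp only [stp, h, if_false, LAdd, lAdd]
      exact ⟨trivial, hs, trivial⟩
  · simp only [LAdd] at hst
    by_cases h : s = some p
    · subst h
      simp only [stp, if_true, addO, LAdd, lAdd]
      refine ⟨addable_nxt hX hst fl, ?_, trivial⟩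
      intro x hx
      cases hx
      exact addable_nxt hX hst fl
    · simp only [stp, h, if_false, LAdd, lAdd]
      rcases s with _ | x
      · refine ⟨hst, ?_, rfl⟩
        intro x hx; cases hx
      · have hne : p ≠ x := fun e => h (by rw [e])
        refine ⟨hst.of_insert hne, ?_, ?_⟩
        · intro y hy; cases hy
          exact (hs x rfl).of_insert hne.symm
        · simp only [addO]
          exact Finset.insert_comm _ _ _

theorem stA_spec {t : ℕ} {β : Finset Cell} {f : Stream'} (hβ : Idl β) (hf : Valid β f)
    (ht : f t = none) (i : ℕ) :
    LAdd (shp β f i) (stA t β f i) ∧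
    shp β (outA t β f) i = lAdd (shp β f i) (stA t β f i) := by
  induction i with
  | zero => exact ⟨trivial, rfl⟩
  | succ i ih =>
    have := stp_spec (hf.idl hβ i) (ins := i = t) (st := stA t β f i) (s := f i)
      (fun x hx => hf i x hx) ih.1 (fun h => by rw [h]; exact ht)
    refine ⟨this.1, ?_⟩
    show addO (shp β (outA t β f) i) (outA t β f i) = _
    rw [ih.2]
    exact this.2.2.symm

theorem outA_valid {t : ℕ} {β : Finset Cell} {f : Stream'} (hβ : Idl β) (hf : Valid β f)
    (ht : f t = none) : Valid β (outA t β f) := by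
  intro i s hs
  have h0 := stA_spec hβ hf ht i
  have := stp_spec (hf.idl hβ i) (ins := i = t) (st := stA t β f i) (s := f i)
      (fun x hx => hf i x hx) h0.1 (fun h => by rw [h]; exact ht)
  rw [h0.2]
  exact this.2.1 s hs

end HB

namespace HB

theorem jst_spec {X : Finset Cell} (hX : Idl X) {h : Cell} (hh : Corner h X) {s : Option Cell}
    (hs : ∀ x, s = some x → Addable X x) :
    Corner (jst h s).1 (addO X s) ∧
    (∀ x, (jst h s).2 = some x → Addable (X.erase h) x) ∧
    (addO X s).erase (jst h s).1 = addO (X.erase h) (jst h s).2 := by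
  rcases s with _ | s
  · exact ⟨hh, fun x hx => (by cases hx), rfl⟩
  have hs := hs s rfl
  obtain ⟨a, b⟩ := s
  obtain ⟨c, d⟩ := h
  obtain ⟨k1, k2, k3⟩ := hh
  have hcd := hX.1 _ _ k1
  obtain ⟨h1, h2, h3, h4⟩ := id hs
  simp only at h1 h2 h3 h4 k1 k2 k3
  simp only [jst]
  split_ifs with hc
  · simp only [Prod.mk.injEq] at hc
    refine ⟨hs.corner hX, ?_, ?_⟩
    · intro x hx
      cases hx
      refine ⟨by simp, hcd, fun h => ?_, fun h => ?_⟩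
      · simp only [Finset.mem_erase, ne_eq, Prod.mk.injEq]
        refine ⟨by simp only at h; omega, hX.2 _ _ _ _ k1 le_rfl (by omega) (by simp only at h ⊢; omega)⟩
      · simp only [Finset.mem_erase, ne_eq, Prod.mk.injEq]
        refine ⟨by simp only at h; omega, hX.2 _ _ _ _ k1 (by omega) le_rfl (by simp only at h ⊢; omega)⟩
    · simp only [addO]
      rw [Finset.erase_insert h1, Finset.insert_erase k1]
  · simp only [Prod.mk.injEq, not_or, not_and] at hc
    have hne : (c, d) ≠ (a, b) := fun e => h1 (e ▸ k1)
    refine ⟨⟨Finset.mem_insert_of_mem k1, ?_, ?_⟩, ?_, ?_⟩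
    · simp only [addO, Finset.mem_insert, Prod.mk.injEq, not_or]
      exact ⟨fun e => hc.1 e.1.symm e.2.symm, k2⟩
    · simp only [addO, Finset.mem_insert, Prod.mk.injEq, not_or]
      exact ⟨fun e => hc.2 e.1.symm e.2.symm, k3⟩
    · intro x hx
      cases hx
      refine ⟨fun h => h1 (Finset.mem_of_mem_erase h), h2, fun h => ?_, fun h => ?_⟩
      · simp only [Finset.mem_erase, ne_eq, Prod.mk.injEq]
        refine ⟨?_, h3 h⟩
        simp only at h ⊢
        rintro ⟨rfl, rfl⟩
        exact hc.1 rfl (by omega)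
      · simp only [Finset.mem_erase, ne_eq, Prod.mk.injEq]
        refine ⟨?_, h4 h⟩
        simp only at h ⊢
        rintro ⟨rfl, rfl⟩
        exact hc.2 (by omega) rfl
    · simp only [addO]
      rw [Finset.erase_insert_of_ne hne.symm]

/-- product-state invariant for commuting a letter with a hole -/
inductive CInv (X : Finset Cell) (h : Cell) : LSt → Cell → LSt → Prop
  | none : CInv X h none h none
  | same (p : Cell) (fl : Bool) (h1 : Addable X p) (h2 : Addable (X.erase h) p) :
      CInv X h (some (p, fl)) h (some (p, fl))
  | row (p : Cell) (h1 : Addable X p) (h2 : p.2 = h.2 + 1) (h3 : p.1 ≤ h.1) :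
      CInv X h (some (p, false)) p (some (h, false))
  | col (p : Cell) (fl : Bool) (h0 : fl = true ∨ p.1 = p.2) (h1 : Addable X p)
      (h2 : p.1 = h.1 + 1) (h3 : p.2 ≤ h.2) :
      CInv X h (some (p, fl)) p (some (h, true))

theorem not_adj_of_addable {X : Finset Cell} (hX : Idl X) {p s : Cell} (hp : Addable X p)
    (hs : Addable X s) : ¬ (s = (p.1, p.2 + 1) ∨ s = (p.1 + 1, p.2)) := by
  obtain ⟨a, b⟩ := p
  obtain ⟨c, d⟩ := s
  obtain ⟨h1, h2, h3, h4⟩ := hp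
  obtain ⟨k1, k2, k3, k4⟩ := hs
  simp only [Prod.mk.injEq] at *
  rintro (⟨rfl, rfl⟩ | ⟨rfl, rfl⟩)
  · exact h1 (by simpa using k3 (by omega))
  · exact h1 (by simpa using k4 (by omega))

theorem jst_of_not_adj {h s : Cell} (hc : ¬ (s = (h.1, h.2 + 1) ∨ s = (h.1 + 1, h.2))) :
    jst h (some s) = (h, some s) := by
  simp only [jst, if_neg hc]

theorem jst_of_adj {h s : Cell} (hc : s = (h.1, h.2 + 1) ∨ s = (h.1 + 1, h.2)) :
    jst h (some s) = (s, some h) := by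
  simp only [jst, if_pos hc]

theorem stp_ne {X : Finset Cell} {ins : Prop} {p : Cell} {fl : Bool} {s : Option Cell}
    (h : s ≠ some p) : stp X ins (some (p, fl)) s = (some (p, fl), s) := by
  simp only [stp, if_neg h]

theorem stp_eq {X : Finset Cell} {ins : Prop} {p : Cell} {fl : Bool} :
    stp X ins (some (p, fl)) (some p) =
      (some (nxt (insert p X) p fl, nfl p fl), some (nxt (insert p X) p fl)) := by
  simp only [stp, if_true]

theorem nxt_row {Y : Finset Cell} (hY : Idl Y) {p : Cell} (hd : p.1 ≠ p.2) {q : Cell}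
    (hq : Addable Y q) (h : q.1 = p.1 + 1) : nxt Y p false = q := by
  simp only [nxt, hd, Bool.false_eq_true, or_self, if_false]
  exact rowEnd_eq hY hq h

theorem nxt_col {Y : Finset Cell} (hY : Idl Y) {p : Cell} {fl : Bool}
    (hd : fl = true ∨ p.1 = p.2) {q : Cell}
    (hq : Addable Y q) (h : q.2 = p.2 + 1) : nxt Y p fl = q := by
  simp only [nxt, hd, if_true]
  exact colEnd_eq hY hq h

theorem same_not_adj {X : Finset Cell} {h p : Cell} (hcd : h.1 ≤ h.2) (hp : Addable (X.erase h) p) :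
    ¬ (p = (h.1, h.2 + 1) ∨ p = (h.1 + 1, h.2)) := by
  obtain ⟨a, b⟩ := p
  obtain ⟨c, d⟩ := h
  obtain ⟨h1, h2, h3, h4⟩ := hp
  simp only at h2 h3 h4 hcd
  simp only [Prod.mk.injEq]
  rintro (⟨rfl, rfl⟩ | ⟨rfl, rfl⟩)
  · have := h3 (by omega)
    simp at this
  · have := h4 (by omega)
    simp at this

/-- the case of equal states with the letter bumped -/
theorem comm_same_bump {X : Finset Cell} (hX : Idl X) {h : Cell} (hh : Corner h X)
    {p : Cell} {fl : Bool} (h1 : Addable X p) (h2 : Addable (X.erase h) p) :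
    let q := nxt (insert p X) p fl
    let q' := nxt (insert p (X.erase h)) p fl
    (jst h (some q)).2 = some q' ∧
      CInv (insert p X) h (some (q, nfl p fl)) (jst h (some q)).1 (some (q', nfl p fl)) := by
  intro q q'
  have hXe := hX.erase hh
  have hY := hX.insert h1
  have hY' := hXe.insert h2
  have hq : Addable (insert p X) q := addable_nxt hX h1 fl
  have hq' : Addable (insert p (X.erase h)) q' := addable_nxt hXe h2 fl
  have hph : p ≠ h := fun e => h1.1 (e ▸ hh.1)
  have hEr : (insert p X).erase h = insert p (X.erase h) := Finset.erase_insert_of_ne hph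
  have hna := same_not_adj (hX.1 _ _ hh.1) h2
  by_cases hqq : q = q'
  · -- equal targets
    have hadj := same_not_adj (X := insert p X) (h := h) (p := q) (hX.1 _ _ hh.1) (by rw [hEr, hqq]; exact hq')
    rw [jst_of_not_adj hadj]
    refine ⟨by rw [hqq], ?_⟩
    rw [← hqq]
    exact CInv.same q _ hq (by rw [hEr, hqq]; exact hq')
  · -- q' = h
    have hq'h : q' = h := by
      by_contra hne
      apply hqq
      have hA : Addable (insert p X) q' := by
        obtain ⟨k1, k2, k3, k4⟩ := hq'
        refine ⟨?_, k2, fun h => ?_, fun h => ?_⟩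
        · simp only [Finset.mem_insert, Finset.mem_erase, not_or, not_and] at k1 ⊢
          exact ⟨k1.1, k1.2 hne⟩
        · have := k3 h
          simp only [Finset.mem_insert, Finset.mem_erase] at this ⊢
          tauto
        · have := k4 h
          simp only [Finset.mem_insert, Finset.mem_erase] at this ⊢
          tauto
      by_cases hc : fl = true ∨ p.1 = p.2
      · refine nxt_col hY hc hA ?_
        simp only [q', nxt, if_pos hc]; rfl
      · push Not at hc
        have : fl = false := by simpa using hc.1
        subst this
        refine nxt_row hY hc.2 hA ?_
        simp only [q', nxt, hc.2, Bool.false_eq_true, or_self, if_false]; rfl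
    by_cases hc : fl = true ∨ p.1 = p.2
    · -- column type, q = below h
      have e1 : q.2 = p.2 + 1 := by simp only [q, nxt, if_pos hc]; rfl
      have e2 : h.2 = p.2 + 1 := by
        rw [← hq'h]; simp only [q', nxt, if_pos hc]; rfl
      clear_value q q'
      have hqa : q = (h.1 + 1, h.2) := by
        have h5 : (h.1 + 1, h.2) ∉ insert p X := by
          simp only [Finset.mem_insert, not_or]
          exact ⟨fun e => hna (Or.inr e.symm), hh.2.2⟩
        have h6 : h ∈ insert p X := Finset.mem_insert_of_mem hh.1
        have h7 : q.1 ≤ h.1 + 1 := by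
          by_contra hlt
          have := hq.2.2.2 (by omega)
          exact h5 (hY.2 _ _ _ _ this (by omega) (by omega) (by have := hq.2.1; omega))
        have h8 : ¬ q.1 ≤ h.1 := by
          intro hle
          have h9 : (h.1, h.2) ∈ insert p X := h6
          exact hq.1 (hY.2 _ _ _ _ h9 hle (by omega) hq.2.1)
        ext
        · simp only; omega
        · simp only; omega
      rw [jst_of_adj (Or.inr hqa)]
      refine ⟨by rw [hq'h], ?_⟩
      rw [hq'h]
      have : nfl p fl = true := by simp only [nfl]; simpa using hc
      rw [this]
      exact CInv.col q true (Or.inl rfl) hq (by rw [hqa]) (by rw [hqa])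
    · push Not at hc
      have : fl = false := by simpa using hc.1
      subst this
      have e1 : q.1 = p.1 + 1 := by
        simp only [q, nxt, hc.2, Bool.false_eq_true, or_self, if_false]; rfl
      have e2 : h.1 = p.1 + 1 := by
        rw [← hq'h]; simp only [q', nxt, hc.2, Bool.false_eq_true, or_self, if_false]; rfl
      clear_value q q'
      have hqa : q = (h.1, h.2 + 1) := by
        have h5 : (h.1, h.2 + 1) ∉ insert p X := by
          simp only [Finset.mem_insert, not_or]
          exact ⟨fun e => hna (Or.inl e.symm), hh.2.1⟩
        have h6 : (h.1, h.2) ∈ insert p X := Finset.mem_insert_of_mem hh.1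
        have hhd := hY.1 _ _ h6
        have h7 : q.2 ≤ h.2 + 1 := by
          by_contra hlt
          have := hq.2.2.1 (by omega)
          exact h5 (hY.2 _ _ _ _ this (by omega) (by omega) (by omega))
        have h8 : ¬ q.2 ≤ h.2 := by
          intro hle
          exact hq.1 (hY.2 _ _ _ _ h6 (by omega) hle hq.2.1)
        ext
        · simp only; omega
        · simp only; omega
      rw [jst_of_adj (Or.inl hqa)]
      refine ⟨by rw [hq'h], ?_⟩
      rw [hq'h]
      have : nfl p false = false := by simp only [nfl]; simpa using hc.2
      rw [this]
      exact CInv.row q hq (by rw [hqa]) (by rw [hqa])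

theorem comm_step {X : Finset Cell} (hX : Idl X) {h : Cell} (hh : Corner h X) {ins : Prop}
    {st st' : LSt} {g : Cell} (hI : CInv X h st g st') {s : Option Cell}
    (hs : ∀ x, s = some x → Addable X x) (hi : ins → s = none) :
    (jst g (stp X ins st s).2).2 = (stp (X.erase h) ins st' (jst h s).2).2 ∧
    CInv (addO X s) (jst h s).1 (stp X ins st s).1 (jst g (stp X ins st s).2).1
      (stp (X.erase h) ins st' (jst h s).2).1 := by
  have hXe := hX.erase hh
  have hcd := hX.1 _ _ hh.1
  cases hI with
  | none =>
    by_cases hins : ins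
    · have := hi hins
      subst this
      simp only [stp, hins, if_true, jst, addO]
      have hp := addable_rowEnd_zero X
      have hp' := addable_rowEnd_zero (X.erase h)
      by_cases h0 : h.1 = 0
      · have e1 : rowEnd (X.erase h) 0 = h := by
          refine rowEnd_eq hXe ?_ h0
          have := jst_spec hX hh (s := some (rowEnd X 0)) (fun x hx => by cases hx; exact hp)
          refine ⟨by simp, hcd, fun hl => ?_, fun hl => by omega⟩
          simp only [Finset.mem_erase, ne_eq]
          refine ⟨fun e => ?_, hX.2 _ _ _ _ hh.1 le_rfl (by omega) (by omega)⟩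
          have := congrArg Prod.snd e
          simp only at this
          omega
        have e2 : rowEnd X 0 = (h.1, h.2 + 1) := by
          refine rowEnd_eq hX ⟨hh.2.1, by simp only; omega, fun _ => hh.1, fun hl => by simp only at hl; omega⟩ h0
        rw [e1, if_pos (Or.inl e2)]
        refine ⟨rfl, ?_⟩
        exact CInv.row _ hp (by rw [e2]) (by rw [e2])
      · have hp2 : Addable (X.erase h) (rowEnd X 0) := by
          obtain ⟨k1, k2, k3, k4⟩ := hp
          refine ⟨fun hm => k1 (Finset.mem_of_mem_erase hm), k2, fun hl => ?_, fun hl => ?_⟩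
          · simp only [Finset.mem_erase, ne_eq]
            refine ⟨fun e => h0 ?_, k3 hl⟩
            rw [← e]; rfl
          · exact absurd hl (by simp [rowEnd])
        have e1 : rowEnd (X.erase h) 0 = rowEnd X 0 := rowEnd_eq hXe hp2 rfl
        rw [e1, if_neg (same_not_adj hcd hp2)]
        exact ⟨rfl, CInv.same _ _ hp hp2⟩
    · simp only [stp, hins, if_false, true_and]
      exact CInv.none
  | same p fl h1 h2 =>
    by_cases hsp : s = some p
    · subst hsp
      rw [jst_of_not_adj (same_not_adj (hX.1 _ _ hh.1) h2)]
      simp only [stp_eq]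
      exact comm_same_bump hX hh h1 h2
    · rw [stp_ne hsp]
      rcases s with _ | s
      · simp only [jst, addO]
        rw [stp_ne (by simp)]
        exact ⟨rfl, CInv.same _ _ h1 h2⟩
      · have hne : p ≠ s := fun e => hsp (by rw [e])
        have hs := hs s rfl
        by_cases hadj : s = (h.1, h.2 + 1) ∨ s = (h.1 + 1, h.2)
        · rw [jst_of_adj hadj]
          have hph : h ≠ p := fun e => h1.1 (e ▸ hh.1)
          rw [stp_ne (by simpa using hph)]
          refine ⟨rfl, CInv.same _ _ (h1.of_insert hne) ?_⟩
          simp only [addO]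
          rw [Finset.erase_insert hs.1]
          exact h1
        · rw [jst_of_not_adj hadj]
          rw [stp_ne hsp]
          refine ⟨rfl, CInv.same _ _ (h1.of_insert hne) ?_⟩
          simp only [addO]
          have hph : s ≠ h := fun e => hs.1 (e ▸ hh.1)
          rw [Finset.erase_insert_of_ne hph]
          exact h2.of_insert hne
  | row _ h1 h2 h3 =>
    have hIe : insert h (X.erase h) = X := Finset.insert_erase hh.1
    obtain ⟨a, b⟩ := g
    obtain ⟨c, d⟩ := h
    simp only at h2 h3 hcd
    subst h2
    by_cases hsp : s = some (a, d + 1)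
    · subst hsp
      have hY := hX.insert h1
      simp only [stp_eq]
      rcases Nat.lt_or_ge a c with hac | hac
      · -- p strictly above
        have hq : nxt (insert (a, d + 1) X) (a, d + 1) false = (a + 1, d + 1) := by
          refine nxt_row hY (by simp only; omega) ?_ rfl
          refine ⟨?_, by simp only; omega, fun _ => ?_, fun _ => ?_⟩
          · exact (h1.corner hX).2.2
          · exact Finset.mem_insert_of_mem (hX.2 _ _ _ _ hh.1 (by simp only; omega) (by simp) (by simp only; omega))
          · simp
        rw [hq]
        have hna : ¬ ((a, d + 1) = ((c, d).1, (c, d).2 + 1) ∨ (a, d + 1) = ((c, d).1 + 1, (c, d).2)) := by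
          simp only [Prod.mk.injEq]; omega
        rw [jst_of_not_adj hna, jst_of_adj (Or.inr rfl), stp_ne (by simp)]
        refine ⟨rfl, ?_⟩
        have hn : nfl (a, d + 1) false = false := by simp [nfl]; omega
        rw [hn]
        refine CInv.row _ ?_ rfl (by simp only; omega)
        rw [← hq]
        exact addable_nxt hX h1 false
      · obtain rfl : a = c := by omega
        rw [jst_of_adj (h := (a, d)) (Or.inl rfl)]
        simp only [stp_eq, hIe]
        have hn : nfl (a, d + 1) false = false := by simp [nfl]; omega
        rw [hn]
        by_cases hd : a = d
        · subst hd
          have hq : nxt (insert (a, a + 1) X) (a, a + 1) false = (a + 1, a + 1) := by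
            refine nxt_row hY (by simp only; omega) ?_ rfl
            exact ⟨(h1.corner hX).2.2, by simp only; omega, fun hl => by simp only at hl; omega,
              fun _ => by simp⟩
          have hq' : nxt X (a, a) false = (a, a + 1) := by
            refine nxt_col hX (Or.inr rfl) h1 rfl
          rw [hq, hq', jst_of_adj (Or.inr rfl)]
          refine ⟨rfl, ?_⟩
          have : nfl (a, a) false = true := by simp [nfl]
          rw [this]
          refine CInv.col _ _ (Or.inr rfl) ?_ rfl (by simp)
          rw [← hq]
          exact addable_nxt hX h1 false
        · have hn2 : nfl (a, d) false = false := by simp [nfl]; omega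
          rw [hn2]
          have hqA := addable_rowEnd_next hX hh hd
          have hq' : nxt X (a, d) false = rowEnd X (a + 1) := by
            simp only [nxt, hd, Bool.false_eq_true, or_self, if_false]
          have hne : rowEnd X (a + 1) ≠ (a, d + 1) := by
            intro e
            have := congrArg Prod.fst e
            simp [rowEnd] at this
          have hqA2 : Addable (insert (a, d + 1) X) (rowEnd X (a + 1)) := hqA.1.of_insert hne
          have hq : nxt (insert (a, d + 1) X) (a, d + 1) false = rowEnd X (a + 1) :=
            nxt_row hY (by simp only; omega) hqA2 rfl
          rw [hq, hq']
          have hna : ¬ (rowEnd X (a + 1) = ((a, d + 1).1, (a, d + 1).2 + 1) ∨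
              rowEnd X (a + 1) = ((a, d + 1).1 + 1, (a, d + 1).2)) := by
            rintro (e | e)
            · have := congrArg Prod.fst e
              simp [rowEnd] at this
            · have h5 := hqA.2
              rw [e] at h5
              simp at h5
          rw [jst_of_not_adj hna]
          refine ⟨rfl, CInv.same _ _ hqA2 ?_⟩
          simp only [addO]
          rw [Finset.erase_insert h1.1]
          exact hqA.1
    · rw [stp_ne hsp]
      rcases s with _ | s
      · simp only [jst, addO]
        rw [stp_ne (by simp)]
        exact ⟨rfl, CInv.row _ h1 rfl h3⟩
      · have hne : (a, d + 1) ≠ s := fun e => hsp (by rw [e])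
        have hs := hs s rfl
        rw [jst_of_not_adj (not_adj_of_addable hX h1 hs)]
        by_cases hadj : s = ((c, d).1, (c, d).2 + 1) ∨ s = ((c, d).1 + 1, (c, d).2)
        · rw [jst_of_adj hadj]
          rcases hadj with rfl | rfl
          · -- right of the hole : impossible
            exfalso
            have hac : a ≠ c := fun e => hne (by rw [e])
            have h5 := hs.2.2.2 (by simp only; omega)
            exact h1.1 (hX.2 _ _ _ _ h5 (by simp only; omega) le_rfl h1.2.1)
          · simp only [stp_eq, hIe]
            have hcd' : c + 1 ≤ d := hs.2.1
            have hq : nxt X (c, d) false = (c + 1, d) := nxt_row hX (by simp only; omega) hs rfl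
            have hn : nfl (c, d) false = false := by simp [nfl]; omega
            rw [hq, hn]
            exact ⟨rfl, CInv.row _ (h1.of_insert hne) rfl (by simp only; omega)⟩
        · rw [jst_of_not_adj hadj]
          have hsc : s ≠ (c, d) := fun e => hs.1 (e ▸ hh.1)
          rw [stp_ne (by simpa using hsc)]
          exact ⟨rfl, CInv.row _ (h1.of_insert hne) rfl h3⟩
  | col _ fl h0 h1 h2 h3 =>
    have hIe : insert h (X.erase h) = X := Finset.insert_erase hh.1
    obtain ⟨a, b⟩ := g
    obtain ⟨c, d⟩ := h
    simp only at h0 h2 h3 hcd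
    subst h2
    have hcb : c + 1 ≤ b := h1.2.1
    have hn : nfl (c + 1, b) fl = true := by simpa [nfl] using h0
    have hnt : ∀ x, nfl x true = true := by intro x; simp [nfl]
    by_cases hsp : s = some (c + 1, b)
    · subst hsp
      have hY := hX.insert h1
      simp only [stp_eq]
      rw [hn]
      rcases Nat.lt_or_ge b d with hbd | hbd
      · have hq : nxt (insert (c + 1, b) X) (c + 1, b) fl = (c + 1, b + 1) := by
          refine nxt_col hY h0 ?_ rfl
          refine ⟨?_, by simp only; omega, fun _ => ?_, fun _ => ?_⟩
          · exact (h1.corner hX).2.1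
          · simp
          · exact Finset.mem_insert_of_mem (hX.2 _ _ _ _ hh.1 (by simp) (by simp only; omega) (by simp only; omega))
        rw [hq]
        have hna : ¬ ((c + 1, b) = ((c, d).1, (c, d).2 + 1) ∨ (c + 1, b) = ((c, d).1 + 1, (c, d).2)) := by
          simp only [Prod.mk.injEq]; omega
        rw [jst_of_not_adj hna, jst_of_adj (Or.inl rfl), stp_ne (by simp)]
        refine ⟨rfl, ?_⟩
        refine CInv.col _ _ (Or.inl rfl) ?_ rfl (by simp only; omega)
        rw [← hq]
        exact addable_nxt hX h1 fl
      · obtain rfl : b = d := by omega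
        rw [jst_of_adj (h := (c, b)) (Or.inr rfl)]
        simp only [stp_eq, hIe, hnt]
        have hqA := addable_colEnd_next hX hh
        have hq' : nxt X (c, b) true = colEnd X (b + 1) := by simp [nxt]
        have hne : colEnd X (b + 1) ≠ (c + 1, b) := by
          intro e
          have := congrArg Prod.snd e
          simp [colEnd] at this
        have hqA2 : Addable (insert (c + 1, b) X) (colEnd X (b + 1)) := hqA.1.of_insert hne
        have hq : nxt (insert (c + 1, b) X) (c + 1, b) fl = colEnd X (b + 1) :=
          nxt_col hY h0 hqA2 rfl
        rw [hq, hq']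
        have hna : ¬ (colEnd X (b + 1) = ((c + 1, b).1, (c + 1, b).2 + 1) ∨
            colEnd X (b + 1) = ((c + 1, b).1 + 1, (c + 1, b).2)) := by
          rintro (e | e)
          · have h5 := hqA.2
            rw [e] at h5
            simp at h5
          · have := congrArg Prod.snd e
            simp [colEnd] at this
        rw [jst_of_not_adj hna]
        refine ⟨rfl, CInv.same _ _ hqA2 ?_⟩
        simp only [addO]
        rw [Finset.erase_insert h1.1]
        exact hqA.1
    · rw [stp_ne hsp]
      rcases s with _ | s
      · simp only [jst, addO]
        rw [stp_ne (by simp)]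
        exact ⟨rfl, CInv.col _ _ h0 h1 rfl h3⟩
      · have hne : (c + 1, b) ≠ s := fun e => hsp (by rw [e])
        have hs := hs s rfl
        rw [jst_of_not_adj (not_adj_of_addable hX h1 hs)]
        by_cases hadj : s = ((c, d).1, (c, d).2 + 1) ∨ s = ((c, d).1 + 1, (c, d).2)
        · rw [jst_of_adj hadj]
          rcases hadj with rfl | rfl
          · simp only [stp_eq, hIe, hnt]
            have hq : nxt X (c, d) true = (c, d + 1) := nxt_col hX (Or.inl rfl) hs rfl
            rw [hq]
            exact ⟨rfl, CInv.col _ _ h0 (h1.of_insert hne) rfl (by simp only; omega)⟩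
          · exfalso
            have hbd : b ≠ d := fun e => hne (by rw [e])
            have h5 := hs.2.2.1 (by simp only; omega)
            exact h1.1 (hX.2 _ _ _ _ h5 le_rfl (by simp only; omega) h1.2.1)
        · rw [jst_of_not_adj hadj]
          have hsc : s ≠ (c, d) := fun e => hs.1 (e ▸ hh.1)
          rw [stp_ne (by simpa using hsc)]
          exact ⟨rfl, CInv.col _ _ h0 (h1.of_insert hne) rfl h3⟩

theorem holeJ_spec {β : Finset Cell} {f : Stream'} (hβ : Idl β) (hf : Valid β f) {h : Cell}
    (hh : Corner h β) (i : ℕ) :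
    Corner (holeJ h f i) (shp β f i) ∧
    shp (β.erase h) (outJ h f) i = (shp β f i).erase (holeJ h f i) := by
  induction i with
  | zero => exact ⟨hh, rfl⟩
  | succ i ih =>
    have := jst_spec (hf.idl hβ i) ih.1 (s := f i) (fun x hx => hf i x hx)
    refine ⟨this.1, ?_⟩
    show addO (shp (β.erase h) (outJ h f) i) (outJ h f i) = _
    rw [ih.2]
    exact this.2.2.symm

theorem outJ_valid {β : Finset Cell} {f : Stream'} (hβ : Idl β) (hf : Valid β f) {h : Cell}
    (hh : Corner h β) : Valid (β.erase h) (outJ h f) := by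
  intro i s hs
  have h0 := holeJ_spec hβ hf hh i
  rw [h0.2]
  exact (jst_spec (hf.idl hβ i) h0.1 (s := f i) (fun x hx => hf i x hx)).2.1 s hs

/-- slides commute with letters -/
theorem outJ_outA {β : Finset Cell} {f : Stream'} (hβ : Idl β) (hf : Valid β f) {h : Cell}
    (hh : Corner h β) {t : ℕ} (ht : f t = none) :
    outJ h (outA t β f) = outA t (β.erase h) (outJ h f) := by
  have key : ∀ i, CInv (shp β f i) (holeJ h f i) (stA t β f i) (holeJ h (outA t β f) i)
      (stA t (β.erase h) (outJ h f) i) ∧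
      outJ h (outA t β f) i = outA t (β.erase h) (outJ h f) i := by
    intro i
    have step : CInv (shp β f i) (holeJ h f i) (stA t β f i) (holeJ h (outA t β f) i)
      (stA t (β.erase h) (outJ h f) i) → _ := fun hI => comm_step (hf.idl hβ i) (holeJ_spec hβ hf hh i).1 (ins := i = t)
        hI (s := f i) (fun x hx => hf i x hx) (fun h => by rw [h]; exact ht)
    rw [← (holeJ_spec hβ hf hh i).2] at step
    suffices hI : CInv (shp β f i) (holeJ h f i) (stA t β f i) (holeJ h (outA t β f) i)
      (stA t (β.erase h) (outJ h f) i) from ⟨hI, (step hI).1⟩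
    clear step
    induction i with
    | zero => exact CInv.none
    | succ i ih =>
      have := comm_step (hf.idl hβ i) (holeJ_spec hβ hf hh i).1 (ins := i = t)
        ih (s := f i) (fun x hx => hf i x hx) (fun h => by rw [h]; exact ht)
      rw [← (holeJ_spec hβ hf hh i).2] at this
      exact this.2
  funext i
  exact (key i).2

end HB

namespace HB

theorem stA_none {t : ℕ} {β : Finset Cell} {f : Stream'} {i : ℕ} (h : i ≤ t) :
    stA t β f i = none := by
  induction i with
  | zero => rfl
  | succ i ih =>
    have h2 : ¬ (i = t) := by omega
    simp only [stA, ih (by omega), stp, h2, if_false]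

theorem outA_lt {t : ℕ} {β : Finset Cell} {f : Stream'} {i : ℕ} (h : i < t) :
    outA t β f i = f i := by
  have h2 : ¬ (i = t) := by omega
  simp only [outA, stA_none h.le, stp, h2, if_false]

theorem outA_none_iff {t : ℕ} {β : Finset Cell} {f : Stream'} {i : ℕ} :
    outA t β f i = none ↔ f i = none ∧ i ≠ t := by
  by_cases hi : i = t
  · subst hi
    simp only [outA, stA_none le_rfl, stp, if_true]
    simp
  · simp only [outA]
    rcases h : stA t β f i with _ | ⟨p, fl⟩
    · simp [stp, hi]
    · simp only [stp]
      split_ifs with h2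
      · simp [h2]
      · simp [hi]

theorem outJ_none_iff {h : Cell} {f : Stream'} {i : ℕ} :
    outJ h f i = none ↔ f i = none := by
  simp only [outJ]
  rcases f i with _ | s
  · simp [jst]
  · simp only [jst]; split_ifs <;> simp

noncomputable def PF (β : Finset Cell) (f : Stream') (a : List ℕ) : Stream' :=
  a.foldl (fun f t => outA t β f) f

noncomputable def PB (β : Finset Cell) (a : List ℕ) : Stream' := PF β (fun _ => none) a

theorem PF_append (β : Finset Cell) (f : Stream') (a b : List ℕ) :
    PF β f (a ++ b) = PF β (PF β f a) b := by
  simp [PF, List.foldl_append]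

theorem PF_cons (β : Finset Cell) (f : Stream') (t : ℕ) (b : List ℕ) :
    PF β f (t :: b) = PF β (outA t β f) b := rfl

theorem PF_nil (β : Finset Cell) (f : Stream') : PF β f [] = f := rfl

theorem PF_none_iff {β : Finset Cell} {f : Stream'} {a : List ℕ} {i : ℕ} :
    PF β f a i = none ↔ f i = none ∧ i ∉ a := by
  induction a generalizing f with
  | nil => simp [PF_nil]
  | cons t a ih =>
    rw [PF_cons, ih, outA_none_iff]
    simp only [List.mem_cons, not_or]
    tauto

theorem PF_valid {β : Finset Cell} (hβ : Idl β) {f : Stream'} (hf : Valid β f) {a : List ℕ}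
    (ha : a.Nodup) (hn : ∀ t ∈ a, f t = none) : Valid β (PF β f a) := by
  induction a generalizing f with
  | nil => exact hf
  | cons t a ih =>
    rw [PF_cons]
    rw [List.nodup_cons] at ha
    refine ih (outA_valid hβ hf (hn t (by simp))) ha.2 ?_
    intro u hu
    rw [outA_none_iff]
    refine ⟨hn u (by simp [hu]), ?_⟩
    rintro rfl
    exact ha.1 hu

theorem valid_none (β : Finset Cell) : Valid β (fun _ => none) := by
  intro i s h; cases h

theorem PB_valid {β : Finset Cell} (hβ : Idl β) {a : List ℕ} (ha : a.Nodup) :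
    Valid β (PB β a) := PF_valid hβ (valid_none β) ha (fun _ _ => rfl)

theorem PB_none_iff {β : Finset Cell} {a : List ℕ} {i : ℕ} : PB β a i = none ↔ i ∉ a := by
  rw [PB, PF_none_iff]; simp

theorem outJ_PF {β : Finset Cell} (hβ : Idl β) {h : Cell} (hh : Corner h β) {f : Stream'}
    (hf : Valid β f) {a : List ℕ}
    (ha : a.Nodup) (hn : ∀ t ∈ a, f t = none) :
    outJ h (PF β f a) = PF (β.erase h) (outJ h f) a := by
  induction a generalizing f with
  | nil => rfl
  | cons t a ih =>
    rw [PF_cons, PF_cons]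
    rw [List.nodup_cons] at ha
    rw [ih (outA_valid hβ hf (hn t (by simp))) ha.2, outJ_outA hβ hf hh (hn t (by simp))]
    intro u hu
    rw [outA_none_iff]
    refine ⟨hn u (by simp [hu]), ?_⟩
    rintro rfl
    exact ha.1 hu

theorem outJ_none (h : Cell) : outJ h (fun _ => none) = fun _ => none := by
  funext i; rw [outJ_none_iff]

theorem outJ_PB {β : Finset Cell} (hβ : Idl β) {h : Cell} (hh : Corner h β) {a : List ℕ}
    (ha : a.Nodup) : outJ h (PB β a) = PB (β.erase h) a := by
  rw [PB, outJ_PF hβ hh (valid_none β) ha (fun _ _ => rfl), outJ_none]; rfl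

theorem holeJ_congr {h : Cell} {f g : Stream'} {K : ℕ} (hfg : ∀ i < K, f i = g i) :
    ∀ i ≤ K, holeJ h f i = holeJ h g i := by
  intro i
  induction i with
  | zero => intro _; rfl
  | succ i ih =>
    intro hi
    simp only [holeJ]
    rw [ih (by omega), hfg i (by omega)]

theorem outJ_congr {h : Cell} {f g : Stream'} {K : ℕ} (hfg : ∀ i < K, f i = g i) :
    ∀ i < K, outJ h f i = outJ h g i := by
  intro i hi
  simp only [outJ]
  rw [holeJ_congr hfg i hi.le, hfg i hi]

theorem exists_corner {β : Finset Cell} (hne : β.Nonempty) : ∃ h, Corner h β := by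
  obtain ⟨h, hm, hmax⟩ := β.exists_max_image (fun c => c.1 + c.2) hne
  refine ⟨h, hm, fun h2 => ?_, fun h2 => ?_⟩
  · have := hmax _ h2; simp only at this; omega
  · have := hmax _ h2; simp only at this; omega

theorem agree_empty {K : ℕ} {a a' : List ℕ} (ha : a.Nodup) (ha' : a'.Nodup) (β : Finset Cell)
    (hβ : Idl β) (h : ∀ i < K, PB β a i = PB β a' i) : ∀ i < K, PB ∅ a i = PB ∅ a' i := by
  induction hk : β.card generalizing β with
  | zero =>
    have : β = ∅ := Finset.card_eq_zero.mp hk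
    subst this
    exact h
  | succ k ih =>
    obtain ⟨c, hc⟩ := exists_corner (β := β) (Finset.card_pos.mp (by omega))
    refine ih (β.erase c) (hβ.erase hc) ?_ ?_
    · rw [← outJ_PB hβ hc ha, ← outJ_PB hβ hc ha']
      exact outJ_congr h
    · rw [Finset.card_erase_of_mem hc.1]; omega

def tl (f : Stream') : Stream' := fun i => f (i + 1)

theorem shp_tl (β : Finset Cell) (f : Stream') (i : ℕ) :
    shp β f (i + 1) = shp (addO β (f 0)) (tl f) i := by
  induction i with
  | zero => rfl
  | succ i ih =>
    rw [shp, ih]; rfl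

theorem stA_tl (t : ℕ) (β : Finset Cell) (f : Stream') (i : ℕ) :
    stA (t + 1) β f (i + 1) = stA t (addO β (f 0)) (tl f) i := by
  induction i with
  | zero => exact stA_none (by omega)
  | succ i ih =>
    rw [stA, ih, shp_tl]
    simp only [stA, tl, Nat.add_right_cancel_iff]

theorem outA_tl (t : ℕ) (β : Finset Cell) (f : Stream') :
    tl (outA (t + 1) β f) = outA t (addO β (f 0)) (tl f) := by
  funext i
  simp only [tl, outA]
  rw [stA_tl, shp_tl]
  simp only [Nat.add_right_cancel_iff]

theorem PF_tl {a : List ℕ} (h0 : 0 ∉ a) (β : Finset Cell) (f : Stream') :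
    PF β f a 0 = f 0 ∧ tl (PF β f a) = PF (addO β (f 0)) (tl f) (a.map Nat.pred) := by
  induction a generalizing f with
  | nil => exact ⟨rfl, rfl⟩
  | cons t a ih =>
    simp only [List.mem_cons, not_or] at h0
    obtain ⟨t, rfl⟩ : ∃ u, t = u + 1 := ⟨t - 1, by omega⟩
    have := ih h0.2 (outA (t + 1) β f)
    rw [PF_cons, this.1, outA_lt (by omega), this.2, outA_tl, outA_lt (by omega)]
    exact ⟨rfl, rfl⟩

theorem Valid.tl {β : Finset Cell} {f : Stream'} (hf : Valid β f) :
    Valid (addO β (f 0)) (tl f) := by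
  intro i s hs
  rw [← shp_tl]
  exact hf (i + 1) s hs

theorem outA_zero {β : Finset Cell} {g : Stream'} : outA 0 β g 0 = some (rowEnd β 0) := by
  simp [outA, stA, stp, shp]

theorem map_pred_nodup {a : List ℕ} (ha : a.Nodup) (h0 : 0 ∉ a) : (a.map Nat.pred).Nodup := by
  refine List.Nodup.map_on ?_ ha
  intro x hx y hy h
  have hx0 : x ≠ 0 := fun e => h0 (e ▸ hx)
  have hy0 : y ≠ 0 := fun e => h0 (e ▸ hy)
  simp only [Nat.pred_eq_sub_one] at h
  omega

theorem F1 {β : Finset Cell} (hβ : Idl β) {a b : List ℕ} (hab : (a ++ 0 :: b).Nodup)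
    (hg : outJ (rowEnd β 0) (tl (outA 0 β (PB β a))) = tl (PB β a)) :
    PB β (a ++ 0 :: b) 0 = some (rowEnd β 0) ∧
    outJ (rowEnd β 0) (tl (PB β (a ++ 0 :: b))) = PB β ((a ++ b).map Nat.pred) := by
  have hnd := hab
  rw [List.nodup_append, List.nodup_cons] at hab
  obtain ⟨ha, ⟨h0b, hb⟩, hdis⟩ := hab
  have h0a : 0 ∉ a := fun h => hdis 0 h 0 (by simp) rfl
  have hmid : Valid β (outA 0 β (PB β a)) :=
    outA_valid hβ (PB_valid hβ ha) (PB_none_iff.mpr h0a)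
  have e1 : PB β (a ++ 0 :: b) = PF β (outA 0 β (PB β a)) b := by
    rw [PB, PF_append, PF_cons]; rfl
  have e2 := PF_tl h0b β (outA 0 β (PB β a))
  rw [outA_zero] at e2
  rw [e1]
  refine ⟨e2.1, ?_⟩
  rw [e2.2]
  have hp := addable_rowEnd_zero β
  simp only [addO]
  have hv := hmid.tl
  rw [outA_zero] at hv
  rw [outJ_PF (hβ.insert hp) (hp.corner hβ) hv (map_pred_nodup hb h0b), hg,
    Finset.erase_insert hp.1, List.map_append]
  · show _ = PF β _ _
    rw [PF_append]
    have e3 := (PF_tl h0a β (fun _ => none)).2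
    rw [PB, e3]
    rfl
  · intro t ht
    rw [List.mem_map] at ht
    obtain ⟨u, hu, rfl⟩ := ht
    have hu0 : u ≠ 0 := fun e => h0b (e ▸ hu)
    have : tl (outA 0 β (PB β a)) (Nat.pred u) = outA 0 β (PB β a) u := by
      simp only [tl]; congr 1; exact Nat.succ_pred hu0
    rw [this, outA_none_iff, PB_none_iff]
    exact ⟨fun h => hdis u h u (by simp [hu]) rfl, hu0⟩

theorem F1_aux {β : Finset Cell} (hI : Idl β) {g : Stream'} (hg : Valid β g) (hg0 : g 0 = none)
    (I : Cell → Bool → Prop) (h0 : I (rowEnd β 0) false)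
    (hst : ∀ i p fl, I p fl → Addable (shp β g i) p → g i = some p →
      (nxt (insert p (shp β g i)) p fl = (p.1, p.2 + 1) ∨
        nxt (insert p (shp β g i)) p fl = (p.1 + 1, p.2)) ∧
      I (nxt (insert p (shp β g i)) p fl) (nfl p fl)) :
    outJ (rowEnd β 0) (tl (outA 0 β g)) = tl g := by
  set f := outA 0 β g with hf
  have key : ∀ i, (∃ p fl, stA 0 β g (i + 1) = some (p, fl) ∧
      Addable (shp β g (i + 1)) p ∧ I p fl ∧ holeJ (rowEnd β 0) (tl f) i = p) →
      (jst (holeJ (rowEnd β 0) (tl f) i) (f (i+1))).2 = g (i+1) ∧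
      (∃ p fl, stA 0 β g (i + 2) = some (p, fl) ∧ Addable (shp β g (i + 2)) p ∧
      I p fl ∧ holeJ (rowEnd β 0) (tl f) (i + 1) = p) := by
    rintro i ⟨p, fl, h1, h2, h3, h4⟩
    have hX := hg.idl hI (i + 1)
    have e1 : f (i + 1) = (stp (shp β g (i+1)) (i + 1 = 0) (some (p, fl)) (g (i+1))).2 := by
      rw [← h1]; rfl
    have e2 : stA 0 β g (i + 2) =
      (stp (shp β g (i+1)) (i + 1 = 0) (some (p, fl)) (g (i+1))).1 := by
      rw [← h1]; rfl
    have e3 : holeJ (rowEnd β 0) (tl f) (i + 1) = (jst p (f (i + 1))).1 := by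
      simp only [holeJ, h4]; rfl
    have e4 : shp β g (i + 2) = addO (shp β g (i + 1)) (g (i + 1)) := rfl
    rw [e3, h4, e1, e2, e4]
    by_cases hs : g (i + 1) = some p
    · have h5 := hst (i + 1) p fl h3 h2 hs
      have ha := addable_nxt hX h2 fl
      rw [hs, stp_eq, jst_of_adj h5.1]
      exact ⟨rfl, _, _, rfl, ha, h5.2, rfl⟩
    · rw [stp_ne hs]
      rcases hgi : g (i + 1) with _ | s
      · exact ⟨rfl, p, fl, rfl, h2, h3, rfl⟩
      · have hs' : p ≠ s := fun e => hs (by rw [hgi, e])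
        rw [jst_of_not_adj (not_adj_of_addable hX h2 (hg _ _ hgi))]
        exact ⟨rfl, p, fl, rfl, h2.of_insert hs', h3, rfl⟩
  have all : ∀ i, (∃ p fl, stA 0 β g (i + 1) = some (p, fl) ∧
      Addable (shp β g (i + 1)) p ∧ I p fl ∧ holeJ (rowEnd β 0) (tl f) i = p) := by
    intro i
    induction i with
    | zero =>
      refine ⟨rowEnd β 0, false, ?_, ?_, h0, rfl⟩
      · simp only [stA, stp, if_true, shp]
      · simp only [shp, hg0, addO]
        exact addable_rowEnd_zero β
    | succ i ih => exact (key i ih).2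
  funext i
  exact (key i (all i)).1

theorem idl_empty : Idl ∅ := ⟨by simp, by simp⟩

theorem rowEnd_empty : rowEnd ∅ 0 = (0, 0) :=
  rowEnd_eq idl_empty ⟨by simp, by simp, by simp, by simp⟩ rfl

theorem F1_empty_aux {g : Stream'} (hg : Valid ∅ g) (hg0 : g 0 = none) :
    outJ (rowEnd ∅ 0) (tl (outA 0 ∅ g)) = tl g := by
  refine F1_aux idl_empty hg hg0 (fun p fl => p.1 = 0 ∧ (fl = true ∨ p.2 = 0)) ?_ ?_
  · rw [rowEnd_empty]; simp
  · rintro i ⟨r, c⟩ fl ⟨h1, h3⟩ h2 -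
    simp only at h1 h3
    subst h1
    have hX := hg.idl idl_empty i
    have hY := hX.insert h2
    have hc : fl = true ∨ ((0, c) : Cell).1 = ((0, c) : Cell).2 := by
      rcases h3 with h | h
      · exact Or.inl h
      · right; simp [h]
    have hq : nxt (insert (0, c) (shp ∅ g i)) (0, c) fl = (0, c + 1) := by
      have h5 := (addable_colEnd_next hY (h2.corner hX)).2
      simp only [nxt, if_pos hc]
      have h6 := (colEnd_spec (insert (0, c) (shp ∅ g i)) (c + 1)).1
      ext
      · simp only at h5 ⊢; omega
      · exact h6
    rw [hq]
    have : nfl (0, c) fl = true := by simp only [nfl]; simpa using hc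
    exact ⟨Or.inl rfl, rfl, Or.inl this⟩

/-- the staircase of size `n` -/
def bst (n : ℕ) : Finset Cell := (Finset.range n ×ˢ Finset.range n).filter (fun c => c.1 ≤ c.2)

theorem mem_bst {n : ℕ} {r c : ℕ} : (r, c) ∈ bst n ↔ r ≤ c ∧ c < n := by
  simp only [bst, Finset.mem_filter, Finset.mem_product, Finset.mem_range]
  omega

theorem idl_bst (n : ℕ) : Idl (bst n) := by
  constructor
  · intro r c h; exact (mem_bst.mp h).1
  · intro r c r' c' h h1 h2 h3
    rw [mem_bst] at h ⊢
    omega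

theorem shp_mono {β : Finset Cell} {f : Stream'} {i : ℕ} : β ⊆ shp β f i := by
  induction i with
  | zero => exact Finset.Subset.refl _
  | succ i ih =>
    refine ih.trans ?_
    simp only [shp]
    rcases f i with _ | s
    · exact Finset.Subset.refl _
    · exact Finset.subset_insert _ _

theorem rowEnd_bst (n : ℕ) : rowEnd (bst n) 0 = (0, n) := by
  refine rowEnd_eq (idl_bst n) ⟨?_, ?_, ?_, ?_⟩ rfl
  · rw [mem_bst]; omega
  · simp
  · intro h; simp only at h ⊢; rw [mem_bst]; omega
  · simp

theorem F1_bst_aux {n : ℕ} (hn : 0 < n) {g : Stream'} (hg : Valid (bst n) g) (hg0 : g 0 = none)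
    (hrow : ∀ i s, g i = some s → s.1 < n) :
    outJ (rowEnd (bst n) 0) (tl (outA 0 (bst n) g)) = tl g := by
  refine F1_aux (idl_bst n) hg hg0 (fun p fl => p.2 = n ∧ fl = false) ?_ ?_
  · rw [rowEnd_bst]; simp
  · rintro i ⟨r, c⟩ fl ⟨h1, h3⟩ h2 hs
    simp only at h1 h3
    subst h1 h3
    have hr := hrow _ _ hs
    simp only at hr
    have hX := hg.idl (idl_bst c) i
    have hY := hX.insert h2
    have hq : nxt (insert (r, c) (shp (bst c) g i)) (r, c) false = (r + 1, c) := by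
      refine nxt_row hY (by simp only; omega) ?_ rfl
      refine ⟨(h2.corner hX).2.2, by simp only; omega, fun h => ?_, fun h => by simp⟩
      refine Finset.mem_insert_of_mem (shp_mono ?_)
      simp only at h
      rw [mem_bst]; simp only; omega
    rw [hq]
    have : nfl (r, c) false = false := by simp [nfl]; omega
    exact ⟨Or.inr rfl, rfl, this⟩

end HB

namespace HB

/-- `F` is the filling (with column offset `k`) recorded by the stream `f` up to time `N` -/
def IsFill (k N : ℕ) (f : Stream') (F : ℕ × ℕ → ℕ) : Prop :=
  ∀ c v, F c = v + 1 ↔ v < N ∧ f v = some (c.1, c.2 + k)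

theorem IsFill.unique {k N : ℕ} {f g : Stream'} {F G : ℕ × ℕ → ℕ} (hF : IsFill k N f F)
    (hG : IsFill k N g G) (h : ∀ i < N, f i = g i) : F = G := by
  funext c
  rcases hc : F c with _ | v
  · rcases hd : G c with _ | v
    · rfl
    · exfalso
      have h1 := (hG c v).mp hd
      have h2 := (hF c v).mpr ⟨h1.1, by rw [h v h1.1]; exact h1.2⟩
      omega
  · have h1 := (hF c v).mp hc
    have h2 := (hG c v).mpr ⟨h1.1, by rw [← h v h1.1]; exact h1.2⟩
    omega

def mixS (h : Cell) (g : Stream') (i : ℕ) : Stream' := fun v => if v < i then outJ h g v else g v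

theorem mem_shp {β : Finset Cell} {f : Stream'} {i v : ℕ} (hv : v < i) {s : Cell}
    (hs : f v = some s) : s ∈ shp β f i := by
  induction i with
  | zero => omega
  | succ i ih =>
    simp only [shp]
    by_cases h : v = i
    · subst h; rw [hs]; exact Finset.mem_insert_self _ _
    · have := ih (by omega)
      rcases f i with _ | x
      · exact this
      · exact Finset.mem_insert_of_mem this

theorem shp_mono_le {β : Finset Cell} {f : Stream'} {i j : ℕ} (h : i ≤ j) :
    shp β f i ⊆ shp β f j := by
  induction j with
  | zero => rw [Nat.le_zero.mp h]
  | succ j ih =>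
    by_cases e : i = j + 1
    · rw [e]
    · refine (ih (by omega)).trans ?_
      simp only [shp]
      rcases f j with _ | s
      · exact Finset.Subset.refl _
      · exact Finset.subset_insert _ _

theorem slide_link {k K : ℕ} {β : Finset Cell} (hβ : Idl β) {g : Stream'} (hg : Valid β g)
    {h : Cell} (hh : Corner h β) :
    ∀ (m i fuel : ℕ) (G : ℕ × ℕ → ℕ) (x : ℕ × ℕ), m + i = K → m ≤ fuel →
      IsFill k K (mixS h g i) G → (x.1, x.2 + k) = holeJ h g i →
      IsFill k K (outJ h g) (jdtSlide fuel G x).1 ∧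
      ((jdtSlide fuel G x).2.1, (jdtSlide fuel G x).2.2 + k) = holeJ h g K := by
  intro m
  have hJ := holeJ_spec hβ hg hh
  have past : ∀ i v s, v < i → outJ h g v = some s → s ∈ shp β g i ∧ s ≠ holeJ h g i := by
    intro i v s hv hs
    have h1 : s ∈ shp (β.erase h) (outJ h g) i := mem_shp hv hs
    rw [(hJ i).2, Finset.mem_erase] at h1
    exact ⟨h1.2, h1.1⟩
  have future : ∀ i v s, i ≤ v → g v = some s → s ∉ shp β g i := by
    intro i v s hv hs hm
    exact (hg v s hs).1 (shp_mono_le hv hm)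
  have nb : ∀ i s, (s = ((holeJ h g i).1, (holeJ h g i).2 + 1) ∨
      s = ((holeJ h g i).1 + 1, (holeJ h g i).2)) → ∀ v, mixS h g i v = some s → i ≤ v := by
    intro i s hs v hv
    by_contra hlt
    simp only [mixS, if_pos (by omega : v < i)] at hv
    have := (past i v s (by omega) hv).1
    rcases hs with rfl | rfl
    · exact (hJ i).1.2.1 this
    · exact (hJ i).1.2.2 this
  induction m with
  | zero =>
    intro i fuel G x hi hf hG hx
    obtain rfl : i = K := by omega
    have e1 : IsFill k i (outJ h g) G := by
      intro c v
      rw [hG c v]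
      constructor
      · rintro ⟨h1, h2⟩; simp only [mixS, if_pos h1] at h2; exact ⟨h1, h2⟩
      · rintro ⟨h1, h2⟩; simp only [mixS, if_pos h1]; exact ⟨h1, h2⟩
    have z1 : G (x.1, x.2 + 1) = 0 := by
      by_contra hne
      obtain ⟨v, hv⟩ := Nat.exists_eq_succ_of_ne_zero hne
      have h1 := (hG _ v).mp hv
      have := nb i (x.1, x.2 + k + 1) (Or.inl (by rw [← hx])) v (by rw [h1.2]; exact congrArg some (Prod.ext rfl (by simp only; omega)))
      omega
    have z2 : G (x.1 + 1, x.2) = 0 := by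
      by_contra hne
      obtain ⟨v, hv⟩ := Nat.exists_eq_succ_of_ne_zero hne
      have h1 := (hG _ v).mp hv
      have := nb i _ (Or.inr (by rw [← hx])) v h1.2
      omega
    cases fuel with
    | zero => exact ⟨e1, hx⟩
    | succ fuel =>
      simp only [jdtSlide, z1, z2, and_self, if_true]
      exact ⟨e1, hx⟩
  | succ m ih =>
    intro i fuel G x hi hf hG hx
    by_cases hadj : ∃ s, g i = some s ∧ (s = ((holeJ h g i).1, (holeJ h g i).2 + 1) ∨
      s = ((holeJ h g i).1 + 1, (holeJ h g i).2))
    · obtain ⟨s, hgs, hs⟩ := hadj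
      obtain ⟨fuel, rfl⟩ : ∃ u, fuel = u + 1 := ⟨fuel - 1, by omega⟩
      have hJi : jst (holeJ h g i) (g i) = (s, some (holeJ h g i)) := by
        rw [hgs, jst_of_adj hs]
      have o1 : outJ h g i = some (holeJ h g i) := by simp only [outJ, hJi]
      have o2 : holeJ h g (i + 1) = s := by simp only [holeJ, hJi]
      have hmi : mixS h g i i = some s := by simp [mixS, hgs]
      have hsne : s ≠ holeJ h g i := by
        intro e
        exact (hg i s hgs).1 (by rw [e]; exact (hJ i).1.1)
      -- values
      have val : ∀ c : ℕ × ℕ, (c.1, c.2 + k) = s → G c = i + 1 := by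
        intro c hc
        exact (hG c i).mpr ⟨by omega, by rw [hmi, hc]⟩
      have fillnew : ∀ c : ℕ × ℕ, (c.1, c.2 + k) = s →
          IsFill k K (mixS h g (i + 1))
            (Function.update (Function.update G c 0) (x.1, x.2) (i + 1)) := by
        intro c hc d v
        by_cases hd : d = (x.1, x.2)
        · rw [hd, Function.update_self]
          have : ((x.1, x.2) : ℕ × ℕ).2 + k = x.2 + k := rfl
          simp only [hx]
          constructor
          · intro e
            have : v = i := by omega
            subst this
            refine ⟨by omega, ?_⟩
            simp only [mixS, if_pos (Nat.lt_succ_self v), o1]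
          · rintro ⟨h1, h2⟩
            by_contra hne
            rcases Nat.lt_or_ge v i with h3 | h3
            · simp only [mixS, if_pos (by omega : v < i + 1)] at h2
              exact (past i v _ h3 h2).2 rfl
            · simp only [mixS, if_neg (by omega : ¬ v < i + 1)] at h2
              exact future i v _ h3 h2 (hJ i).1.1
        · rw [Function.update_of_ne hd]
          have hdx : (d.1, d.2 + k) ≠ holeJ h g i := by
            rw [← hx]
            intro e
            simp only [Prod.mk.injEq] at e
            exact hd (Prod.ext e.1 (by simp only; omega))
          by_cases hdc : d = c
          · rw [hdc, Function.update_self, hc]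
            constructor
            · intro e; omega
            · rintro ⟨h1, h2⟩
              exfalso
              rcases Nat.lt_trichotomy v i with h3 | h3 | h3
              · simp only [mixS, if_pos (by omega : v < i + 1)] at h2
                exact (hg i s hgs).1 (past i v _ h3 h2).1
              · subst h3
                simp only [mixS, if_pos (Nat.lt_succ_self v), o1] at h2
                exact hsne (by simpa using h2.symm)
              · simp only [mixS, if_neg (by omega : ¬ v < i + 1)] at h2
                exact (hg v s h2).1 (mem_shp h3 hgs)
          · rw [Function.update_of_ne hdc, hG d v]
            have hds : (d.1, d.2 + k) ≠ s := by
              rw [← hc]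
              intro e
              simp only [Prod.mk.injEq] at e
              exact hdc (Prod.ext e.1 (by omega))
            refine and_congr_right fun hvK => ?_
            rcases Nat.lt_trichotomy v i with h3 | h3 | h3
            · simp only [mixS, if_pos (by omega : v < i + 1), if_pos h3]
            · subst h3
              rw [hmi]
              simp only [mixS, if_pos (Nat.lt_succ_self v), o1, Option.some.injEq]
              exact ⟨fun e => absurd e.symm hds, fun e => absurd e.symm hdx⟩
            · simp only [mixS, if_neg (by omega : ¬ v < i + 1), if_neg (by omega : ¬ v < i)]
      rcases hs with hs | hs
      · have v1 : G (x.1, x.2 + 1) = i + 1 := val _ (by rw [hs, ← hx]; exact Prod.ext rfl (by simp only; omega))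
        have v2 : G (x.1 + 1, x.2) = 0 ∨ i + 1 < G (x.1 + 1, x.2) := by
          rcases hv : G (x.1 + 1, x.2) with _ | v
          · exact Or.inl rfl
          · right
            have h1 := (hG _ v).mp hv
            have h2 := nb i _ (Or.inr (by rw [← hx])) v h1.2
            have : v ≠ i := by
              rintro rfl
              rw [hmi, hs, ← hx] at h1
              simp at h1
            omega
        have hc1 : ¬ (G (x.1, x.2 + 1) = 0 ∧ G (x.1 + 1, x.2) = 0) := by omega
        have hc2 : G (x.1 + 1, x.2) = 0 ∨ (G (x.1, x.2 + 1) ≠ 0 ∧ G (x.1, x.2 + 1) < G (x.1 + 1, x.2)) := by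
          omega
        simp only [jdtSlide, if_neg hc1, if_pos hc2]
        have hcs : (x.1, x.2 + 1 + k) = s := by rw [hs, ← hx]; exact Prod.ext rfl (by simp only; omega)
        rw [v1]
        exact ih (i + 1) fuel _ _ (by omega) (by omega) (fillnew (x.1, x.2 + 1) hcs) (by rw [o2]; exact hcs)
      · have v1 : G (x.1 + 1, x.2) = i + 1 := val _ (by rw [hs, ← hx])
        have v2 : G (x.1, x.2 + 1) = 0 ∨ i + 1 < G (x.1, x.2 + 1) := by
          rcases hv : G (x.1, x.2 + 1) with _ | v
          · exact Or.inl rfl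
          · right
            have h1 := (hG _ v).mp hv
            have h2 := nb i (x.1, x.2 + k + 1) (Or.inl (by rw [← hx])) v (by rw [h1.2]; exact congrArg some (Prod.ext rfl (by simp only; omega)))
            have : v ≠ i := by
              rintro rfl
              rw [hmi, hs, ← hx] at h1
              simp at h1
            omega
        have hc1 : ¬ (G (x.1, x.2 + 1) = 0 ∧ G (x.1 + 1, x.2) = 0) := by omega
        have hc2 : ¬ (G (x.1 + 1, x.2) = 0 ∨ (G (x.1, x.2 + 1) ≠ 0 ∧ G (x.1, x.2 + 1) < G (x.1 + 1, x.2))) := by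
          omega
        simp only [jdtSlide, if_neg hc1, if_neg hc2]
        have hcs : (x.1 + 1, x.2 + k) = s := by rw [hs, ← hx]
        rw [v1]
        exact ih (i + 1) fuel _ _ (by omega) (by omega) (fillnew (x.1 + 1, x.2) hcs) (by rw [o2]; exact hcs)
    · have hJi : jst (holeJ h g i) (g i) = (holeJ h g i, g i) := by
        rcases hgi : g i with _ | s
        · rfl
        · exact jst_of_not_adj (fun hc => hadj ⟨s, hgi, hc⟩)
      refine ih (i + 1) fuel G x (by omega) (by omega) ?_ ?_
      · convert hG using 1
        funext v
        simp only [mixS]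
        rcases Nat.lt_trichotomy v i with h3 | h3 | h3
        · rw [if_pos (by omega), if_pos h3]
        · subst h3
          rw [if_pos (by omega), if_neg (by omega)]
          simp only [outJ, hJi]
        · rw [if_neg (by omega), if_neg (by omega)]
      · simp only [holeJ, hJi]; exact hx

/-- the promoted stream -/
def proS (f : Stream') (p : Cell) (K : ℕ) : Stream' :=
  fun v => if v < K then outJ p (tl f) v else some (holeJ p (tl f) K)

theorem promote_link {k K : ℕ} {β : Finset Cell} (hβ : Idl β) {f : Stream'} (hf : Valid β f)
    (h0 : f 0 = some (0, k)) {F : ℕ × ℕ → ℕ} (hF : IsFill k (K + 1) f F) :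
    IsFill k (K + 1) (proS f (0, k) K) (promote (K + 1) F) := by
  have hv := hf.tl
  have ha := hf 0 _ h0
  simp only [shp] at ha
  rw [h0] at hv
  have hc := ha.corner hβ
  have hG : IsFill k K (mixS (0, k) (tl f) 0) (fun c => F c - 1) := by
    intro c v
    have := hF c (v + 1)
    simp only [mixS, Nat.not_lt_zero, if_false, tl]
    rw [show v < K ↔ v + 1 < K + 1 by omega, ← this]
    omega
  have := slide_link (hβ.insert ha) hv hc K 0 (K + 1) _ (0, 0) (by omega) (by omega) hG
    (by simp [holeJ])
  obtain ⟨h1, h2⟩ := this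
  unfold promote
  set R := jdtSlide (K + 1) (fun c => F c - 1) (0, 0) with hR
  simp only
  have hJ := holeJ_spec (hβ.insert ha) hv hc K
  intro c v
  by_cases hcR : c = R.2
  · rw [hcR, Function.update_self, h2]
    constructor
    · intro e
      obtain rfl : v = K := by omega
      exact ⟨by omega, by simp [proS]⟩
    · rintro ⟨h3, h4⟩
      by_contra hne
      simp only [proS, if_pos (by omega : v < K)] at h4
      have h5 : holeJ (0, k) (tl f) K ∈ shp ((insert (0,k) β).erase (0, k)) (outJ (0, k) (tl f)) K :=
        mem_shp (by omega) h4
      rw [hJ.2] at h5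
      simp at h5
  · rw [Function.update_of_ne hcR, h1 c v]
    constructor
    · rintro ⟨h3, h4⟩
      exact ⟨by omega, by simp only [proS, if_pos h3]; exact h4⟩
    · rintro ⟨h3, h4⟩
      by_cases h5 : v < K
      · simp only [proS, if_pos h5] at h4
        exact ⟨h5, h4⟩
      · exfalso
        simp only [proS, if_neg h5, Option.some.injEq] at h4
        rw [← h2] at h4
        simp only [Prod.mk.injEq] at h4
        exact hcR (Prod.ext h4.1.symm (by omega))

end HB

namespace HB

def wd (M : ℕ) (l : ℕ → ℕ) : List ℕ := (List.range M).map l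

theorem wd_succ (M : ℕ) (l : ℕ → ℕ) : wd (M + 1) l = wd M l ++ [l M] := by
  simp [wd, List.range_succ]

theorem wd_length (M : ℕ) (l : ℕ → ℕ) : (wd M l).length = M := by simp [wd]

theorem wd_congr {M : ℕ} {l l' : ℕ → ℕ} (h : ∀ i < M, l i = l' i) : wd M l = wd M l' := by
  simp only [wd]
  apply List.map_congr_left
  intro i hi
  exact h i (List.mem_range.mp hi)

theorem wd_getD (w : List ℕ) : w = wd w.length (fun i => w.getD i 0) := by
  apply List.ext_getElem
  · simp [wd]
  · intro i h1 h2
    simp [wd, h1]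

theorem wd_take {M i : ℕ} (h : i ≤ M) (l : ℕ → ℕ) : (wd M l).take i = wd i l := by
  simp only [wd, ← List.map_take, List.take_range, min_eq_left h]

theorem wd_drop_one (M : ℕ) (l : ℕ → ℕ) : (wd (M + 1) l).drop 1 = wd M (fun i => l (i + 1)) := by
  simp only [wd, List.range_succ_eq_map]
  simp

def cn (l : ℕ → ℕ) (x i : ℕ) : ℕ := (wd i l).count x

theorem cn_zero (l : ℕ → ℕ) (x : ℕ) : cn l x 0 = 0 := by simp [cn, wd]

theorem cn_succ (l : ℕ → ℕ) (x i : ℕ) : cn l x (i + 1) = cn l x i + if l i = x then 1 else 0 := by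
  simp only [cn, wd_succ, List.count_append, List.count_singleton]
  simp

/-- prefix condition -/
structure YW (n M : ℕ) (l : ℕ → ℕ) : Prop where
  pos : ∀ i < M, 1 ≤ l i ∧ l i ≤ n
  dom : ∀ i ≤ M, ∀ j, 1 ≤ j → j < n → cn l j i ≤ cn l (j + 1) i

def fS (n k M : ℕ) (l : ℕ → ℕ) : Stream' :=
  fun i => if i < M then some (n - l i, k + cn l (l i) i) else none

theorem shp_plain {n M : ℕ} {l : ℕ → ℕ} {g : Stream'} (hl : ∀ i < M, 1 ≤ l i ∧ l i ≤ n)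
    (hg : Valid (bst n) g) (hrow : ∀ i < M, ∃ c, g i = some (n - l i, c)) :
    ∀ i ≤ M, (∀ r c, (r, c) ∈ shp (bst n) g i ↔
      (r, c) ∈ bst n ∨ (r < n ∧ n ≤ c ∧ c < n + cn l (n - r) i)) := by
  intro i
  induction i with
  | zero =>
    intro _ r c
    simp only [shp, cn_zero]
    constructor
    · exact Or.inl
    · rintro (h | h)
      · exact h
      · omega
  | succ i ih =>
    intro hi r c
    have ih := ih (by omega)
    obtain ⟨c0, hc⟩ := hrow i (by omega)
    have hli := hl i (by omega)
    have hA := hg i _ hc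
    have hId := hg.idl (idl_bst n) i
    have h1 := (ih (n - l i) c0).not.mp hA.1
    rw [mem_bst] at h1
    have h0 := hA.2.1
    simp only at h0
    have hnn : n - (n - l i) = l i := by omega
    rw [hnn] at h1
    have hc0 : c0 = n + cn l (l i) i := by
      by_contra hne
      have h2 := hA.2.2.1 (by simp only; omega)
      simp only at h2
      rw [ih, mem_bst, hnn] at h2
      omega
    simp only [shp, hc, addO, Finset.mem_insert, Prod.mk.injEq]
    rw [ih, mem_bst, cn_succ]
    by_cases hr : r = n - l i
    · subst hr
      rw [hnn]
      simp only [if_true, true_and]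
      omega
    · by_cases hrn : r < n
      · rw [if_neg (by omega)]
        omega
      · omega

theorem plain_cell {n M : ℕ} {l : ℕ → ℕ} {g : Stream'} (hl : ∀ i < M, 1 ≤ l i ∧ l i ≤ n)
    (hg : Valid (bst n) g) (hrow : ∀ i < M, ∃ c, g i = some (n - l i, c)) :
    ∀ i < M, g i = fS n n M l i := by
  intro i hi
  have ih := shp_plain hl hg hrow i hi.le
  obtain ⟨c0, hc⟩ := hrow i hi
  have hli := hl i hi
  have hA := hg i _ hc
  have h1 := (ih (n - l i) c0).not.mp hA.1
  rw [mem_bst] at h1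
  have h0 := hA.2.1
  simp only at h0
  have hnn : n - (n - l i) = l i := by omega
  rw [hnn] at h1
  have hc0 : c0 = n + cn l (l i) i := by
    by_contra hne
    have h2 := hA.2.2.1 (by simp only; omega)
    simp only at h2
    rw [ih, mem_bst, hnn] at h2
    omega
  simp only [fS, if_pos hi]
  rw [hc, hc0]

theorem plain_YW {n M : ℕ} {l : ℕ → ℕ} {g : Stream'} (hl : ∀ i < M, 1 ≤ l i ∧ l i ≤ n)
    (hg : Valid (bst n) g) (hrow : ∀ i < M, ∃ c, g i = some (n - l i, c)) : YW n M l := by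
  refine ⟨hl, fun i hi j h1 h2 => ?_⟩
  have ih := shp_plain hl hg hrow i hi
  have hId := hg.idl (idl_bst n) i
  by_contra hlt
  have h3 : (n - j, n + cn l (j + 1) i) ∈ shp (bst n) g i := by
    rw [ih]; right
    refine ⟨by omega, by omega, ?_⟩
    rw [show n - (n - j) = j by omega]; omega
  have h4 := hId.2 _ _ (n - j - 1) (n + cn l (j + 1) i) h3 (by omega) le_rfl (by omega)
  rw [ih, mem_bst, show n - (n - j - 1) = j + 1 by omega] at h4
  omega

theorem fS_valid {n M : ℕ} {l : ℕ → ℕ} (h : YW n M l) : Valid (bst n) (fS n n M l) := by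
  -- by strong induction on the time
  have key : ∀ i ≤ M, (∀ r c, (r, c) ∈ shp (bst n) (fS n n M l) i ↔
      (r, c) ∈ bst n ∨ (r < n ∧ n ≤ c ∧ c < n + cn l (n - r) i)) := by
    intro i
    induction i with
    | zero =>
      intro _ r c
      simp only [shp, cn_zero]
      constructor
      · exact Or.inl
      · rintro (h | h)
        · exact h
        · omega
    | succ i ih =>
      intro hi r c
      have hli := h.pos i (by omega)
      simp only [shp, fS, if_pos (by omega : i < M), addO, Finset.mem_insert]
      have ih := ih (by omega) r c
      change ((r, c) = (_, _) ∨ (r, c) ∈ shp (bst n) (fS n n M l) i) ↔ _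
      rw [Prod.mk.injEq, ih, mem_bst, cn_succ]
      by_cases hr : r = n - l i
      · subst hr
        rw [show n - (n - l i) = l i by omega]
        simp only [if_true, true_and]
        omega
      · by_cases hrn : r < n
        · rw [if_neg (by omega)]
          omega
        · omega
  intro i s hs
  by_cases hi : i < M
  · have hli := h.pos i hi
    have hd := h.dom (i + 1) (by omega) (l i) hli.1
    have ki := key i hi.le
    simp only [fS, if_pos hi, Option.some.injEq] at hs
    subst hs
    refine ⟨?_, by simp only; omega, ?_, ?_⟩
    · rw [ki, mem_bst, show n - (n - l i) = l i by omega]; omega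
    · intro hlt
      simp only at hlt ⊢
      rw [ki, mem_bst, show n - (n - l i) = l i by omega]; omega
    · intro hlt
      simp only at hlt ⊢
      rw [ki, mem_bst, show n - (n - l i - 1) = l i + 1 by omega]
      have := hd (by omega)
      rw [cn_succ, cn_succ, if_pos rfl, if_neg (by omega)] at this
      omega
  · simp [fS, if_neg hi] at hs

theorem fS_row {n k M : ℕ} {l : ℕ → ℕ} : ∀ i < M, ∃ c, fS n k M l i = some (n - l i, c) := by
  intro i hi
  exact ⟨k + cn l (l i) i, by simp only [fS, if_pos hi]⟩

theorem holeJ_mono (h : Cell) (f : Stream') (i : ℕ) : h.2 ≤ (holeJ h f i).2 := by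
  induction i with
  | zero => exact le_rfl
  | succ i ih =>
    simp only [holeJ]
    rcases f i with _ | s
    · exact ih
    · simp only [jst]
      split_ifs with hc
      · rcases hc with rfl | rfl
        · simp only; omega
        · simp only; omega
      · exact ih

section hole
variable {n M : ℕ} {l : ℕ → ℕ}

/-- the hole in the plain stream -/
def hol (n M : ℕ) (l : ℕ → ℕ) (i : ℕ) : Cell := holeJ (0, n) (tl (fS n n (M + 1) l)) i

theorem hol_shape (hn : 0 < n) (h : YW n (M + 1) l) (h0 : l 0 = n) :
    ∀ i, Corner (hol n M l i) (shp (bst n) (fS n n (M + 1) l) (i + 1)) ∧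
      shp (bst n) (outJ (0, n) (tl (fS n n (M + 1) l))) i =
        (shp (bst n) (fS n n (M + 1) l) (i + 1)).erase (hol n M l i) ∧
      Valid (bst n) (outJ (0, n) (tl (fS n n (M + 1) l))) := by
  intro i
  have hv := fS_valid h
  have hf0 : fS n n (M + 1) l 0 = some (0, n) := by
    simp [fS, h0, cn_zero]
  have ha := hv 0 _ hf0
  simp only [shp] at ha
  have hv2 := hv.tl
  rw [hf0] at hv2
  have hJ := holeJ_spec ((idl_bst n).insert ha) hv2 (ha.corner (idl_bst n)) i
  have hV := outJ_valid ((idl_bst n).insert ha) hv2 (ha.corner (idl_bst n))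
  rw [Finset.erase_insert ha.1] at hJ hV
  rw [shp_tl, hf0]
  exact ⟨hJ.1, hJ.2, hV⟩

theorem hol_fact (hn : 0 < n) (h : YW n (M + 1) l) (h0 : l 0 = n) {i : ℕ} (hi : i ≤ M) :
    (hol n M l i).1 < n ∧ 1 ≤ cn l (n - (hol n M l i).1) (i + 1) ∧
    (hol n M l i).2 + 1 = n + cn l (n - (hol n M l i).1) (i + 1) ∧
    ((hol n M l i).1 + 1 < n → cn l (n - (hol n M l i).1 - 1) (i + 1) + 1 ≤
      cn l (n - (hol n M l i).1) (i + 1)) := by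
  have hk := shp_plain h.pos (fS_valid h) fS_row (i + 1) (by omega)
  obtain ⟨⟨c1, c2, c3⟩, -⟩ := hol_shape hn h h0 i
  have hm := holeJ_mono (0, n) (tl (fS n n (M + 1) l)) i
  change n ≤ (hol n M l i).2 at hm
  generalize hol n M l i = p at *
  obtain ⟨r, c⟩ := p
  simp only at *
  rw [hk, mem_bst] at c1 c2 c3
  have hr : r < n := by omega
  refine ⟨hr, by omega, by omega, fun h3 => ?_⟩
  rw [show n - (r + 1) = n - r - 1 by omega] at c3
  omega

theorem hol_trans (hn : 0 < n) (h : YW n (M + 1) l) (h0 : l 0 = n) {i : ℕ} (hi : i < M) :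
    ((hol n M l (i + 1)).1 = (hol n M l i).1 + 1 ∧ l (i + 1) + (hol n M l i).1 + 1 = n ∧
      cn l (n - (hol n M l i).1 - 1) (i + 1) + 1 = cn l (n - (hol n M l i).1) (i + 1) ∧
      outJ (0, n) (tl (fS n n (M + 1) l)) i = some (hol n M l i)) ∨
    ((hol n M l (i + 1)).1 = (hol n M l i).1 ∧
      ¬ (l (i + 1) + (hol n M l i).1 + 1 = n ∧
        cn l (n - (hol n M l i).1 - 1) (i + 1) + 1 = cn l (n - (hol n M l i).1) (i + 1)) ∧
      ∃ c, outJ (0, n) (tl (fS n n (M + 1) l)) i = some (n - l (i + 1), c)) := by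
  obtain ⟨k1, k2, k3, k4⟩ := hol_fact hn h h0 (i := i) (by omega)
  have hp := h.pos (i + 1) (by omega)
  have hg : tl (fS n n (M + 1) l) i = some (n - l (i + 1), n + cn l (l (i + 1)) (i + 1)) := by
    simp only [tl, fS, if_pos (by omega : i + 1 < M + 1)]
  have e1 : hol n M l (i + 1) = (jst (hol n M l i) (tl (fS n n (M + 1) l) i)).1 := rfl
  have e2 : outJ (0, n) (tl (fS n n (M + 1) l)) i =
    (jst (hol n M l i) (tl (fS n n (M + 1) l) i)).2 := rfl
  rw [e1, e2, hg]
  generalize hol n M l i = p at *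
  obtain ⟨r, c⟩ := p
  simp only at *
  by_cases hr : n - l (i + 1) = r + 1
  · have hl : l (i + 1) = n - r - 1 := by omega
    by_cases hd : cn l (n - r - 1) (i + 1) + 1 = cn l (n - r) (i + 1)
    · left
      rw [jst_of_adj (Or.inr (by rw [hl]; simp only [Prod.mk.injEq]; omega))]
      refine ⟨hr, by omega, hd, rfl⟩
    · right
      rw [jst_of_not_adj (by rw [hl]; simp only [Prod.mk.injEq]; omega)]
      exact ⟨rfl, by omega, _, rfl⟩
  · right
    by_cases hr2 : n - l (i + 1) = r
    · have hl : l (i + 1) = n - r := by omega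
      rw [jst_of_adj (Or.inl (by rw [hl]; simp only [Prod.mk.injEq]; omega))]
      refine ⟨by simp only; omega, by omega, c, by rw [hr2]⟩
    · rw [jst_of_not_adj (by simp only [Prod.mk.injEq]; omega)]
      exact ⟨rfl, by omega, _, rfl⟩

/-- letters of the intermediate word `u_ρ` -/
def ul (n M : ℕ) (l : ℕ → ℕ) (ρ i : ℕ) : ℕ :=
  l (i + 1) + if (hol n M l (i + 1)).1 ≠ (hol n M l i).1 ∧ (hol n M l i).1 < ρ then 1 else 0

theorem unp_wd (j : ℕ) (u : ℕ → ℕ) (m : ℕ) :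
    ∃ S : ℕ → ℕ × Option ℕ, S 0 = (0, none) ∧
    (∀ i, S (i + 1) = (if u i = j + 1 then ((S i).1 + 1, (S i).2)
      else if u i = j then (if 0 < (S i).1 then ((S i).1 - 1, (S i).2) else (0, some i))
      else S i)) ∧ unpairedPos j (wd m u) = (S m).2 := by
  refine ⟨fun m => ((List.range m).zip (wd m u)).foldl
    (fun (s : ℕ × Option ℕ) p =>
      if p.2 = j + 1 then (s.1 + 1, s.2)
      else if p.2 = j then (if 0 < s.1 then (s.1 - 1, s.2) else (0, some p.1))
      else s)
    (0, none), ?_, ?_, ?_⟩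
  · simp
  · intro i
    simp only
    rw [List.range_succ, wd_succ, List.zip_append (by simp [wd_length]), List.foldl_append]
    simp
  · simp only [unpairedPos, wd_length]

theorem cryE_step (hn : 0 < n) (h : YW n (M + 1) l) (h0 : l 0 = n) {ρ : ℕ} (hρ : ρ + 1 < n)
    (hend : (hol n M l M).1 = n - 1) :
    cryE (n - 1 - ρ) (wd M (ul n M l ρ)) = wd M (ul n M l (ρ + 1)) := by
  set j := n - 1 - ρ with hj
  obtain ⟨S, hS0, hS, hU⟩ := unp_wd j (ul n M l ρ) M
  have inv : ∀ i ≤ M,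
      ((hol n M l i).1 < ρ → (S i).1 + cn l j (i + 1) = cn l (j + 1) (i + 1) ∧ (S i).2 = none) ∧
      ((hol n M l i).1 = ρ → (S i).1 + cn l j (i + 1) + 1 = cn l (j + 1) (i + 1) ∧ (S i).2 = none) ∧
      (ρ < (hol n M l i).1 → (S i).1 + cn l j (i + 1) = cn l (j + 1) (i + 1) ∧ (S i).2 ≠ none) ∧
      (∀ t, (S i).2 = some t ↔ t < i ∧ (hol n M l (t + 1)).1 ≠ (hol n M l t).1 ∧
        (hol n M l t).1 = ρ) ∧ (∀ t, (S i).2 = some t → l (t + 1) = j) := by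
    intro i
    induction i with
    | zero =>
      intro _
      have hh : hol n M l 0 = (0, n) := rfl
      rw [hS0, hh]
      simp only [cn_succ, cn_zero, h0]
      refine ⟨fun hr => ⟨?_, trivial⟩, fun hr => ⟨?_, trivial⟩, fun hr => by omega, ?_, ?_⟩
      · rw [if_neg (by omega), if_neg (by omega)]
      · rw [if_neg (by omega), if_pos (by omega)]
      · intro t; simp
      · intro t; simp
    | succ i ih =>
      intro hi
      obtain ⟨i1, i2, i3, i4, i5⟩ := ih (by omega)
      obtain ⟨k1, k2, k3, k4⟩ := hol_fact hn h h0 (i := i) (by omega)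
      have hT := hol_trans hn h h0 (i := i) (by omega)
      have hp := h.pos (i + 1) (by omega)
      have hdom := h.dom (i + 2) (by omega) j (by omega) (by omega)
      have cj := cn_succ l j (i + 1)
      have cj1 := cn_succ l (j + 1) (i + 1)
      have hSi := hS i
      rw [show i + 1 + 1 = i + 2 from rfl] at *
      rw [cj, cj1] at hdom
      rcases Nat.lt_trichotomy (hol n M l i).1 ρ with hr | hr | hr
      · -- before
        obtain ⟨d1, d2⟩ := i1 hr
        have i4' : ∀ t, ¬ (t < i ∧ (hol n M l (t + 1)).1 ≠ (hol n M l t).1 ∧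
            (hol n M l t).1 = ρ) := by
          intro t ht
          have := (i4 t).mpr ht
          rw [d2] at this
          cases this
        have goal2 : S (i + 1) = ((S (i + 1)).1, none) →
            ((∀ t, (S (i + 1)).2 = some t ↔ t < i + 1 ∧
              (hol n M l (t + 1)).1 ≠ (hol n M l t).1 ∧
              (hol n M l t).1 = ρ) ∧ (∀ t, (S (i + 1)).2 = some t → l (t + 1) = j)) := by
          intro e
          rw [e]
          refine ⟨fun t => ⟨fun h => by simp at h, fun ht => ?_⟩, fun t h => by simp at h⟩
          exfalso
          by_cases e2 : t = i
          · subst e2; omega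
          · exact i4' t ⟨by omega, ht.2⟩
        rcases hT with ⟨t1, t2, t3, -⟩ | ⟨t1, t2, -⟩
        · have hu : ul n M l ρ i = l (i + 1) + 1 := by
            simp only [ul]; rw [if_pos ⟨by omega, hr⟩]
          rw [hu, if_neg (by omega), if_neg (by omega)] at hSi
          rw [if_neg (by omega)] at cj
          have goal3 := goal2 (by rw [hSi]; exact Prod.ext rfl d2)
          refine ⟨fun h1 => ?_, fun h1 => ?_, fun h1 => by omega, goal3.1, goal3.2⟩
          · rw [if_neg (by omega)] at cj1
            rw [hSi]
            exact ⟨by omega, d2⟩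
          · rw [if_pos (by omega)] at cj1
            rw [hSi]
            exact ⟨by omega, d2⟩
        · have hu : ul n M l ρ i = l (i + 1) := by
            simp only [ul]; rw [if_neg (by omega)]; rfl
          rw [hu] at hSi
          have hfin : (S (i + 1)).1 + cn l j (i + 2) = cn l (j + 1) (i + 2) ∧ (S (i+1)).2 = none := by
            by_cases c1 : l (i + 1) = j + 1
            · rw [if_pos c1] at hSi cj1
              rw [if_neg (by omega)] at cj
              rw [hSi]; exact ⟨by simp only; omega, d2⟩
            · rw [if_neg c1] at hSi cj1
              by_cases c2 : l (i + 1) = j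
              · rw [if_pos c2] at hSi cj hdom
                rw [if_neg c1] at hdom
                rw [if_pos (by omega)] at hSi
                rw [hSi]; exact ⟨by simp only; omega, d2⟩
              · rw [if_neg c2] at hSi cj
                rw [hSi]; exact ⟨by omega, d2⟩
          have goal3 := goal2 (Prod.ext rfl hfin.2)
          refine ⟨fun h1 => hfin, fun h1 => by omega, fun h1 => by omega, goal3.1, goal3.2⟩
      · -- in row ρ
        obtain ⟨d1, d2⟩ := i2 hr
        have hu : ul n M l ρ i = l (i + 1) := by
            simp only [ul]; rw [if_neg (by omega)]; rfl
        rw [hu] at hSi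
        have hj1 : n - (hol n M l i).1 = j + 1 := by omega
        rw [hj1] at hT
        simp only [Nat.add_sub_cancel] at hT
        have i4' : ∀ t, ¬ (t < i ∧ (hol n M l (t + 1)).1 ≠ (hol n M l t).1 ∧
            (hol n M l t).1 = ρ) := by
          intro t ht
          have := (i4 t).mpr ht
          rw [d2] at this
          cases this
        rcases hT with ⟨t1, t2, t3, -⟩ | ⟨t1, t2, -⟩
        · have hlj : l (i + 1) = j := by omega
          rw [if_neg (by omega), if_pos hlj, if_neg (by omega)] at hSi
          rw [if_pos hlj] at cj
          rw [if_neg (by omega)] at cj1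
          rw [hSi]
          refine ⟨fun h1 => by omega, fun h1 => by omega, fun h1 => ⟨by simp only; omega, by simp⟩, ?_, ?_⟩
          · intro t
            simp only [Option.some.injEq]
            constructor
            · rintro rfl; exact ⟨by omega, by omega, hr⟩
            · intro ht
              by_contra hne
              exact i4' t ⟨by omega, ht.2⟩
          · intro t ht
            simp only [Option.some.injEq] at ht
            subst ht; exact hlj
        · have hfin : (S (i + 1)).1 + cn l j (i + 2) + 1 = cn l (j + 1) (i + 2) ∧ (S (i+1)).2 = none := by
            by_cases c1 : l (i + 1) = j + 1
            · rw [if_pos c1] at hSi cj1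
              rw [if_neg (by omega)] at cj
              rw [hSi]; exact ⟨by simp only; omega, d2⟩
            · rw [if_neg c1] at hSi cj1
              by_cases c2 : l (i + 1) = j
              · rw [if_pos c2] at hSi cj hdom
                rw [if_pos (by omega)] at hSi
                rw [hSi]; exact ⟨by simp only; omega, d2⟩
              · rw [if_neg c2] at hSi cj
                rw [hSi]; exact ⟨by omega, d2⟩
          refine ⟨fun h1 => by omega, fun h1 => hfin, fun h1 => by omega, ?_, ?_⟩
          · intro t
            rw [hfin.2]
            refine ⟨fun h => by simp at h, fun ht => ?_⟩
            exfalso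
            by_cases e2 : t = i
            · subst e2; omega
            · exact i4' t ⟨by omega, ht.2⟩
          · intro t ht; rw [hfin.2] at ht; cases ht
      · -- after
        obtain ⟨d1, d2⟩ := i3 hr
        have hu : ul n M l ρ i = l (i + 1) := by
            simp only [ul]; rw [if_neg (by omega)]; rfl
        rw [hu] at hSi
        have hge : ρ < (hol n M l (i + 1)).1 := by omega
        have hfin : (S (i + 1)).1 + cn l j (i + 2) = cn l (j + 1) (i + 2) ∧ (S (i+1)).2 = (S i).2 := by
          by_cases c1 : l (i + 1) = j + 1
          · rw [if_pos c1] at hSi cj1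
            rw [if_neg (by omega)] at cj
            rw [hSi]; exact ⟨by simp only; omega, rfl⟩
          · rw [if_neg c1] at hSi cj1
            by_cases c2 : l (i + 1) = j
            · rw [if_pos c2] at hSi cj hdom
              rw [if_neg c1] at hdom
              rw [if_pos (by omega)] at hSi
              rw [hSi]; exact ⟨by simp only; omega, rfl⟩
            · rw [if_neg c2] at hSi cj
              rw [hSi]; exact ⟨by omega, rfl⟩
        rw [hfin.2]
        refine ⟨fun h1 => by omega, fun h1 => by omega, fun h1 => ⟨hfin.1, d2⟩, ?_, i5⟩
        intro t
        rw [i4 t]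
        constructor
        · rintro ⟨h1, h2⟩; exact ⟨by omega, h2⟩
        · rintro ⟨h1, h2⟩
          refine ⟨?_, h2⟩
          by_contra hne
          have : t = i := by omega
          subst this; omega
  obtain ⟨-, -, i3, i4, i5⟩ := inv M le_rfl
  obtain ⟨-, d2⟩ := i3 (by omega)
  obtain ⟨t, ht⟩ := Option.ne_none_iff_exists'.mp d2
  have i4t := (i4 t).mp ht
  have i5t := i5 t ht
  simp only [cryE, hU, ht]
  apply List.ext_getElem
  · simp [wd_length]
  · intro m h1 h2
    have hm : m < M := by simpa [wd_length] using h2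
    rw [List.getElem_set]
    simp only [wd, List.getElem_map, List.getElem_range]
    split_ifs with e
    · subst e
      simp only [ul]
      rw [if_pos ⟨i4t.2.1, by omega⟩, i5t]
    · simp only [ul]
      congr 1
      have : ¬ ((hol n M l (m + 1)).1 ≠ (hol n M l m).1 ∧ (hol n M l m).1 = ρ) := by
        intro hc
        have := (i4 m).mpr ⟨hm, hc⟩
        rw [ht] at this
        exact e (by simpa using this)
      by_cases hc : (hol n M l (m + 1)).1 ≠ (hol n M l m).1 ∧ (hol n M l m).1 < ρ
      · rw [if_pos hc, if_pos ⟨hc.1, by omega⟩]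
      · rw [if_neg hc, if_neg (by
          rintro ⟨a, b⟩
          by_cases e3 : (hol n M l m).1 = ρ
          · exact this ⟨a, e3⟩
          · exact hc ⟨a, by omega⟩)]

theorem cryEbar_eq (hn : 0 < n) (h : YW n (M + 1) l) (h0 : l 0 = n)
    (hend : (hol n M l M).1 = n - 1) :
    cryEbar n (wd M (fun i => l (i + 1))) = wd M (ul n M l (n - 1)) := by
  have key : ∀ m ≤ n - 1, ((List.range m).reverse.foldl (fun v i => cryE (i + 1) v)
      (wd M (ul n M l (n - 1 - m)))) = wd M (ul n M l (n - 1)) := by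
    intro m
    induction m with
    | zero => intro _; simp
    | succ m ih =>
      intro hm
      rw [List.range_succ, List.reverse_append]
      simp only [List.reverse_singleton, List.singleton_append, List.foldl_cons]
      have := cryE_step hn h h0 (ρ := n - 1 - (m + 1)) (by omega) hend
      rw [show n - 1 - (n - 1 - (m + 1)) = m + 1 by omega,
        show n - 1 - (m + 1) + 1 = n - 1 - m by omega] at this
      rw [this]
      exact ih (by omega)
  have := key (n - 1) le_rfl
  rw [← this]
  simp only [cryEbar]
  congr 2
  funext i
  simp [ul]

end hole

end HB

namespace HB

theorem countP_Icc (n : ℕ) (w : List ℕ) :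
    w.countP (fun x => decide (x ∈ Finset.Icc 1 n)) = ∑ j ∈ Finset.Icc 1 n, w.count j := by
  induction w with
  | nil => simp
  | cons a w ih =>
    rw [List.countP_cons, ih]
    simp only [List.count_cons, Finset.sum_add_distrib]
    congr 1
    simp

/-- data of a square word -/
structure SqW (n M : ℕ) (l : ℕ → ℕ) : Prop extends YW n (M + 1) l where
  npos : 0 < n
  sz : M + 1 = n * n
  tot : ∀ j, 1 ≤ j → j ≤ n → cn l j (M + 1) = n
  fst : l 0 = n

theorem sq_data {n : ℕ} (hn : 0 < n) {w : List ℕ} (hw : IsSquareWord n w) :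
    ∃ M l, w = wd (M + 1) l ∧ SqW n M l := by
  obtain ⟨h1, h2, h3⟩ := hw
  have hpos : 0 < n * n := Nat.mul_pos hn hn
  refine ⟨n * n - 1, fun i => w.getD i 0, ?_, ?_⟩
  · rw [show n * n - 1 + 1 = w.length by omega]; exact wd_getD w
  · have hsz : n * n - 1 + 1 = n * n := by omega
    have hwd : w = wd (n * n) (fun i => w.getD i 0) := by rw [← h1]; exact wd_getD w
    have hall : ∀ x ∈ w, 1 ≤ x ∧ x ≤ n := by
      have := countP_Icc n w
      rw [Finset.sum_congr rfl (g := fun _ => n)] at this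
      · simp only [Finset.sum_const, Nat.card_Icc, smul_eq_mul, Nat.add_sub_cancel] at this
        rw [← h1, List.countP_eq_length] at this
        intro x hx
        simpa using this x hx
      · intro j hj
        rw [Finset.mem_Icc] at hj
        exact h2 j hj.1 hj.2
    have hpos' : ∀ i < n * n, 1 ≤ w.getD i 0 ∧ w.getD i 0 ≤ n := by
      intro i hi
      have : w.getD i 0 ∈ w := by
        rw [List.getD_eq_getElem _ _ (by omega)]
        exact List.getElem_mem _
      exact hall _ this
    have hcn : ∀ i ≤ n * n, ∀ j, cn (fun i => w.getD i 0) j i = (w.take i).count j := by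
      intro i hi j
      conv_rhs => rw [hwd, wd_take hi]
      rfl
    have hdom : ∀ i ≤ n * n, ∀ j, 1 ≤ j → j < n →
        cn (fun i => w.getD i 0) j i ≤ cn (fun i => w.getD i 0) (j + 1) i := by
      intro i hi j a b
      rw [hcn i hi, hcn i hi]; exact h3 i j a b
    refine ⟨⟨?_, ?_⟩, hn, hsz, ?_, ?_⟩
    · rw [hsz]; exact hpos'
    · rw [hsz]; exact hdom
    · intro j a b
      rw [hsz, hcn _ le_rfl, ← h1, List.take_length]
      exact h2 j a b
    · have a := hpos' 0 hpos
      by_contra hne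
      have hne' : w.getD 0 0 ≠ n := hne
      have := hdom 1 (by omega) (w.getD 0 0) a.1 (by omega)
      rw [cn_succ, cn_succ, cn_zero, cn_zero] at this
      simp at this

variable {n M : ℕ} {l : ℕ → ℕ}

theorem SqW.isSquare (h : SqW n M l) : IsSquareWord n (wd (M + 1) l) := by
  refine ⟨by rw [wd_length, h.sz], h.tot, ?_⟩
  intro k j a b
  rcases Nat.le_total k (M + 1) with hk | hk
  · rw [wd_take hk]; exact h.dom k hk j a b
  · rw [List.take_of_length_le (by rw [wd_length]; exact hk)]
    exact h.dom (M + 1) le_rfl j a b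

theorem SqW.hol_end (h : SqW n M l) : hol n M l M = (n - 1, n + (n - 1)) := by
  obtain ⟨k1, k2, k3, k4⟩ := hol_fact h.npos h.toYW h.fst (i := M) le_rfl
  have hn := h.npos
  have t1 := h.tot (n - (hol n M l M).1) (by omega) (by omega)
  have hr : (hol n M l M).1 = n - 1 := by
    by_contra hne
    have t2 := h.tot (n - (hol n M l M).1 - 1) (by omega) (by omega)
    have := k4 (by omega)
    omega
  ext
  · exact hr
  · simp only; omega

/-- letters of the promoted word -/
def pl (n M : ℕ) (l : ℕ → ℕ) (i : ℕ) : ℕ := if i < M then ul n M l (n - 1) i else 1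

theorem pl_wd : wd (M + 1) (pl n M l) = wd M (ul n M l (n - 1)) ++ [1] := by
  rw [wd_succ]
  congr 1
  · apply wd_congr
    intro i hi
    simp [pl, hi]
  · simp [pl]

theorem SqW.cryEbar (h : SqW n M l) :
    cryEbar n ((wd (M + 1) l).drop 1) ++ [1] = wd (M + 1) (pl n M l) := by
  rw [wd_drop_one, cryEbar_eq h.npos h.toYW h.fst (by rw [h.hol_end]), pl_wd]

theorem SqW.out_row (h : SqW n M l) : ∀ i < M, (1 ≤ pl n M l i ∧ pl n M l i ≤ n) ∧
    ∃ c, outJ (0, n) (tl (fS n n (M + 1) l)) i = some (n - pl n M l i, c) := by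
  intro i hi
  have hp := h.pos (i + 1) (by omega)
  obtain ⟨k1, -⟩ := hol_fact h.npos h.toYW h.fst (i := i + 1) (by omega)
  simp only [pl, if_pos hi, ul]
  rcases hol_trans h.npos h.toYW h.fst hi with ⟨t1, t2, t3, t4⟩ | ⟨t1, t2, c, t3⟩
  · rw [if_pos ⟨by omega, by omega⟩]
    refine ⟨by omega, (hol n M l i).2, ?_⟩
    rw [t4]
    congr 1
    ext
    · simp only; omega
    · rfl
  · rw [if_neg (by omega)]
    refine ⟨by omega, c, ?_⟩
    rw [t3]; rfl

theorem SqW.pl_cn (h : SqW n M l) {j : ℕ} (h1 : 1 ≤ j) (h2 : j ≤ n) :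
    cn (pl n M l) j M + (if j = 1 then 1 else 0) = n := by
  have hs := hol_shape h.npos h.toYW h.fst M
  have e1 := shp_plain (fun i hi => (h.out_row i hi).1) hs.2.2 (fun i hi => (h.out_row i hi).2) M le_rfl
  have e2 := shp_plain h.pos (fS_valid h.toYW) fS_row (M + 1) le_rfl
  rw [hs.2.1, h.hol_end] at e1
  have key : ∀ c, n ≤ c → (c < n + cn (pl n M l) j M ↔ c < n + n ∧ ¬ (j = 1 ∧ c = n + (n - 1))) := by
    intro c hc
    have a := e1 (n - j) c
    rw [Finset.mem_erase, e2, mem_bst, show n - (n - j) = j by omega, h.tot j h1 h2] at a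
    simp only [ne_eq, Prod.mk.injEq] at a
    constructor
    · intro hlt
      have := a.mpr (Or.inr ⟨by omega, hc, hlt⟩)
      omega
    · intro hlt
      have := a.mp ⟨by omega, Or.inr ⟨by omega, hc, hlt.1⟩⟩
      omega
  have k1 := key (n + cn (pl n M l) j M) (by omega)
  have k4 := key (n + n) (by omega)
  have hn := h.npos
  split_ifs with hj
  · have k2 := key (n + n - 2)
    have k3 := key (n + n - 1) (by omega)
    omega
  · have k3 := key (n + n - 1) (by omega)
    omega

theorem SqW.pl_sq (h : SqW n M l) : SqW n M (pl n M l) := by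
  have hs := hol_shape h.npos h.toYW h.fst M
  have hY := plain_YW (fun i hi => (h.out_row i hi).1) hs.2.2 (fun i hi => (h.out_row i hi).2)
  have hn := h.npos
  have hM : pl n M l M = 1 := by simp [pl]
  have tot : ∀ j, 1 ≤ j → j ≤ n → cn (pl n M l) j (M + 1) = n := by
    intro j h1 h2
    rw [cn_succ, hM]
    have := h.pl_cn h1 h2
    by_cases hj : j = 1
    · rw [if_pos hj] at this; rw [if_pos hj.symm]; exact this
    · rw [if_neg hj] at this; rw [if_neg (fun e => hj e.symm)]; exact this
  have pos : ∀ i < M + 1, 1 ≤ pl n M l i ∧ pl n M l i ≤ n := by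
    intro i hi
    by_cases hi2 : i < M
    · exact hY.pos i hi2
    · obtain rfl : i = M := by omega
      rw [hM]; omega
  have dom : ∀ i ≤ M + 1, ∀ j, 1 ≤ j → j < n → cn (pl n M l) j i ≤ cn (pl n M l) (j + 1) i := by
    intro i hi j h1 h2
    by_cases hi2 : i ≤ M
    · exact hY.dom i hi2 j h1 h2
    · obtain rfl : i = M + 1 := by omega
      rw [tot j h1 h2.le, tot (j + 1) (by omega) h2]
  refine ⟨⟨pos, dom⟩, hn, h.sz, tot, ?_⟩
  by_contra hne
  have a := pos 0 (by omega)
  have := dom 1 (by omega) _ a.1 (by omega)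
  rw [cn_succ, cn_succ, cn_zero, cn_zero] at this
  simp at this

theorem SqW.pl_stream (h : SqW n M l) : ∀ i < M + 1,
    proS (fS n n (M + 1) l) (0, n) M i = fS n n (M + 1) (pl n M l) i := by
  intro i hi
  have hs := hol_shape h.npos h.toYW h.fst M
  have hn := h.npos
  by_cases hi2 : i < M
  · have := plain_cell (fun i hi => (h.out_row i hi).1) hs.2.2 (fun i hi => (h.out_row i hi).2) i hi2
    simp only [proS, if_pos hi2, this]
    simp only [fS, if_pos hi2, if_pos hi]
  · obtain rfl : i = M := by omega
    have e : holeJ (0, n) (tl (fS n n (i + 1) l)) i = _ := h.hol_end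
    simp only [proS, if_neg hi2, fS, if_pos hi] at e ⊢
    have hM : pl n i l i = 1 := by simp [pl]
    have := h.pl_cn le_rfl hn
    simp only [if_true] at this
    rw [hM, e]
    congr 2
    omega

end HB

namespace HB

theorem setBox_cons (row : List ℕ) (T : List (List ℕ)) (r j v : ℕ) :
    setBox (row :: T) (r + 1) j v = row :: setBox T r j v := by
  simp only [setBox, List.length_cons, Nat.add_lt_add_iff_right, Nat.add_sub_add_right]
  split_ifs <;> simp

theorem setBox_new {T : List (List ℕ)} {ρ κ : ℕ} (v : ℕ) (h1 : ρ ≤ T.length)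
    (h2 : (T.getD ρ []).length = κ) :
    (∀ r, (setBox T ρ κ v).getD r [] = if r = ρ then T.getD ρ [] ++ [v] else T.getD r []) ∧
    tsize (setBox T ρ κ v) = tsize T + 1 ∧
    (setBox T ρ κ v).length = max T.length (ρ + 1) := by
  induction T generalizing ρ with
  | nil =>
    obtain rfl : ρ = 0 := by simpa using h1
    simp at h2
    subst h2
    refine ⟨?_, ?_, ?_⟩
    · intro r
      cases r <;> simp [setBox, padSet]
    · simp [setBox, padSet, tsize]
    · simp [setBox]
  | cons row T ih =>
    cases ρ with
    | zero =>
      simp only [List.getD_cons_zero] at h2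
      subst h2
      refine ⟨?_, ?_, ?_⟩
      · intro r
        cases r <;> simp [setBox, padSet]
      · simp [setBox, padSet, tsize]; omega
      · simp [setBox]
    | succ ρ =>
      rw [setBox_cons]
      simp only [List.getD_cons_succ, List.length_cons] at h2 h1
      obtain ⟨a, b, c⟩ := ih (by omega) h2
      refine ⟨?_, ?_, ?_⟩
      · intro r
        cases r with
        | zero => simp
        | succ r => simp only [List.getD_cons_succ, a]; simp
      · simp only [tsize, List.map_cons, List.sum_cons] at b ⊢
        omega
      · simp only [List.length_cons, c]; omega

theorem getD_append_one (l : List ℕ) (v c : ℕ) :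
    (l ++ [v]).getD c 0 = if c = l.length then v else l.getD c 0 := by
  rcases lt_trichotomy c l.length with h | h | h
  · rw [if_neg (by omega), List.getD_append _ _ _ _ h]
  · subst h; simp
  · rw [if_neg (by omega), List.getD_eq_default _ _ (by simp; omega),
      List.getD_eq_default _ _ (by omega)]

theorem getD_set_one (l : List ℕ) {j : ℕ} (hj : j < l.length) (v c : ℕ) :
    (l.set j v).getD c 0 = if c = j then v else l.getD c 0 := by
  simp only [List.getD_eq_getElem?_getD, List.getElem?_set]
  by_cases h1 : j = c
  · subst h1; simp [hj]
  · rw [if_neg h1, if_neg (fun e => h1 e.symm)]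

theorem findIdx?_some {l : List ℕ} {p : ℕ → Bool} {j : ℕ} (hj : j < l.length)
    (h1 : p (l.getD j 0) = true) (h2 : ∀ c < j, p (l.getD c 0) = false) :
    l.findIdx? p = some j := by
  rw [List.findIdx?_eq_some_iff_getElem]
  refine ⟨hj, ?_, ?_⟩
  · rw [List.getD_eq_getElem _ _ hj] at h1; exact h1
  · intro c hc
    have := h2 c hc
    rw [List.getD_eq_getElem _ _ (by omega)] at this
    simp [this]

theorem findIdx?_none {l : List ℕ} {p : ℕ → Bool}
    (h2 : ∀ c < l.length, p (l.getD c 0) = false) :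
    l.findIdx? p = none := by
  rw [List.findIdx?_eq_none_iff]
  intro x hx
  obtain ⟨c, hc, rfl⟩ := List.getElem_of_mem hx
  have := h2 c hc
  rwa [List.getD_eq_getElem _ _ hc] at this

theorem rsk_spec : ∀ (T : List (List ℕ)) (x κ ρ : ℕ), ρ ≤ T.length →
    (∀ r < ρ, κ < (T.getD r []).length ∧ (T.getD r []).getD κ 0 = x + r + 1 ∧
      ∀ c < κ, (T.getD r []).getD c 0 ≤ x + r) →
    ((T.getD ρ []).length = κ ∧ ∀ c < κ, (T.getD ρ []).getD c 0 ≤ x + ρ) →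
    (rskInsert x T).length = max T.length (ρ + 1) ∧
    ∀ r, ((rskInsert x T).getD r []).length = (if r = ρ then κ + 1 else (T.getD r []).length) ∧
      ∀ c, ((rskInsert x T).getD r []).getD c 0 =
        if c = κ ∧ r ≤ ρ then x + r else (T.getD r []).getD c 0 := by
  intro T
  induction T with
  | nil =>
    intro x κ ρ h1 h2 h3
    obtain rfl : ρ = 0 := by simpa using h1
    obtain rfl : κ = 0 := by simpa using h3.1.symm
    refine ⟨by simp [rskInsert], ?_⟩
    intro r
    cases r with
    | zero =>
      refine ⟨by simp [rskInsert], ?_⟩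
      intro c
      cases c <;> simp [rskInsert]
    | succ r => simp [rskInsert]
  | cons row T ih =>
    intro x κ ρ h1 h2 h3
    cases ρ with
    | zero =>
      simp only [List.getD_cons_zero] at h3
      have hn : row.findIdx? (fun z => decide (x < z)) = none := by
        apply findIdx?_none
        intro c hc
        have := h3.2 c (by omega)
        simp only [decide_eq_false_iff_not]; omega
      simp only [rskInsert, hn]
      refine ⟨by simp, ?_⟩
      intro r
      cases r with
      | zero =>
        refine ⟨by simp [h3.1], ?_⟩
        intro c
        simp only [List.getD_cons_zero, getD_append_one, h3.1]
        simp
      | succ r => simp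
    | succ ρ =>
      obtain ⟨a1, a2, a3⟩ := h2 0 (by omega)
      simp only [List.getD_cons_zero] at a1 a2 a3
      have hn : row.findIdx? (fun z => decide (x < z)) = some κ := by
        apply findIdx?_some a1
        · simp only [decide_eq_true_eq]; omega
        · intro c hc
          have := a3 c hc
          simp only [decide_eq_false_iff_not]; omega
      obtain ⟨b1, b2⟩ := ih (x + 1) κ ρ (by simpa using h1)
        (fun r hr => by
          have := h2 (r + 1) (by omega)
          simp only [List.getD_cons_succ] at this
          refine ⟨this.1, by omega, fun c hc => ?_⟩
          have := this.2.2 c hc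
          omega)
        (by
          simp only [List.getD_cons_succ] at h3
          refine ⟨h3.1, fun c hc => ?_⟩
          have := h3.2 c hc
          omega)
      simp only [rskInsert, hn]
      rw [a2, show x + 0 + 1 = x + 1 by omega]
      refine ⟨by simp only [List.length_cons, b1]; omega, ?_⟩
      intro r
      cases r with
      | zero =>
        refine ⟨by simp, ?_⟩
        intro c
        simp only [List.getD_cons_zero, getD_set_one _ a1]
        simp
      | succ r =>
        simp only [List.getD_cons_succ]
        refine ⟨by rw [(b2 r).1]; simp, ?_⟩
        intro c
        rw [(b2 r).2 c]
        simp only [Nat.add_le_add_iff_right]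
        split_ifs <;> omega

theorem newCell_eq {T T' : List (List ℕ)} {ρ κ : ℕ} (hρ : ρ < T'.length)
    (h1 : (T.getD ρ []).length = κ) (h2 : (T'.getD ρ []).length = κ + 1)
    (h3 : ∀ r < ρ, (T'.getD r []).length = (T.getD r []).length) : newCell T T' = (ρ, κ) := by
  have : (List.range T'.length).findIdx
    (fun r => decide ((T.getD r []).length ≠ (T'.getD r []).length)) = ρ := by
    rw [List.findIdx_eq (by simpa using hρ)]
    refine ⟨?_, ?_⟩
    · simp only [List.getElem_range, decide_eq_true_eq, ne_eq]; omega
    · intro j hj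
      have := h3 j hj
      simp only [List.getElem_range, this, ne_eq, not_true_eq_false, decide_false]
  simp only [newCell, this, h1]

def rl (n : ℕ) (l : ℕ → ℕ) (i r : ℕ) : ℕ := if r < n then cn l (n - r) i else 0

theorem rl_anti {n M : ℕ} {l : ℕ → ℕ} (h : YW n M l) {i : ℕ} (hi : i ≤ M) : Antitone (rl n l i) := by
  apply antitone_nat_of_succ_le
  intro r
  unfold rl
  split_ifs with h1 h2
  · have := h.dom i hi (n - (r + 1)) (by omega) (by omega)
    rwa [show n - (r + 1) + 1 = n - r by omega] at this
  · omega
  · omega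
  · omega

theorem rsk_inv {n M : ℕ} {l : ℕ → ℕ} (h : YW n M l) : ∀ i ≤ M,
    (∀ r, ((rskPQ (wd i l)).1.getD r []).length = rl n l i r) ∧
    (∀ r c, c < rl n l i r → ∃ q, r ≤ q ∧ q < n ∧
      ((rskPQ (wd i l)).1.getD r []).getD c 0 = n - q + r ∧ c < rl n l i q ∧ rl n l i (q + 1) ≤ c) ∧
    (∀ r, ((rskPQ (wd i l)).2.getD r []).length = rl n l i r) ∧
    tsize (rskPQ (wd i l)).2 = i ∧
    IsFill n i (fS n n i l) (toFunStraight (rskPQ (wd i l)).2) := by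
  intro i
  induction i with
  | zero =>
    intro _
    refine ⟨?_, ?_, ?_, ?_, ?_⟩
    · intro r; simp [rskPQ, wd, rl, cn]
    · intro r c hc
      simp [rl, cn, wd] at hc
    · intro r; simp [rskPQ, wd, rl, cn]
    · simp [rskPQ, wd, tsize]
    · intro c v
      simp [toFunStraight, rskPQ, wd]
  | succ i ih =>
    intro hi
    obtain ⟨a1, a2, a3, a4, a5⟩ := ih (by omega)
    have hstep : rskPQ (wd (i + 1) l) = (rskInsert (l i) (rskPQ (wd i l)).1,
        setBox (rskPQ (wd i l)).2
          (newCell (rskPQ (wd i l)).1 (rskInsert (l i) (rskPQ (wd i l)).1)).1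
          (newCell (rskPQ (wd i l)).1 (rskInsert (l i) (rskPQ (wd i l)).1)).2
          (tsize (rskPQ (wd i l)).2 + 1)) := by
      conv_lhs => rw [rskPQ, wd_succ, List.foldl_append]
      rfl
    rw [hstep]
    generalize (rskPQ (wd i l)).1 = P at *
    generalize (rskPQ (wd i l)).2 = Q at *
    have hx := h.pos i (by omega)
    have an := rl_anti h (i := i) (by omega)
    have an' := rl_anti h hi
    obtain ⟨ρ, hρ⟩ : ∃ ρ, ρ = n - l i := ⟨_, rfl⟩
    obtain ⟨κ, hκ⟩ : ∃ κ, κ = rl n l i ρ := ⟨_, rfl⟩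
    have hκ2 : κ = cn l (l i) i := by
      rw [hκ, rl, if_pos (by omega), show n - ρ = l i by omega]
    have hrl : ∀ r, rl n l (i + 1) r = if r = ρ then κ + 1 else rl n l i r := by
      intro r
      simp only [rl, cn_succ]
      by_cases hr : r < n
      · rw [if_pos hr]
        by_cases e : r = ρ
        · subst e
          rw [if_pos (by omega), if_pos rfl, hκ, rl, if_pos hr]
        · rw [if_neg (by omega), if_neg e, if_pos hr]; rfl
      · rw [if_neg hr, if_neg (by omega), if_neg hr]
    have hkl : ∀ r < ρ, κ < rl n l i r := by
      intro r hr
      have := an' (Nat.le_of_lt hr)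
      rw [hrl, hrl, if_pos rfl, if_neg (by omega)] at this
      omega
    have hlen : ∀ T : List (List ℕ), (∀ r, (T.getD r []).length = rl n l i r) → ρ ≤ T.length := by
      intro T hT
      by_contra hlt
      have h1 := hkl (ρ - 1) (by omega)
      rw [← hT, List.getD_eq_default _ _ (by omega)] at h1
      simp at h1
    have le_ent : ∀ r c, r ≤ ρ → c < κ → (P.getD r []).getD c 0 ≤ l i + r := by
      intro r c hr hc
      obtain ⟨q, q1, q2, q3, q4, q5⟩ := a2 r c (by
        have := an hr; omega)
      have : ρ < q + 1 := by
        by_contra hh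
        have := an (show q + 1 ≤ ρ by omega)
        omega
      omega
    obtain ⟨b1, b2⟩ := rsk_spec P (l i) κ ρ (hlen P a1) (by
        intro r hr
        refine ⟨by rw [a1]; exact hkl r hr, ?_, fun c hc => le_ent r c hr.le hc⟩
        obtain ⟨q, q1, q2, q3, q4, q5⟩ := a2 r κ (hkl r hr)
        have c1 : q < ρ := by
          by_contra hh
          have := an (show ρ ≤ q by omega)
          omega
        have c2 : ρ ≤ q + 1 := by
          by_contra hh
          have := hkl (q + 1) (by omega)
          omega
        omega) ⟨by rw [a1, hκ], fun c hc => le_ent ρ c le_rfl hc⟩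
    have hnc : newCell P (rskInsert (l i) P) = (ρ, κ) := by
      apply newCell_eq (by rw [b1]; omega) (by rw [a1, hκ]) (by rw [(b2 ρ).1, if_pos rfl])
      intro r hr
      rw [(b2 r).1, if_neg (by omega)]
    rw [hnc]
    obtain ⟨s1, s2, s3⟩ := setBox_new (tsize Q + 1) (hlen Q a3) (show (Q.getD ρ []).length = κ by
      rw [a3, hκ])
    refine ⟨?_, ?_, ?_, ?_, ?_⟩
    · intro r
      rw [(b2 r).1, hrl, a1]
    · intro r c hc
      simp only [(b2 r).2]
      by_cases e : c = κ ∧ r ≤ ρ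
      · refine ⟨ρ, e.2, by omega, ?_, ?_, ?_⟩
        · rw [if_pos e]; omega
        · rw [hrl, if_pos rfl]; omega
        · rw [hrl, if_neg (by omega)]
          have := an (Nat.le_succ ρ)
          simp only [Nat.succ_eq_add_one] at this
          omega
      · rw [if_neg e]
        obtain ⟨q, q1, q2, q3, q4, q5⟩ := a2 r c (by
          rw [hrl] at hc
          split_ifs at hc with e2
          · subst e2; omega
          · exact hc)
        refine ⟨q, q1, q2, q3, ?_, ?_⟩
        · rw [hrl]; split_ifs with e2
          · subst e2; omega
          · exact q4
        · rw [hrl]; split_ifs with e2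
          · rw [e2] at q5; omega
          · exact q5
    · intro r
      simp only [s1, hrl]
      split_ifs
      · rw [List.length_append, a3, ← hκ]; rfl
      · rw [a3]
    · show tsize (setBox Q ρ κ (tsize Q + 1)) = i + 1
      rw [s2, a4]
    · rintro ⟨r, c⟩ v
      have h5 := a5 (r, c) v
      simp only [toFunStraight, s1] at h5 ⊢
      have hcell : r = ρ → Q.getD r [] = Q.getD ρ [] := by rintro rfl; rfl
      have old : v ≠ i → ((v < i ∧ fS n n i l v = some (r, c + n)) ↔
          (v < i + 1 ∧ fS n n (i + 1) l v = some (r, c + n))) := by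
        intro hv
        simp only [fS]
        constructor
        · rintro ⟨u1, u2⟩
          rw [if_pos u1] at u2
          exact ⟨by omega, by rw [if_pos (by omega)]; exact u2⟩
        · rintro ⟨u1, u2⟩
          rw [if_pos u1] at u2
          exact ⟨by omega, by rw [if_pos (by omega)]; exact u2⟩
      have new : fS n n (i + 1) l i = some (ρ, κ + n) := by
        simp only [fS, if_pos (Nat.lt_succ_self i), ← hρ, ← hκ2, Nat.add_comm]
      by_cases hv : v = i
      · subst hv
        rw [new]
        simp only [Nat.lt_succ_self, true_and, Option.some.injEq, Prod.mk.injEq]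
        have h5' : (Q.getD r []).getD c 0 ≠ v + 1 := fun hh => by
          have := h5.mp hh; omega
        by_cases hr : r = ρ
        · rw [if_pos hr, getD_append_one, a3, ← hκ, ← hcell hr]
          split_ifs with e2
          · rw [a4]; simp; omega
          · constructor
            · intro h6; exact absurd h6 h5'
            · omega
        · rw [if_neg hr]
          constructor
          · intro h6; exact absurd h6 h5'
          · omega
      · rw [← old hv, ← h5]
        by_cases hr : r = ρ
        · rw [if_pos hr, getD_append_one, a3, ← hκ, ← hcell hr]
          split_ifs with e2
          · rw [a4]
            constructor
            · omega
            · intro h6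
              rw [List.getD_eq_default _ _ (by rw [a3, hr]; omega)] at h6
              omega
          · rfl
        · rw [if_neg hr]

theorem rsk_fill {n M : ℕ} {l : ℕ → ℕ} (h : YW n M l) :
    IsFill n M (fS n n M l) (toFunStraight (rskQ (wd M l))) := (rsk_inv h M le_rfl).2.2.2.2

theorem rsk_promote {n M : ℕ} {l : ℕ → ℕ} (h : SqW n M l) :
    promote (M + 1) (toFunStraight (rskQ (wd (M + 1) l))) =
      toFunStraight (rskQ (wd (M + 1) (pl n M l))) := by
  have h1 := rsk_fill h.toYW
  have h2 := promote_link (idl_bst n) (fS_valid h.toYW)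
    (by simp only [fS, if_pos (Nat.succ_pos M), h.fst, cn_zero]; simp) h1
  exact h2.unique (rsk_fill h.pl_sq.toYW) h.pl_stream

theorem rsk_det {n M : ℕ} {l l' : ℕ → ℕ} (h : YW n M l) (h' : YW n M l')
    (e : toFunStraight (rskQ (wd M l)) = toFunStraight (rskQ (wd M l'))) : wd M l = wd M l' := by
  apply wd_congr
  intro i hi
  have h1 := rsk_fill h (n - l i, cn l (l i) i) i
  have h2 := rsk_fill h' (n - l i, cn l (l i) i) i
  rw [e] at h1
  have := h2.mp (h1.mpr ⟨hi, by simp [fS, hi, Nat.add_comm]⟩)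
  have p1 := h.pos i hi
  have p2 := h'.pos i hi
  simp only [fS, if_pos hi, Option.some.injEq, Prod.mk.injEq] at this
  omega

end HB

namespace HB

/-- times of the letter `x` -/
def tms (M : ℕ) (l : ℕ → ℕ) (x : ℕ) : List ℕ := (List.range M).filter (fun i => l i = x)

/-- times sorted by letter, then by time, letters `≤ n` -/
def ordw (M : ℕ) (l : ℕ → ℕ) : ℕ → List ℕ
  | 0 => []
  | n + 1 => ordw M l n ++ tms M l (n + 1)

theorem tms_succ (M : ℕ) (l : ℕ → ℕ) (x : ℕ) :
    tms (M + 1) l x = tms M l x ++ if l M = x then [M] else [] := by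
  simp only [tms, List.range_succ, List.filter_append]
  split_ifs with h <;> simp [h]

theorem mem_tms {M : ℕ} {l : ℕ → ℕ} {x i : ℕ} : i ∈ tms M l x ↔ i < M ∧ l i = x := by
  simp [tms]

theorem mem_ordw {M : ℕ} {l : ℕ → ℕ} {n i : ℕ} : i ∈ ordw M l n ↔ i < M ∧ 1 ≤ l i ∧ l i ≤ n := by
  induction n with
  | zero => simp [ordw]; omega
  | succ n ih => simp only [ordw, List.mem_append, ih, mem_tms]; omega

theorem ordw_nodup {M : ℕ} {l : ℕ → ℕ} {n : ℕ} : (ordw M l n).Nodup := by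
  induction n with
  | zero => simp [ordw]
  | succ n ih =>
    rw [ordw, List.nodup_append]
    refine ⟨ih, List.nodup_range.filter _, ?_⟩
    intro a ha b hb e
    subst e
    rw [mem_ordw] at ha
    rw [mem_tms] at hb
    omega

theorem cn_mono (l : ℕ → ℕ) (x : ℕ) : Monotone (cn l x) := by
  apply monotone_nat_of_le_succ
  intro i; rw [cn_succ]; omega

theorem exists_copy {l : ℕ → ℕ} {x i k : ℕ} (h : k < cn l x i) :
    ∃ v < i, l v = x ∧ cn l x v = k := by
  induction i with
  | zero => simp [cn_zero] at h
  | succ i ih =>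
    rw [cn_succ] at h
    by_cases h2 : k < cn l x i
    · obtain ⟨v, hv, e⟩ := ih h2
      exact ⟨v, by omega, e⟩
    · split_ifs at h with h3
      · exact ⟨i, by omega, h3, by omega⟩
      · omega

theorem YW.chain {n M : ℕ} {l : ℕ → ℕ} (h : YW n M l) {i : ℕ} (hi : i ≤ M) {x y : ℕ} (hx : 1 ≤ x)
    (hxy : x ≤ y) (hy : y ≤ n) : cn l x i ≤ cn l y i := by
  induction y, hxy using Nat.le_induction with
  | base => exact le_rfl
  | succ y hxy ih => exact (ih (by omega)).trans (h.dom i hi y (by omega) (by omega))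

theorem mem_shp_iff {β : Finset Cell} {f : Stream'} {i : ℕ} {s : Cell} :
    s ∈ shp β f i ↔ s ∈ β ∨ ∃ v < i, f v = some s := by
  induction i with
  | zero => simp [shp]
  | succ i ih =>
    simp only [shp]
    have : s ∈ addO (shp β f i) (f i) ↔ s ∈ shp β f i ∨ f i = some s := by
      rcases f i with _ | x
      · simp [addO]
      · simp only [addO, Finset.mem_insert, Option.some.injEq]
        constructor
        · rintro (h | h)
          · exact Or.inr h.symm
          · exact Or.inl h
        · rintro (h | h)
          · exact Or.inr h
          · exact Or.inl h.symm
    rw [this, ih]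
    constructor
    · rintro ((h | ⟨v, hv, e⟩) | h)
      · exact Or.inl h
      · exact Or.inr ⟨v, by omega, e⟩
      · exact Or.inr ⟨i, by omega, h⟩
    · rintro (h | ⟨v, hv, e⟩)
      · exact Or.inl (Or.inl h)
      · by_cases hvi : v = i
        · subst hvi; exact Or.inr e
        · exact Or.inl (Or.inr ⟨v, by omega, e⟩)

theorem rowEnd_eq' {X : Finset Cell} {r b : ℕ} (h0 : r ≤ b) (h1 : (r, b) ∉ X)
    (h2 : ∀ c, r ≤ c → c < b → (r, c) ∈ X) : rowEnd X r = (r, b) := by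
  obtain ⟨e1, e2, e3, e4⟩ := rowEnd_spec X r
  refine Prod.ext e1 ?_
  simp only
  rcases lt_trichotomy (rowEnd X r).2 b with h | h | h
  · exact absurd (h2 _ e2 h) e3
  · exact h
  · exact absurd (e4 b h0 h) h1

def GG (n M : ℕ) (l : ℕ → ℕ) (r m : ℕ) : Stream' := fun i =>
  if i < M ∧ l i + r ≤ n then
    if cn l (l i) i < m then some (n - l i - r, n + cn l (l i) i)
    else if l i + r < n then some (n - l i - r - 1, n + cn l (l i) i) else none
  else none

theorem GG_some {n M : ℕ} {l : ℕ → ℕ} {r m i a b : ℕ} :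
    GG n M l r m i = some (a, b) ↔ i < M ∧ b = n + cn l (l i) i ∧
      ((cn l (l i) i < m ∧ l i + r ≤ n ∧ a = n - l i - r) ∨
       (m ≤ cn l (l i) i ∧ l i + r < n ∧ a = n - l i - r - 1)) := by
  unfold GG
  split_ifs with h1 h2 h3
  · simp only [Option.some.injEq, Prod.mk.injEq]; omega
  · simp only [Option.some.injEq, Prod.mk.injEq]; omega
  · simp only [reduceCtorEq, false_iff]; omega
  · simp only [reduceCtorEq, false_iff]; omega

theorem GG_st {n M : ℕ} {l : ℕ → ℕ} (h : YW n M l) {r m z : ℕ} (hr : r < n) (hz : z < M)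
    (hlz : l z = n - r) (hc : cn l (n - r) z = m) : ∀ i, z < i → i ≤ M →
    ∃ d, stA z (bst n) (GG n M l r m) i = some ((d, n + m), false) ∧ d + r < n ∧
      m < cn l (n - r - d) i ∧ (d + r + 1 < n → cn l (n - r - d - 1) i ≤ m) := by
  intro i
  induction i with
  | zero => omega
  | succ i ih =>
    intro h1 h2
    by_cases hiz : i = z
    · clear ih
      subst hiz
      refine ⟨0, ?_, by omega, ?_, ?_⟩
      · simp only [stA, stA_none le_rfl, stp, if_true]
        rw [rowEnd_eq' (b := n + m) (by omega)]
        · rw [mem_shp_iff, mem_bst]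
          rintro (e | ⟨v, hv, e⟩)
          · omega
          · rw [GG_some] at e
            have p := h.pos v (by omega)
            have q1 : n - r = l v + 1 := by omega
            have := h.dom (v + 1) (by omega) (l v) (by omega) (by omega)
            rw [← q1] at this
            have q2 := cn_mono l (n - r) (show v + 1 ≤ i by omega)
            rw [cn_succ, if_pos rfl] at this
            omega
        · intro c _ hcb
          rw [mem_shp_iff, mem_bst]
          by_cases hcn : c < n
          · left; omega
          · right
            obtain ⟨v, hv, e1, e2⟩ := exists_copy (l := l) (x := n - r) (i := i) (k := c - n) (by omega)
            refine ⟨v, hv, GG_some.mpr ⟨by omega, by rw [e1]; omega, Or.inl ⟨by rw [e1]; omega, by omega, by omega⟩⟩⟩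
      · rw [Nat.sub_zero, cn_succ, if_pos hlz]; omega
      · intro _
        have := h.dom i (by omega) (n - r - 1) (by omega) (by omega)
        rw [show n - r - 1 + 1 = n - r by omega] at this
        rw [Nat.sub_zero, cn_succ, if_neg (by omega)]; omega
    · obtain ⟨d, d1, d2, d3, d4⟩ := ih (by omega) (by omega)
      have p := h.pos i (by omega)
      simp only [stA, d1, stp]
      by_cases hit : GG n M l r m i = some (d, n + m)
      · rw [if_pos hit]
        rw [GG_some] at hit
        have hli : l i = n - r - d - 1 := by omega
        have hci : cn l (n - r - d - 1) i = m := by rw [← hli]; omega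
        refine ⟨d + 1, ?_, by omega, ?_, ?_⟩
        · have hn1 : nfl (d, n + m) false = false := by simp [nfl]; omega
          have hn2 : nxt (insert (d, n + m) (shp (bst n) (GG n M l r m) i)) (d, n + m) false =
              (d + 1, n + m) := by
            rw [nxt, if_neg (by simp only; simp; omega)]
            refine rowEnd_eq' (by omega) ?_ ?_
            · rw [Finset.mem_insert, mem_shp_iff, mem_bst]
              simp only [Prod.mk.injEq]
              rintro (e | e | ⟨v, hv, e⟩)
              · omega
              · omega
              · rw [GG_some] at e
                have p := h.pos v (by omega)
                have q1 : n - r - d - 1 = l v + 1 := by omega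
                have := h.dom (v + 1) (by omega) (l v) (by omega) (by omega)
                rw [← q1] at this
                have q2 := cn_mono l (n - r - d - 1) (show v + 1 ≤ i by omega)
                rw [cn_succ, if_pos rfl] at this
                omega
            · intro c _ hcb
              rw [Finset.mem_insert, mem_shp_iff, mem_bst]
              right
              by_cases hcn : c < n
              · left; omega
              · right
                obtain ⟨v, hv, e1, e2⟩ := exists_copy (l := l) (x := n - r - d - 1) (i := i) (k := c - n) (by omega)
                refine ⟨v, hv, GG_some.mpr ⟨by omega, by rw [e1]; omega, Or.inl ⟨by rw [e1]; omega, by omega, by omega⟩⟩⟩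
          rw [hn1, hn2]
        · rw [show n - r - (d + 1) = n - r - d - 1 by omega, cn_succ, if_pos hli]; omega
        · intro hd
          rw [show n - r - (d + 1) - 1 = n - r - d - 2 by omega, cn_succ, if_neg (by omega)]
          have := h.dom i (by omega) (n - r - d - 2) (by omega) (by omega)
          rw [show n - r - d - 2 + 1 = n - r - d - 1 by omega] at this
          omega
      · rw [if_neg hit]
        refine ⟨d, rfl, d2, ?_, ?_⟩
        · rw [cn_succ]; omega
        · intro hd
          have d4 := d4 hd
          rw [cn_succ]
          split_ifs with e
          · rcases Nat.lt_or_ge (cn l (n - r - d - 1) i) m with hh | hh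
            · omega
            · exfalso
              apply hit
              rw [GG_some, e]
              omega
          · omega

theorem GG_step {n M : ℕ} {l : ℕ → ℕ} (h : YW n M l) {r m z : ℕ} (hr : r < n) (hz : z < M)
    (hlz : l z = n - r) (hc : cn l (n - r) z = m) :
    outA z (bst n) (GG n M l r m) = GG n M l r (m + 1) := by
  have same : ∀ i, ¬ (i < M ∧ l i + r ≤ n ∧ cn l (l i) i = m) →
      GG n M l r m i = GG n M l r (m + 1) i := by
    intro i hi
    unfold GG
    split_ifs <;> first | rfl | omega
  funext i
  rcases lt_trichotomy i z with hi | hi | hi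
  · rw [outA_lt hi]
    apply same
    rintro ⟨a, b, c⟩
    have p := h.pos i a
    have := h.chain (i := i + 1) (by omega) p.1 (show l i ≤ n - r by omega) (by omega)
    rw [cn_succ, if_pos rfl] at this
    have q2 := cn_mono l (n - r) (show i + 1 ≤ z by omega)
    omega
  · subst hi
    obtain ⟨d, d1, d2, d3, d4⟩ := GG_st h hr hz hlz hc (i + 1) (by omega) (by omega)
    have e1 : outA i (bst n) (GG n M l r m) i = some (d, n + m) := by
      simp only [outA, stA, stA_none le_rfl, stp, if_true] at d1 ⊢
      simp only [Option.some.injEq, Prod.mk.injEq] at d1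
      rw [d1.1]
    have hd : d = 0 := by
      by_contra hne
      have := h.chain (i := i + 1) (by omega) (show 1 ≤ n - r - d by omega)
        (show n - r - d ≤ n - r - 1 by omega) (by omega)
      have e5 := h.chain (i := i) (by omega) (show 1 ≤ n - r - 1 by omega)
        (show n - r - 1 ≤ n - r by omega) (by omega)
      rw [cn_succ (x := n - r - 1), if_neg (by omega)] at this
      omega
    rw [e1, eq_comm, GG_some, hlz, hc]
    omega
  · by_cases hiM : i < M
    · obtain ⟨d, d1, d2, d3, d4⟩ := GG_st h hr hz hlz hc i hi hiM.le
      obtain ⟨d', d1', d2', d3', d4'⟩ := GG_st h hr hz hlz hc (i + 1) (by omega) hiM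
      have p := h.pos i hiM
      simp only [outA, stA, d1, stp] at d1' ⊢
      by_cases hit : GG n M l r m i = some (d, n + m)
      · rw [if_pos hit] at d1' ⊢
        simp only [Option.some.injEq, Prod.mk.injEq] at d1'
        simp only [d1'.1]
        rw [GG_some] at hit
        rw [eq_comm, GG_some]
        have hli : l i = n - r - d - 1 := by omega
        have hd' : d' = d + 1 := by
          rcases lt_trichotomy d' (d + 1) with e | e | e
          · exfalso
            have := d4' (by omega)
            have e5 := h.chain (i := i + 1) (by omega) (show 1 ≤ n - r - d - 1 by omega)
              (show n - r - d - 1 ≤ n - r - d' - 1 by omega) (by omega)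
            have e6 := cn_succ l (n - r - d - 1) i
            rw [if_pos hli] at e6
            rw [← hli] at e6 e5
            omega
          · exact e
          · exfalso
            have e5 := h.chain (i := i + 1) (by omega) (show 1 ≤ n - r - d' by omega)
              (show n - r - d' ≤ n - r - d - 2 by omega) (by omega)
            have e6 := h.chain (i := i) (by omega) (show 1 ≤ n - r - d - 2 by omega)
              (show n - r - d - 2 ≤ n - r - d - 1 by omega) (by omega)
            rw [cn_succ (x := n - r - d - 2), if_neg (by omega)] at e5
            rw [← hli] at e6
            omega
        omega
      · rw [if_neg hit]
        apply same
        rintro ⟨a, b, c⟩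
        apply hit
        rw [GG_some]
        have c1 : l i < n - r - d := by
          by_contra hh
          have := h.chain (i := i) (by omega) (show 1 ≤ n - r - d by omega)
            (show n - r - d ≤ l i by omega) (by omega)
          omega
        have c2 : l i = n - r - d - 1 := by
          by_contra hh
          have := h.chain (i := i + 1) (by omega) (show 1 ≤ l i by omega)
            (show l i ≤ n - r - d - 1 by omega) (by omega)
          rw [cn_succ, if_pos rfl, cn_succ, if_neg (by omega)] at this
          have := d4 (by omega)
          omega
        omega
    · have : GG n M l r m i = none := by unfold GG; rw [if_neg (by omega)]
      have e2 : outA z (bst n) (GG n M l r m) i = none := by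
        rw [outA_none_iff]; exact ⟨this, by omega⟩
      rw [e2]; unfold GG; rw [if_neg (by omega)]

theorem GG_tms {n M : ℕ} {l : ℕ → ℕ} (h : YW n M l) {r : ℕ} (hr : r < n) : ∀ i ≤ M,
    PF (bst n) (GG n M l r 0) (tms i l (n - r)) = GG n M l r (cn l (n - r) i) := by
  intro i
  induction i with
  | zero => intro _; rw [cn_zero]; rfl
  | succ i ih =>
    intro hi
    rw [tms_succ, PF_append, ih (by omega), cn_succ]
    split_ifs with e
    · rw [PF_cons, PF_nil, GG_step h hr (by omega) e rfl]
    · rw [PF_nil]; rfl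

theorem GG_next {n M : ℕ} {l : ℕ → ℕ} (h : YW n M l) {r : ℕ} (hr : r + 1 < n) :
    GG n M l (r + 1) (cn l (n - (r + 1)) M) = GG n M l r 0 := by
  funext i
  apply Option.ext
  rintro ⟨a, b⟩
  rw [GG_some, GG_some]
  by_cases hi : i < M
  · by_cases h1 : l i + (r + 1) ≤ n
    · have p := h.pos i hi
      have c1 := h.chain le_rfl p.1 (show l i ≤ n - (r + 1) by omega) (by omega)
      have c2 := cn_mono l (l i) (show i + 1 ≤ M by omega)
      rw [cn_succ, if_pos rfl] at c2
      omega
    · omega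
  · omega

theorem PB_GG {n M : ℕ} {l : ℕ → ℕ} (h : YW n M l) : ∀ j < n,
    PB (bst n) (ordw M l j) = GG n M l (n - 1 - j) 0 := by
  intro j
  induction j with
  | zero =>
    intro hj
    funext i
    apply Option.ext
    rintro ⟨a, b⟩
    rw [GG_some]
    simp only [ordw, PB, PF_nil]
    constructor
    · intro hh; cases hh
    · rintro ⟨h1, h2, h3⟩
      have := h.pos i h1
      omega
  | succ j ih =>
    intro hj
    have e := GG_tms h (r := n - 1 - j) (by omega) M le_rfl
    rw [ordw, PB, PF_append]
    rw [PB] at ih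
    rw [ih (by omega), show j + 1 = n - (n - 1 - j) by omega, e, ← GG_next h (by omega),
      show n - 1 - (n - (n - 1 - j)) + 1 = n - 1 - j by omega]

theorem PB_plain {n M : ℕ} {l : ℕ → ℕ} (h : YW n M l) (hn : 0 < n) :
    PB (bst n) (ordw M l n) = fS n n M l := by
  obtain ⟨n', rfl⟩ : ∃ n', n = n' + 1 := ⟨n - 1, by omega⟩
  have e := GG_tms h (r := 0) (by omega) M le_rfl
  have e2 := PB_GG h n' (by omega)
  rw [ordw, PB, PF_append]
  rw [PB] at e2
  rw [e2, show n' + 1 - 1 - n' = 0 by omega]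
  rw [Nat.sub_zero] at e
  rw [e]
  funext i
  apply Option.ext
  rintro ⟨a, b⟩
  rw [GG_some]
  by_cases hi : i < M
  · have p := h.pos i hi
    have c1 := h.chain le_rfl p.1 p.2 le_rfl
    have c2 := cn_mono l (l i) (show i + 1 ≤ M by omega)
    rw [cn_succ, if_pos rfl] at c2
    simp only [fS, if_pos hi, Option.some.injEq, Prod.mk.injEq]
    omega
  · simp only [fS, if_neg hi]
    constructor
    · rintro ⟨a, -⟩; exact absurd a hi
    · intro hh; cases hh

end HB

namespace HB

variable {n M : ℕ} {l : ℕ → ℕ}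

theorem SqW.split (h : SqW n M l) : ∃ b, ordw (M + 1) l n = ordw (M + 1) l (n - 1) ++ 0 :: b := by
  obtain ⟨n', rfl⟩ : ∃ n', n = n' + 1 := ⟨n - 1, by have := h.npos; omega⟩
  rw [ordw, tms, List.range_succ_eq_map, List.filter_cons, if_pos (by simp [h.fst])]
  exact ⟨_, rfl⟩

theorem SqW.mixed_stream (h : SqW n M l) :
    PB ∅ (ordw (M + 1) l n) 0 = some (0, 0) ∧
    ∀ i < M, outJ (0, 0) (tl (PB ∅ (ordw (M + 1) l n))) i = PB ∅ (ordw (M + 1) (pl n M l) n) i := by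
  obtain ⟨b, hb⟩ := h.split
  have hn := h.npos
  have nd : (ordw (M + 1) l (n - 1) ++ 0 :: b).Nodup := by rw [← hb]; exact ordw_nodup
  have h0 : 0 ∉ ordw (M + 1) l (n - 1) := by
    rw [mem_ordw, h.fst]; omega
  have g1 := F1 (idl_bst n) nd (F1_bst_aux hn (PB_valid (idl_bst n) ordw_nodup)
    (PB_none_iff.mpr h0) (by
      rw [PB_GG h.toYW (n - 1) (by omega)]
      rintro i ⟨r, c⟩ hs
      rw [GG_some] at hs
      simp only
      omega))
  have g2 := F1 idl_empty nd (F1_empty_aux (PB_valid idl_empty ordw_nodup) (PB_none_iff.mpr h0))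
  have nd' : ((ordw (M + 1) l (n - 1) ++ b).map Nat.pred).Nodup := by
    have e : ((ordw (M + 1) l (n - 1) ++ b).Nodup) ∧ 0 ∉ (ordw (M + 1) l (n - 1) ++ b) := by
      have := (List.nodup_middle.mp nd)
      rw [List.nodup_cons] at this
      exact ⟨this.2, this.1⟩
    exact map_pred_nodup e.1 e.2
  rw [← hb] at g1 g2
  refine ⟨by rw [g2.1, rowEnd_empty], ?_⟩
  intro i hi
  rw [rowEnd_empty] at g2
  rw [g2.2]
  refine agree_empty nd' ordw_nodup (bst n) (idl_bst n) (K := M) ?_ i hi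
  intro i hi
  rw [PB_plain h.pl_sq.toYW hn, ← h.pl_stream i (by omega), proS, if_pos hi, ← g1.2, rowEnd_bst,
    PB_plain h.toYW hn]

theorem shp_congr {β : Finset Cell} {f g : Stream'} {i : ℕ} (h : ∀ v < i, f v = g v) :
    shp β f i = shp β g i := by
  induction i with
  | zero => rfl
  | succ i ih =>
    rw [shp, shp, ih (fun v hv => h v (by omega)), h i (by omega)]

theorem SqW.mixed_pro (h : SqW n M l)
    (hD : shp ∅ (PB ∅ (ordw (M + 1) l n)) (M + 1) =
      shp ∅ (PB ∅ (ordw (M + 1) (pl n M l) n)) (M + 1)) :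
    ∀ i < M + 1, proS (PB ∅ (ordw (M + 1) l n)) (0, 0) M i =
      PB ∅ (ordw (M + 1) (pl n M l) n) i := by
  obtain ⟨h0, hs⟩ := h.mixed_stream
  intro i hi
  simp only [proS]
  split_ifs with hi2
  · exact hs i hi2
  · obtain rfl : i = M := by omega
    have hv := PB_valid idl_empty (ordw_nodup (M := i + 1) (l := l) (n := n))
    have hv' := PB_valid idl_empty (ordw_nodup (M := i + 1) (l := pl n i l) (n := n))
    have ht := hv.tl
    rw [h0] at ht
    have hid : Idl (insert (0, 0) ∅) :=
      Idl.insert idl_empty ⟨by simp, by simp, by simp, by simp⟩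
    have hc : Corner (0, 0) (insert (0, 0) (∅ : Finset Cell)) := by
      refine ⟨by simp, by simp, by simp⟩
    obtain ⟨k1, k2⟩ := holeJ_spec hid ht hc i
    have e1 : (insert (0, 0) (∅ : Finset Cell)).erase (0, 0) = ∅ := by simp
    have e2 := shp_tl ∅ (PB ∅ (ordw (i + 1) l n)) i
    rw [h0] at e2
    simp only [addO] at e2
    rw [e1, shp_congr hs, ← e2, hD] at k2
    rw [← e2, hD] at k1
    simp only [shp] at k1 k2
    have hne : PB ∅ (ordw (i + 1) (pl n i l) n) i ≠ none := by
      rw [Ne, PB_none_iff, mem_ordw, not_not]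
      exact ⟨hi, h.pl_sq.pos i hi⟩
    obtain ⟨s, hs'⟩ := Option.ne_none_iff_exists'.mp hne
    rw [hs'] at k1 k2 ⊢
    have ha := hv' i s hs'
    simp only [addO] at k1 k2
    congr 1
    by_contra hne2
    have : s ∈ shp ∅ (PB ∅ (ordw (i + 1) (pl n i l) n)) i := by
      rw [k2]
      exact Finset.mem_erase.mpr ⟨fun e => hne2 e.symm, Finset.mem_insert_self _ _⟩
    exact ha.1 this

end HB

namespace HB

noncomputable def ff (a : ℕ → ℕ) (k : ℕ) : Stream' := PB ∅ (wd k a)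
noncomputable def XX (a : ℕ → ℕ) (k i : ℕ) : Finset Cell := shp ∅ (ff a k) i
noncomputable def sA (a : ℕ → ℕ) (k i : ℕ) : LSt := stA (a k) ∅ (ff a k) i

theorem ff_zero (a : ℕ → ℕ) (i : ℕ) : ff a 0 i = none := rfl

theorem ff_succ (a : ℕ → ℕ) (k : ℕ) : ff a (k + 1) = outA (a k) ∅ (ff a k) := by
  rw [ff, wd_succ, PB, PF_append]; rfl

theorem XX_zero (a : ℕ → ℕ) (k : ℕ) : XX a k 0 = ∅ := rfl

theorem XX_succ (a : ℕ → ℕ) (k i : ℕ) : XX a k (i + 1) = addO (XX a k i) (ff a k i) := rfl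

theorem sA_zero (a : ℕ → ℕ) (k : ℕ) : sA a k 0 = none := rfl

theorem st_step (a : ℕ → ℕ) (k i : ℕ) :
    (sA a k (i + 1), ff a (k + 1) i) = stp (XX a k i) (i = a k) (sA a k i) (ff a k i) := by
  rw [ff_succ]; rfl

/-- data: an enumeration of the times, sorted by letter, then time -/
structure Enum (K : ℕ) (a L : ℕ → ℕ) : Prop where
  inj : ∀ j k, j < K → k < K → a j = a k → j = k
  mono : ∀ j k, j ≤ k → k < K → L j ≤ L k
  tm : ∀ j k, j < k → k < K → L j = L k → a j < a k

variable {K : ℕ} {a L : ℕ → ℕ}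

theorem Enum.nodup (E : Enum K a L) {k : ℕ} (hk : k ≤ K) : (wd k a).Nodup := by
  rw [wd]
  refine List.Nodup.map_on ?_ List.nodup_range
  intro x hx y hy e
  rw [List.mem_range] at hx hy
  exact E.inj x y (by omega) (by omega) e

theorem Enum.valid (E : Enum K a L) {k : ℕ} (hk : k ≤ K) : Valid ∅ (ff a k) :=
  PB_valid idl_empty (E.nodup hk)

theorem Enum.idl (E : Enum K a L) {k : ℕ} (hk : k ≤ K) (i : ℕ) : Idl (XX a k i) :=
  (E.valid hk).idl idl_empty i

theorem Enum.fresh (E : Enum K a L) {k : ℕ} (hk : k < K) : ff a k (a k) = none := by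
  rw [ff, PB_none_iff]
  intro h
  simp only [wd, List.mem_map, List.mem_range] at h
  obtain ⟨j, hj, e⟩ := h
  have := E.inj j k (by omega) hk e
  omega

theorem Enum.LA (E : Enum K a L) {k : ℕ} (hk : k < K) (i : ℕ) :
    LAdd (XX a k i) (sA a k i) ∧ XX a (k + 1) i = lAdd (XX a k i) (sA a k i) := by
  have := stA_spec idl_empty (E.valid hk.le) (E.fresh hk) i
  rw [← ff_succ] at this
  exact this

theorem st_some {k i : ℕ} (hlt : a k < i) : sA a k i ≠ none := by
  intro h
  induction i with
  | zero => omega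
  | succ i ih =>
    have e := st_step a k i
    rw [h] at e
    rcases h2 : sA a k i with _ | ⟨p, fl⟩
    · by_cases hi : i = a k
      · rw [h2] at e
        simp [stp, hi] at e
      · exact ih (by omega) h2
    · rw [h2] at e
      simp only [stp] at e
      split_ifs at e
      · simp at e
      · simp at e

theorem st_none_iff {k i : ℕ} : sA a k i = none ↔ i ≤ a k := by
  constructor
  · intro h
    by_contra hlt
    push Not at hlt
    exact st_some hlt h
  · exact fun h => stA_none h

theorem Enum.add (E : Enum K a L) {k i : ℕ} (hk : k < K) {p : Cell} {f : Bool}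
    (h : sA a k i = some (p, f)) : Addable (XX a k i) p ∧ XX a (k + 1) i = insert p (XX a k i) := by
  have := E.LA hk i
  rw [h] at this
  exact this

theorem Enum.arr (E : Enum K a L) {k i : ℕ} (hk : k ≤ K) {s : Cell}
    (h : ff a k i = some s) : Addable (XX a k i) s ∧ XX a k (i + 1) = insert s (XX a k i) := by
  refine ⟨E.valid hk i s h, ?_⟩
  rw [XX_succ, h]; rfl

theorem Enum.X_none (E : Enum K a L) {k i : ℕ} (hk : k < K)
    (h : sA a k i = none) : XX a (k + 1) i = XX a k i := by
  have := (E.LA hk i).2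
  rw [h] at this
  exact this

theorem Enum.X_mono (E : Enum K a L) {j k i : ℕ} (hjk : j ≤ k) (hk : k ≤ K) :
    XX a j i ⊆ XX a k i := by
  induction k, hjk using Nat.le_induction with
  | base => exact Finset.Subset.refl _
  | succ k hjk ih =>
    refine (ih (by omega)).trans ?_
    rcases h : sA a k i with _ | ⟨p, f⟩
    · rw [E.X_none (by omega) h]
    · rw [(E.add (by omega) h).2]; exact Finset.subset_insert _ _

theorem Enum.mem (E : Enum K a L) {j k i : ℕ} (hjk : j < k) (hk : k ≤ K) {p : Cell} {f : Bool}
    (h : sA a j i = some (p, f)) : p ∈ XX a k i := by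
  apply E.X_mono (show j + 1 ≤ k from hjk) hk
  rw [(E.add (by omega) h).2]; exact Finset.mem_insert_self _ _

/-- a row move of the letter `k` at time `i` -/
def RowMv (a : ℕ → ℕ) (k i : ℕ) (p q : Cell) (f g : Bool) : Prop :=
  f = false ∧ g = false ∧ p.1 < p.2 ∧ q = rowEnd (XX a k (i + 1)) (p.1 + 1) ∧ q.1 = p.1 + 1 ∧
    q.2 ≤ p.2

def ColMv (a : ℕ → ℕ) (k i : ℕ) (p q : Cell) (f g : Bool) : Prop :=
  (f = true ∨ p.1 = p.2) ∧ g = true ∧ q = colEnd (XX a k (i + 1)) (p.2 + 1) ∧ q.2 = p.2 + 1 ∧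
    q.1 ≤ p.1

theorem Enum.step (E : Enum K a L) {k i : ℕ} (hk : k < K) {p : Cell} {f : Bool}
    (h : sA a k i = some (p, f)) :
    (ff a k i ≠ some p ∧ sA a k (i + 1) = some (p, f) ∧ ff a (k + 1) i = ff a k i) ∨
    (ff a k i = some p ∧ ∃ q g, sA a k (i + 1) = some (q, g) ∧ ff a (k + 1) i = some q ∧
      (RowMv a k i p q f g ∨ ColMv a k i p q f g)) := by
  have e := st_step a k i
  rw [h] at e
  simp only [stp] at e
  by_cases hs : ff a k i = some p
  · rw [if_pos hs] at e
    right
    refine ⟨hs, _, _, (congrArg Prod.fst e), (congrArg Prod.snd e), ?_⟩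
    have hY : insert p (XX a k i) = XX a k (i + 1) := ((E.arr hk.le hs).2).symm
    have hY2 := E.idl hk.le (i + 1)
    obtain ⟨hA, -⟩ := E.add hk h
    have hc := hA.corner (E.idl hk.le i)
    rw [hY] at hc ⊢
    unfold nxt nfl
    by_cases hf : f = true ∨ p.1 = p.2
    · right
      rw [if_pos hf]
      refine ⟨hf, ?_, rfl, rfl, (addable_colEnd_next hY2 hc).2⟩
      rcases hf with hf | hf <;> simp [hf]
    · left
      rw [if_neg hf]
      push Not at hf
      refine ⟨by simpa using hf.1, ?_, ?_, rfl, rfl, (addable_rowEnd_next hY2 hc hf.2).2⟩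
      · simp [hf]
      · have := hA.2.1
        omega
  · rw [if_neg hs] at e
    left
    exact ⟨hs, congrArg Prod.fst e, congrArg Prod.snd e⟩

theorem Enum.step_new (E : Enum K a L) {k : ℕ} (hk : k < K) :
    sA a k (a k + 1) = some (rowEnd (XX a k (a k)) 0, false) ∧
    ff a (k + 1) (a k) = some (rowEnd (XX a k (a k)) 0) ∧ ff a k (a k) = none := by
  have e := st_step a k (a k)
  rw [st_none_iff.mpr le_rfl] at e
  simp only [stp, if_true] at e
  exact ⟨congrArg Prod.fst e, congrArg Prod.snd e, E.fresh hk⟩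

theorem step_abs {k i : ℕ} (hi : i < a k) :
    sA a k (i + 1) = none ∧ ff a (k + 1) i = ff a k i := by
  have e := st_step a k i
  rw [st_none_iff.mpr hi.le] at e
  simp only [stp, if_neg (show ¬ (i = a k) by omega)] at e
  exact ⟨congrArg Prod.fst e, congrArg Prod.snd e⟩

theorem ff_none_iff {k i : ℕ} : ff a k i = none ↔ ∀ j < k, a j ≠ i := by
  rw [ff, PB_none_iff]
  simp [wd]

/-- the letter that brought the arrival -/
theorem Enum.last (E : Enum K a L) {j k i : ℕ} (hjk : j ≤ k) (hk : k ≤ K) {s : Cell}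
    (h : ff a k i = some s) : ff a j i = some s ∨ ∃ m, j ≤ m ∧ m < k ∧ ∃ g, sA a m (i + 1) = some (s, g) ∧
      (a m = i ∨ ∃ p f, sA a m i = some (p, f) ∧ ff a m i = some p ∧
        (RowMv a m i p s f g ∨ ColMv a m i p s f g)) := by
  induction k, hjk using Nat.le_induction with
  | base => exact Or.inl h
  | succ k hjk ih =>
    have pass : ff a k i = some s → _ := fun e => (ih (by omega) e).imp id
      (fun ⟨m, h1, h2, h3⟩ => (⟨m, h1, by omega, h3⟩ : ∃ m, j ≤ m ∧ m < k + 1 ∧ ∃ g, sA a m (i + 1) = some (s, g) ∧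
      (a m = i ∨ ∃ p f, sA a m i = some (p, f) ∧ ff a m i = some p ∧
        (RowMv a m i p s f g ∨ ColMv a m i p s f g))))
    rcases hs : sA a k i with _ | ⟨p, f⟩
    · rw [st_none_iff] at hs
      by_cases e : i = a k
      · right
        subst e
        obtain ⟨e1, e2, e3⟩ := E.step_new (show k < K by omega)
        rw [h] at e2
        cases e2
        exact ⟨k, hjk, by omega, _, e1, Or.inl rfl⟩
      · apply pass
        rw [← (step_abs (a := a) (k := k) (i := i) (by omega)).2]; exact h
    · rcases E.step (by omega) hs with ⟨h1, h2, h3⟩ | ⟨h1, q, g, h2, h3, h4⟩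
      · exact pass (by rw [← h3]; exact h)
      · rw [h] at h3
        cases h3
        exact Or.inr ⟨k, hjk, by omega, g, h2, Or.inr ⟨p, f, hs, h1, h4⟩⟩

/-- invariants for pairs of equal letters -/
def Tie (K : ℕ) (a L : ℕ → ℕ) (i : ℕ) : Prop :=
  (∀ k < K, ∀ p, sA a k i = some (p, true) → p.1 < p.2) ∧
  ∀ j k, j < k → k < K → L j = L k → ∀ p f q g, sA a j i = some (p, f) → sA a k i = some (q, g) →
    (g = true → f = true ∧ q.2 ≤ p.2 ∧ p.1 < q.1) ∧ (f = false → q.1 ≤ p.1 ∧ p.2 < q.2)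

theorem rowEnd_gt {X : Finset Cell} (hX : Idl X) {r r' c : ℕ} (h : (r', c) ∈ X) (hr : r ≤ r') :
    c < (rowEnd X r).2 := by
  obtain ⟨e1, e2, e3, e4⟩ := rowEnd_spec X r
  by_contra hlt
  exact e3 (hX.2 _ _ _ _ h hr (by omega) e2)

theorem colEnd_gt {X : Finset Cell} (hX : Idl X) {r c c' : ℕ} (h : (r, c') ∈ X) (hc : c ≤ c')
    (hrc : r ≤ c) : r < (colEnd X c).1 := by
  obtain ⟨e1, e3, e4⟩ := colEnd_spec X c
  by_contra hlt
  exact e3 (hX.2 _ _ _ _ h (by omega) (by omega) (by omega))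

theorem Enum.tie (E : Enum K a L) (i : ℕ) : Tie K a L i := by
  induction i with
  | zero => exact ⟨fun k _ p h => (by cases h), fun j k _ _ _ p f q g h => (by cases h)⟩
  | succ i ih =>
    obtain ⟨ihd, iht⟩ := ih
    constructor
    · intro k hk p h
      rcases hs : sA a k i with _ | ⟨p0, f0⟩
      · rw [st_none_iff] at hs
        by_cases e : i = a k
        · subst e
          rw [(E.step_new hk).1] at h
          cases h
        · rw [(step_abs (a := a) (k := k) (i := i) (by omega)).1] at h
          cases h
      · rcases E.step hk hs with ⟨h1, h2, h3⟩ | ⟨h1, q, g, h2, h3, h4⟩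
        · rw [h2] at h; cases h
          exact ihd k hk p hs
        · rw [h2] at h; cases h
          rcases h4 with h4 | h4
          · cases h4.2.1
          · have := (E.add hk hs).1.2.1
            have := h4.2.2.2
            omega
    · intro j k hjk hk hL p' f' q' g' hj' hk'
      have hjK : j < K := by omega
      have ajk := E.tm j k hjk hk hL
      have between : ∀ m, j ≤ m → m < k → L j = L m ∧ L m = L k := by
        intro m h1 h2
        have x1 := E.mono j m h1 (by omega)
        have x2 := E.mono m k h2.le hk
        omega
      have hik : ¬ (i + 1 ≤ a k) := fun hh => by
        rw [← st_none_iff (a := a), hk'] at hh; cases hh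
      -- `j` is present at time `i`
      rcases hj : sA a j i with _ | ⟨p, f⟩
      · rw [st_none_iff] at hj; omega
      have pd : p.1 ≤ p.2 := (E.add hjK hj).1.2.1
      rcases hkk : sA a k i with _ | ⟨q, g⟩
      · -- `k` is new
        have hi : i = a k := by rw [st_none_iff] at hkk; omega
        subst hi
        obtain ⟨e1, -, e3⟩ := E.step_new hk
        rw [e1] at hk'; cases hk'
        rcases E.step hjK hj with ⟨h1, h2, h3⟩ | ⟨h1, q, g, h2, h3, h4⟩
        · rw [h2] at hj'; cases hj'
          refine ⟨fun hh => (by cases hh), fun _ => ⟨Nat.zero_le _, ?_⟩⟩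
          exact rowEnd_gt (E.idl hk.le _) (E.mem hjk hk.le hj) (Nat.zero_le _)
        · exfalso
          rw [ff_none_iff] at e3
          have : ff a j (a k) = none := ff_none_iff.mpr (fun m hm => e3 m (by omega))
          rw [this] at h1; cases h1
      · have qd : q.1 ≤ q.2 := (E.add hk hkk).1.2.1
        have T := iht j k hjk hk hL p f q g hj hkk
        have hjX : p' ∈ XX a k (i + 1) := E.mem hjk hk.le hj'
        have hXk := E.idl hk.le (i + 1)
        -- facts on the arrival at `k`
        have noins : ∀ m, j ≤ m → m < k → a m ≠ i := by
          intro m h1 h2 e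
          have := E.tm m k h2 hk (between m h1 h2).2
          have h5 : ¬ (i ≤ a k) := fun hh => by
            rw [← st_none_iff (a := a), hkk] at hh; cases hh
          omega
        rcases E.step hk hkk with ⟨k1, k2, k3⟩ | ⟨k1, q2, g2, k2, k3, k4⟩
        · -- `k` does not move
          rw [k2] at hk'; cases hk'
          rcases E.step hjK hj with ⟨j1, j2, j3⟩ | ⟨j1, p2, f2, j2, j3, j4⟩
          · rw [j2] at hj'; cases hj'; exact T
          · rw [j2] at hj'; cases hj'
            rcases j4 with ⟨m1, m2, m3, m4, m5, m6⟩ | ⟨m1, m2, m3, m4, m5⟩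
            · refine ⟨fun hh => ?_, fun _ => ?_⟩
              · have := (T.1 hh).1
                rw [m1] at this; cases this
              · have := T.2 m1; omega
            · refine ⟨fun hh => ⟨m2, ?_⟩, fun hh => ?_⟩
              · have := T.1 hh; omega
              · rw [m2] at hh; cases hh
        · rw [k2] at hk'; cases hk'
          -- the arrival `q`
          have hlast := E.last hjk.le hk.le k1
          rcases k4 with ⟨m1, m2, m3, m4, m5, m6⟩ | ⟨m1, m2, m3, m4, m5⟩
          · -- row move of `k`
            refine ⟨fun hh => (by rw [m2] at hh; cases hh), fun hf' => ?_⟩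
            have hrow : q.1 + 1 ≤ p'.1 := by
              rcases E.step hjK hj with ⟨j1, j2, j3⟩ | ⟨j1, p2, f2, j2, j3, j4⟩
              · rw [j2] at hj'
                simp only [Option.some.injEq, Prod.mk.injEq] at hj'
                obtain ⟨rfl, rfl⟩ := hj'
                have T2 := T.2 hf'
                by_contra hlt
                have hr : p.1 = q.1 := by omega
                rcases hlast with hl | ⟨m, z1, z2, g0, z3, z4 | ⟨p0, f0, z4, z5, z6⟩⟩
                · have b1 := E.arr hjK.le hl
                  have b2 := E.add hjK hj
                  have c1 := rowEnd_eq (E.idl hjK.le i) b1.1 (r := q.1) rfl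
                  have c2 := rowEnd_eq (E.idl hjK.le i) b2.1 (r := q.1) hr
                  rw [c1] at c2
                  rw [c2] at T2; omega
                · exact noins m z1 z2 z4
                · have Tm := iht m k z2 hk (between m z1 z2).2 p0 f0 q g z4 hkk
                  have hjm : j ≠ m := by
                    rintro rfl
                    rw [hj] at z4; cases z4
                    exact j1 z5
                  have Tj := iht j m (by omega) (by omega) (between m z1 z2).1 p f p0 f0 hj z4
                  rcases z6 with ⟨n1, n2, n3, n4, n5, n6⟩ | ⟨n1, n2, n3, n4, n5⟩
                  · have := Tm.2 n1; omega
                  · rcases n1 with n1 | n1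
                    · have := (Tj.1 n1).1; rw [hf'] at this; cases this
                    · have := Tj.2 hf'; omega
              · rw [j2] at hj'; cases hj'
                rcases j4 with ⟨n1, n2, n3, n4, n5, n6⟩ | ⟨n1, n2, n3, n4, n5⟩
                · have := T.2 n1; omega
                · rw [n2] at hf'; cases hf'
            refine ⟨by omega, ?_⟩
            rw [m4]
            exact rowEnd_gt hXk hjX hrow
          · -- column move of `k`
            have fl : f = true := by
              rcases m1 with m1 | m1
              · exact (T.1 m1).1
              · by_contra hf
                have := T.2 (by simpa using hf)
                omega
            have nomv : ff a j i = some q := by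
              rcases hlast with hl | ⟨m, z1, z2, g0, z3, z4 | ⟨p0, f0, z4, z5, z6⟩⟩
              · exact hl
              · exact absurd z4 (noins m z1 z2)
              · exfalso
                have Tm := iht m k z2 hk (between m z1 z2).2 p0 f0 q g z4 hkk
                have pd0 : p0.1 ≤ p0.2 := (E.add (by omega) z4).1.2.1
                rcases z6 with ⟨n1, n2, n3, n4, n5, n6⟩ | ⟨n1, n2, n3, n4, n5⟩
                · have := Tm.2 n1; omega
                · rcases m1 with m1 | m1
                  · have := Tm.1 m1; omega
                  · omega
            have b1 := E.arr hjK.le nomv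
            have b2 := E.add hjK hj
            have hX := E.idl hjK.le i
            rcases E.step hjK hj with ⟨j1, j2, j3⟩ | ⟨j1, p2, f2, j2, j3, j4⟩
            · rw [j2] at hj'
              simp only [Option.some.injEq, Prod.mk.injEq] at hj'
              obtain ⟨rfl, rfl⟩ := hj'
              have hpX : p ∈ XX a k i := E.mem hjk hk.le hj
              have hqX := (E.add hk hkk).1.1
              -- `p` is above `q`
              have hrow : p.1 < q.1 := by
                rcases m1 with m1 | m1
                · exact (T.1 m1).2.2
                · by_contra hlt
                  exact hqX ((E.idl hk.le i).2 _ _ _ _ hpX (by omega) (by omega) qd)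
              have hcol : q.2 < p.2 := by
                by_contra hlt
                have := b1.1.2.2.2 (by omega)
                exact b2.1.1 (hX.2 _ _ _ _ this (by omega) (by omega) pd)
              refine ⟨fun _ => ⟨fl, by omega, ?_⟩, fun hh => by rw [fl] at hh; cases hh⟩
              rw [m3]
              exact colEnd_gt hXk hjX (by omega) (by omega)
            · exfalso
              rw [nomv] at j1
              have j1 : q = p := Option.some.inj j1
              subst j1
              -- `p = q`: impossible
              rcases m1 with m1 | m1
              · have := T.1 m1; omega
              · have := ihd j hjK q (by rw [hj, fl]); omega

end HB

namespace HB

def Rep (T : List (List ℕ)) (F : Cell → ℕ) : Prop :=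
  ∀ r j, (j < (T.getD r []).length ↔ F (r, r + j) ≠ 0) ∧ (T.getD r []).getD j 0 = F (r, r + j)

theorem Rep.len {T : List (List ℕ)} {F : Cell → ℕ} (h : Rep T F) {r j : ℕ}
    (h1 : F (r, r + j) = 0) (h2 : ∀ i < j, F (r, r + i) ≠ 0) : (T.getD r []).length = j := by
  have a1 := (h r j).1
  rcases lt_trichotomy (T.getD r []).length j with e | e | e
  · have := (h r (T.getD r []).length).1.mpr (h2 _ e); omega
  · exact e
  · exact absurd h1 (a1.mp e)

theorem Rep.lenT {T : List (List ℕ)} {F : Cell → ℕ} (h : Rep T F) {r j : ℕ}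
    (h1 : F (r, r + j) ≠ 0) : r < T.length := by
  by_contra hlt
  have := (h r j).1.mpr h1
  rw [List.getD_eq_default _ _ (by omega)] at this
  simp at this

theorem setBox_old {T : List (List ℕ)} {r j : ℕ} (v : ℕ) (h1 : r < T.length)
    (h2 : j < (T.getD r []).length) : setBox T r j v = T.set r ((T.getD r []).set j v) := by
  simp only [setBox, if_pos h1, padSet, if_pos h2]

theorem getD_set_list (T : List (List ℕ)) {r : ℕ} (hr : r < T.length) (v : List ℕ) (c : ℕ) :
    (T.set r v).getD c [] = if c = r then v else T.getD c [] := by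
  simp only [List.getD_eq_getElem?_getD, List.getElem?_set]
  by_cases h1 : r = c
  · subst h1; simp [hr]
  · rw [if_neg h1, if_neg (fun e => h1 e.symm)]

theorem Rep.set {T : List (List ℕ)} {F : Cell → ℕ} (h : Rep T F) {r c v : ℕ} (hrc : r ≤ c)
    (hv : v ≠ 0) (h1 : F (r, c) = 0 → (∀ c', r ≤ c' → c' < c → F (r, c') ≠ 0))
    (h2 : F (r, c) = 0 → 0 < r → F (r - 1, c) ≠ 0) :
    Rep (setBox T r (c - r) v) (Function.update F (r, c) v) := by
  obtain ⟨j, rfl⟩ : ∃ j, c = r + j := ⟨c - r, by omega⟩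
  rw [Nat.add_sub_cancel_left]
  by_cases h0 : F (r, r + j) = 0
  · have hl := h.len h0 (fun i hi => h1 h0 _ (by omega) (by omega))
    have hT : r ≤ T.length := by
      rcases Nat.eq_zero_or_pos r with e | e
      · omega
      · have := h.lenT (r := r - 1) (j := j + 1) (by
          have := h2 h0 e
          rwa [show r - 1 + (j + 1) = r + j by omega])
        omega
    obtain ⟨b1, -, -⟩ := setBox_new v hT hl
    intro r' j'
    rw [b1]
    by_cases e : r' = r
    · subst e
      rw [if_pos rfl, getD_append_one, hl]
      by_cases e2 : j' = j
      · subst e2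
        rw [Function.update_self, if_pos rfl]
        refine ⟨⟨fun _ => hv, fun _ => ?_⟩, rfl⟩
        rw [List.length_append, List.length_singleton]; omega
      · rw [if_neg e2, Function.update_of_ne (by simp; omega)]
        refine ⟨?_, (h r' j').2⟩
        rw [← (h r' j').1, List.length_append, List.length_singleton]; omega
    · rw [if_neg e, Function.update_of_ne (by simp; omega)]
      exact h r' j'
  · have hT := h.lenT h0
    have hl := (h r j).1.mpr h0
    rw [setBox_old v hT hl]
    intro r' j'
    rw [getD_set_list _ hT]
    by_cases e : r' = r
    · subst e
      rw [if_pos rfl, getD_set_one _ hl, List.length_set]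
      by_cases e2 : j' = j
      · subst e2
        rw [Function.update_self, if_pos rfl]
        exact ⟨⟨fun _ => hv, fun _ => hl⟩, rfl⟩
      · rw [if_neg e2, Function.update_of_ne (by simp; omega)]
        exact h r' j'
    · rw [if_neg e, Function.update_of_ne (by simp; omega)]
      exact h r' j'

/-- what happens after the value `z` has been bumped from the cell `s` -/
def cont (fuel : ℕ) (T : List (List ℕ)) (s : Cell) (z : ℕ) : List (List ℕ) × (ℕ × ℕ) :=
  if z = 0 then (T, s) else
    if (if s.1 = s.2 ∧ z % 2 = 0 then z - 1 else z) % 2 = 0 then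
      mixedIns fuel T true (s.1 + 1) (if s.1 = s.2 ∧ z % 2 = 0 then z - 1 else z)
    else mixedIns fuel T false (s.2 + 1) (if s.1 = s.2 ∧ z % 2 = 0 then z - 1 else z)

theorem mixed_row {T : List (List ℕ)} {F : Cell → ℕ} (h : Rep T F) {r c v : ℕ} (fuel : ℕ)
    (hrc : r ≤ c)
    (h1 : ∀ c', r ≤ c' → c' < c → F (r, c') ≠ 0 ∧ F (r, c') ≤ v)
    (h2 : F (r, c) = 0 ∨ v < F (r, c)) :
    mixedIns (fuel + 1) T true r v = cont fuel (setBox T r (c - r) v) (r, c) (F (r, c)) := by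
  obtain ⟨j, rfl⟩ : ∃ j, c = r + j := ⟨c - r, by omega⟩
  rw [Nat.add_sub_cancel_left]
  by_cases h0 : F (r, r + j) = 0
  · have hl := h.len h0 (fun i hi => (h1 _ (by omega) (by omega)).1)
    have hn : (T.getD r []).findIdx? (fun z => decide (v < z)) = none := by
      apply findIdx?_none
      intro i hi
      simp only [decide_eq_false_iff_not]
      rw [(h r i).2]
      have := (h1 (r + i) (by omega) (by omega)).2
      omega
    simp only [mixedIns, hn, hl, cont, if_pos h0]
  · have hT := h.lenT h0
    have hl := (h r j).1.mpr h0
    have hn : (T.getD r []).findIdx? (fun z => decide (v < z)) = some j := by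
      apply findIdx?_some hl
      · simp only [decide_eq_true_eq]
        rw [(h r j).2]
        omega
      · intro i hi
        simp only [decide_eq_false_iff_not]
        rw [(h r i).2]
        have := (h1 (r + i) (by omega) (by omega)).2
        omega
    have e : (r = r + j) = (j = 0) := by rw [eq_iff_iff]; omega
    simp only [mixedIns, hn, (h r j).2, cont, if_neg h0, setBox_old v hT hl, e]

theorem find?_range {p : ℕ → Bool} {n r : ℕ} (hr : r < n) (h1 : p r = true)
    (h2 : ∀ c < r, p c = false) : (List.range n).find? p = some r := by
  rw [List.find?_range_eq_some]
  refine ⟨h1, by simpa using hr, ?_⟩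
  intro c hc
  simp [h2 c hc]

theorem mixed_col {T : List (List ℕ)} {F : Cell → ℕ} (h : Rep T F) {r c v : ℕ} (fuel : ℕ)
    (hrc : r ≤ c)
    (h1 : ∀ r' < r, F (r', c) ≠ 0 ∧ F (r', c) ≤ v)
    (h2 : F (r, c) = 0 ∨ v < F (r, c))
    (h3 : F (r, c) = 0 → ∀ r', r ≤ r' → r' ≤ c → F (r', c) = 0) :
    mixedIns (fuel + 1) T false c v = cont fuel (setBox T r (c - r) v) (r, c) (F (r, c)) := by
  have hS : ∀ r' ≤ c, sEntry T r' c = F (r', c) := by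
    intro r' hr'
    rw [sEntry, (h r' (c - r')).2, show r' + (c - r') = c by omega]
  have hLn : ∀ r' ≤ c, (c - r' < (T.getD r' []).length ↔ F (r', c) ≠ 0) := by
    intro r' hr'
    rw [(h r' (c - r')).1, show r' + (c - r') = c by omega]
  by_cases h0 : F (r, c) = 0
  · have hn : (List.range (c+1)).find? (fun r =>
        decide (c - r < (T.getD r []).length) && decide (v < sEntry T r c)) = none := by
      rw [List.find?_range_eq_none]
      intro r' hr'
      rw [hS r' (by omega)]
      by_cases e : r' < r
      · have := (h1 r' e).2
        have : ¬ (v < F (r', c)) := by omega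
        simp [this]
      · have := h3 h0 r' (by omega) (by omega)
        simp [this]
    have hf : (List.range (c+1)).findIdx (fun r => decide ((T.getD r []).length ≤ c - r)) = r := by
      rw [List.findIdx_eq (by simp; omega)]
      constructor
      · simp only [List.getElem_range, decide_eq_true_eq]
        have := hLn r hrc
        by_contra hlt
        exact this.mp (by omega) h0
      · intro i hi
        simp only [List.getElem_range, decide_eq_false_iff_not]
        have := (hLn i (by omega)).mpr (h1 i hi).1
        omega
    simp only [mixedIns, hn, hf, cont, if_pos h0]
  · have hn : (List.range (c+1)).find? (fun r =>
        decide (c - r < (T.getD r []).length) && decide (v < sEntry T r c)) = some r := by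
      apply find?_range (by omega)
      · rw [Bool.and_eq_true, decide_eq_true_eq, decide_eq_true_eq, hS r hrc]
        exact ⟨(hLn r hrc).mpr h0, by omega⟩
      · intro i hi
        rw [hS i (by omega)]
        have := (h1 i hi).2
        have : ¬ (v < F (i, c)) := by omega
        simp [this]
    simp only [mixedIns, hn, hS r hrc, cont, if_neg h0]

theorem Rep.card {T : List (List ℕ)} {F : Cell → ℕ} (h : Rep T F) {X : Finset Cell} (hX : Idl X)
    (hF : ∀ c ∈ X, F c ≠ 0) : X.card ≤ tsize T := by
  have e : tsize T = ∑ r ∈ Finset.range T.length, (T.getD r []).length := by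
    clear h hF hX
    rw [tsize]
    induction T with
    | nil => simp
    | cons row T ih =>
      rw [List.length_cons, Finset.sum_range_succ']
      simp only [List.map_cons, List.sum_cons, List.getD_cons_zero, List.getD_cons_succ, ih]
      omega
  have e2 : tsize T =
      ((Finset.range T.length).sigma (fun r => Finset.range (T.getD r []).length)).card := by
    rw [Finset.card_sigma, e]
    simp
  rw [e2]
  refine Finset.card_le_card_of_injOn (fun c => (⟨c.1, c.2 - c.1⟩ : (_ : ℕ) × ℕ)) ?_ ?_
  · rintro ⟨r, c⟩ hc
    have h1 := hX.1 r c hc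
    have h2 := hF _ hc
    rw [show c = r + (c - r) by omega] at h2
    simp only [Finset.coe_sigma, Finset.coe_range, Set.mem_sigma_iff, Set.mem_Iio]
    exact ⟨h.lenT h2, (h r (c - r)).1.mpr h2⟩
  · rintro ⟨r, c⟩ hc ⟨r', c'⟩ hc' e
    have h1 := hX.1 r c hc
    have h2 := hX.1 r' c' hc'
    simp only [Sigma.mk.injEq, heq_eq_eq] at e
    exact Prod.ext e.1 (by simp only; omega)

end HB

namespace HB
variable {K : ℕ} {a L : ℕ → ℕ}

def enc (x : ℕ) (f : Bool) : ℕ := if f = true then 2 * x - 1 else 2 * x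

theorem enc_le (x : ℕ) (f : Bool) : enc x f ≤ 2 * x := by unfold enc; split_ifs <;> omega
theorem le_enc (x : ℕ) (f : Bool) : 2 * x - 1 ≤ enc x f := by unfold enc; split_ifs <;> omega

theorem Enum.occ (E : Enum K a L) {k : ℕ} (hk : k ≤ K) {i : ℕ} {c : Cell} (h : c ∈ XX a k i) :
    ∃ j < k, ∃ f, sA a j i = some (c, f) := by
  induction k with
  | zero =>
    exfalso
    have : XX a 0 i = ∅ := by
      clear h
      induction i with
      | zero => rfl
      | succ i ih => rw [XX_succ, ff_zero, ih]; rfl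
    rw [this] at h; simp at h
  | succ k ih =>
    rcases hs : sA a k i with _ | ⟨p, f⟩
    · rw [E.X_none (by omega) hs] at h
      obtain ⟨j, h1, h2⟩ := ih (by omega) h
      exact ⟨j, by omega, h2⟩
    · rw [(E.add (by omega) hs).2, Finset.mem_insert] at h
      rcases h with rfl | h
      · exact ⟨k, by omega, f, hs⟩
      · obtain ⟨j, h1, h2⟩ := ih (by omega) h
        exact ⟨j, by omega, h2⟩

theorem Enum.uniq_lt (E : Enum K a L) {j k i : ℕ} (hjk : j < k) (hk : k < K) {c : Cell} {f g : Bool}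
    (h1 : sA a j i = some (c, f)) (h2 : sA a k i = some (c, g)) : False :=
  (E.add hk h2).1.1 (E.mem hjk hk.le h1)

theorem Enum.uniq (E : Enum K a L) {j k i : ℕ} (hj : j < K) (hk : k < K) {c : Cell} {f g : Bool}
    (h1 : sA a j i = some (c, f)) (h2 : sA a k i = some (c, g)) : j = k := by
  rcases lt_trichotomy j k with h | h | h
  · exact (E.uniq_lt h hk h1 h2).elim
  · exact h
  · exact (E.uniq_lt h hj h2 h1).elim

theorem XX_sub (k i : ℕ) : XX a k i ⊆ XX a k (i + 1) := by
  rw [XX_succ]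
  rcases ff a k i with _ | s
  · exact Finset.Subset.refl _
  · exact Finset.subset_insert _ _

structure Cfg (K : ℕ) (a L : ℕ → ℕ) (i k : ℕ) (F : Cell → ℕ) : Prop where
  new : ∀ c ∈ XX a k (i + 1), ∃ j < k, ∃ f, sA a j (i + 1) = some (c, f) ∧ F c = enc (L j) f
  old : ∀ c ∉ XX a k (i + 1), ∀ j, k ≤ j → j < K → ∀ f, sA a j i = some (c, f) → F c = enc (L j) f
  emp : ∀ c ∉ XX a k (i + 1), c ∉ XX a K i → F c = 0

theorem Cfg.ne (E : Enum K a L) (Lp : ∀ k < K, 1 ≤ L k) {i k : ℕ} {F : Cell → ℕ} (hk : k ≤ K)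
    (h : Cfg K a L i k F) {c : Cell} (hc : c ∈ XX a k (i + 1)) : F c ≠ 0 := by
  obtain ⟨j, h1, f, h2, h3⟩ := h.new c hc
  have := le_enc (L j) f
  have := Lp j (by omega)
  omega

/-- the occupant of a cell outside of the smaller letters -/
theorem Cfg.at (E : Enum K a L) (Lp : ∀ k < K, 1 ≤ L k) {i k : ℕ} {F : Cell → ℕ} (hk : k ≤ K)
    (h : Cfg K a L i k F) {c : Cell} (hc : c ∉ XX a k (i + 1)) :
    (F c = 0 ∧ c ∉ XX a K i) ∨ ∃ m, k ≤ m ∧ m < K ∧ ∃ f, sA a m i = some (c, f) ∧ F c = enc (L m) f := by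
  by_cases h1 : c ∈ XX a K i
  · right
    obtain ⟨m, h2, f, h3⟩ := E.occ le_rfl h1
    by_cases h4 : k ≤ m
    · exact ⟨m, h4, h2, f, h3, h.old c hc m h4 h2 f h3⟩
    · exact absurd (XX_sub k i (E.mem (by omega) hk h3)) hc
  · exact Or.inl ⟨h.emp c hc h1, h1⟩

theorem Cfg.place (E : Enum K a L) (Lp : ∀ k < K, 1 ≤ L k) {i k : ℕ} {F : Cell → ℕ} (hk : k < K)
    (h : Cfg K a L i k F) {T : List (List ℕ)} (hT : Rep T F) {q : Cell} {g : Bool}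
    (hq : sA a k (i + 1) = some (q, g))
    (hnone : ∀ c f, sA a k i = some (c, f) → c ∈ XX a k (i + 1)) :
    Rep (setBox T q.1 (q.2 - q.1) (enc (L k) g)) (Function.update F q (enc (L k) g)) ∧
    Cfg K a L i (k + 1) (Function.update F q (enc (L k) g)) := by
  obtain ⟨hA, hX⟩ := E.add hk hq
  have hI := E.idl hk.le (i + 1)
  have hv : enc (L k) g ≠ 0 := by
    have := le_enc (L k) g
    have := Lp k hk
    omega
  refine ⟨?_, ?_, ?_, ?_⟩
  · apply hT.set hA.2.1 hv
    · intro _ c' h1 h2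
      apply h.ne E Lp hk.le
      exact hI.2 _ _ _ _ (hA.2.2.1 (by omega)) le_rfl (by omega) h1
    · intro _ h1
      exact h.ne E Lp hk.le (hA.2.2.2 h1)
  · intro c hc
    rw [hX, Finset.mem_insert] at hc
    by_cases e : c = q
    · subst e
      exact ⟨k, by omega, g, hq, Function.update_self ..⟩
    · rw [Function.update_of_ne e]
      obtain ⟨j, h1, h2⟩ := h.new c (hc.resolve_left e)
      exact ⟨j, by omega, h2⟩
  · intro c hc j h1 h2 f h3
    rw [hX, Finset.mem_insert, not_or] at hc
    rw [Function.update_of_ne hc.1]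
    exact h.old c hc.2 j (by omega) h2 f h3
  · intro c hc h1
    rw [hX, Finset.mem_insert, not_or] at hc
    rw [Function.update_of_ne hc.1]
    exact h.emp c hc.2 h1

theorem Cfg.skip_abs (E : Enum K a L) {i k : ℕ} {F : Cell → ℕ} (hk : k < K)
    (h : Cfg K a L i k F) (h1 : sA a k i = none) (h2 : sA a k (i + 1) = none) :
    Cfg K a L i (k + 1) F := by
  have hX := E.X_none hk h2
  refine ⟨?_, ?_, ?_⟩
  · intro c hc
    rw [hX] at hc
    obtain ⟨j, h1, h2⟩ := h.new c hc
    exact ⟨j, by omega, h2⟩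
  · rw [hX]
    intro c hc j h1 h2 f h3
    exact h.old c hc j (by omega) h2 f h3
  · rw [hX]; exact h.emp

theorem Cfg.skip_same (E : Enum K a L) {i k : ℕ} {F : Cell → ℕ} (hk : k < K)
    (h : Cfg K a L i k F) {p : Cell} {f : Bool} (h1 : sA a k i = some (p, f))
    (h2 : sA a k (i + 1) = some (p, f)) :
    Cfg K a L i (k + 1) F := by
  obtain ⟨hA, hX⟩ := E.add hk h2
  refine ⟨?_, ?_, ?_⟩
  · intro c hc
    rw [hX, Finset.mem_insert] at hc
    by_cases e : c = p
    · subst e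
      exact ⟨k, by omega, f, h2, h.old c hA.1 k le_rfl hk f h1⟩
    · obtain ⟨j, h1, h2⟩ := h.new c (hc.resolve_left e)
      exact ⟨j, by omega, h2⟩
  · intro c hc j h1 h2 f h3
    rw [hX, Finset.mem_insert, not_or] at hc
    exact h.old c hc.2 j (by omega) h2 f h3
  · intro c hc h1
    rw [hX, Finset.mem_insert, not_or] at hc
    exact h.emp c hc.2 h1

theorem Enum.claim (E : Enum K a L) (Lp : ∀ k < K, 1 ≤ L k) {i k : ℕ} (hk : k ≤ K) :
    ∀ (T : List (List ℕ)) (F : Cell → ℕ) (s : Cell) (z fuel : ℕ), ff a k i = some s → Rep T F →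
    Cfg K a L i k F →
    (∀ m, k ≤ m → m < K → ∀ f, sA a m i = some (s, f) → z = enc (L m) f) →
    (s ∉ XX a K i → z = 0) → (XX a K i).card ≤ fuel + (XX a k i).card →
    ∃ T' F' s', cont fuel T s z = (T', s') ∧ Rep T' F' ∧ Cfg K a L i K F' ∧ ff a K i = some s' := by
  induction hk using Nat.decreasingInduction with
  | self =>
    intro T F s z fuel h1 h2 h3 h4 h5 h6
    refine ⟨T, F, s, ?_, h2, h3, h1⟩
    rw [cont, if_pos (h5 (E.arr le_rfl h1).1.1)]
  | of_succ k hk ih =>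
    intro T F s z fuel h1 h2 h3 h4 h5 h6
    rcases hs : sA a k i with _ | ⟨p, f⟩
    · have hs' := hs
      rw [st_none_iff] at hs
      by_cases e : i = a k
      · subst e; rw [E.fresh hk] at h1; cases h1
      obtain ⟨b1, b2⟩ := step_abs (a := a) (k := k) (i := i) (by omega)
      exact ih T F s z fuel (by rw [b2]; exact h1) h2 (h3.skip_abs E hk hs' b1)
        (fun m hm => h4 m (by omega)) h5 (by rw [E.X_none hk hs']; exact h6)
    · obtain ⟨hA, hX⟩ := E.add hk hs
      have hcard : (XX a (k + 1) i).card = (XX a k i).card + 1 := by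
        rw [hX, Finset.card_insert_of_notMem hA.1]
      rcases E.step hk hs with ⟨b1, b2, b3⟩ | ⟨b1, q, g, b2, b3, b4⟩
      · exact ih T F s z fuel (by rw [b3]; exact h1) h2 (h3.skip_same E hk hs b2)
          (fun m hm => h4 m (by omega)) h5 (by omega)
      · rw [h1] at b1
        have b1 : s = p := Option.some.inj b1
        subst b1
        have hz := h4 k le_rfl hk f hs
        have hLk := Lp k hk
        have hsK : s ∈ XX a K i := E.mem hk le_rfl hs
        have hsk : s ∈ XX a k (i + 1) := by
          rw [(E.arr hk.le h1).2]; exact Finset.mem_insert_self _ _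
        obtain ⟨hA2, hX2⟩ := E.add hk b2
        have hlt : (XX a k i).card < (XX a K i).card := by
          apply Finset.card_lt_card
          refine ⟨E.X_mono hk.le le_rfl, fun hh => hA.1 (hh hsK)⟩
        obtain ⟨fuel, rfl⟩ : ∃ x, fuel = x + 1 := ⟨fuel - 1, by omega⟩
        obtain ⟨P1, P2⟩ := h3.place E Lp hk h2 b2 (fun c f' h => by
          rw [hs] at h; cases h; exact hsk)
        have hgoal := ih _ _ q (F q) fuel b3 P1 P2 (fun m h1 h2 f' h => h3.old q hA2.1 m (by omega) h2 f' h)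
          (fun h => h3.emp q hA2.1 h) (by omega)
        suffices hc : cont (fuel + 1) T s z = cont fuel (setBox T q.1 (q.2 - q.1) (enc (L k) g)) q (F q) by
          rw [hc]; exact hgoal
        have tieI := (E.tie i)
        have tieJ := (E.tie (i + 1))
        have hat := h3.at E Lp hk.le hA2.1
        have hnk : ∀ f', sA a k i ≠ some (q, f') := by
          intro f' hh
          rw [hs] at hh; cases hh
          exact hA2.1 hsk
        rcases b4 with ⟨m1, m2, m3, m4, m5, m6⟩ | ⟨m1, m2, m3, m4, m5⟩
        · have hz0 : z = 2 * L k := by rw [hz, m1]; rfl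
          have hg : enc (L k) g = 2 * L k := by rw [m2]; rfl
          have hz1 : (if s.1 = s.2 ∧ z % 2 = 0 then z - 1 else z) = 2 * L k := by
            rw [if_neg (by omega), hz0]
          have hz2 : (2 * L k) % 2 = 0 := by omega
          rw [cont, if_neg (by omega), hz1, if_pos hz2, hg, ← m5]
          have hq : q = (q.1, q.2) := rfl
          apply mixed_row h2 fuel hA2.2.1
          · intro c' c1 c2
            have hm : (q.1, c') ∈ XX a k (i + 1) := (E.idl hk.le (i + 1)).2 _ _ _ _
              (hA2.2.2.1 (by omega)) le_rfl (by omega) c1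
            obtain ⟨j, j1, f', j2, j3⟩ := h3.new _ hm
            have := E.mono j k j1.le hk
            have := enc_le (L j) f'
            have := le_enc (L j) f'
            have := Lp j (by omega)
            omega
          · rcases hat with hat | ⟨m, n1, n2, f', n3, n4⟩
            · exact Or.inl hat.1
            · right
              have n4 : F (q.1, q.2) = enc (L m) f' := n4
              have hmk : m ≠ k := by
                rintro rfl; exact hnk _ n3
              have hLm := E.mono k m n1 n2
              have := le_enc (L m) f'
              rcases Nat.lt_or_ge (L k) (L m) with hl | hl
              · omega
              · exfalso
                have t := tieI.2 k m (by omega) n2 (by omega) s f q f' hs n3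
                have := t.2 m1
                omega
        · have hz1 : (if s.1 = s.2 ∧ z % 2 = 0 then z - 1 else z) = 2 * L k - 1 := by
            rw [hz]
            rcases m1 with m1 | m1
            · have := tieI.1 k hk s (by rw [hs, m1])
              rw [if_neg (by omega), m1]; rfl
            · have : f = false := by
                by_contra hf
                have := tieI.1 k hk s (by rw [hs]; simpa using hf)
                omega
              rw [this]
              simp only [enc, Bool.false_eq_true, if_false]
              rw [if_pos ⟨m1, by omega⟩]
          have hz0 : z ≠ 0 := by
            have := le_enc (L k) f; omega
          have hg : enc (L k) g = 2 * L k - 1 := by rw [m2]; rfl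
          have hz2 : ¬ ((2 * L k - 1) % 2 = 0) := by omega
          rw [cont, if_neg hz0, hz1, if_neg hz2, hg, ← m4]
          apply mixed_col h2 fuel hA2.2.1
          · intro r' c1
            have hm : (r', q.2) ∈ XX a k (i + 1) := (E.idl hk.le (i + 1)).2 _ _ _ _
              (hA2.2.2.2 (by omega)) (by omega) le_rfl (by have := hA2.2.1; omega)
            refine ⟨h3.ne E Lp hk.le hm, ?_⟩
            obtain ⟨j, j1, f', j2, j3⟩ := h3.new _ hm
            have hLj := E.mono j k j1.le hk
            have := enc_le (L j) f'
            rcases Nat.lt_or_ge (L j) (L k) with hl | hl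
            · omega
            · have t := (tieJ.2 j k j1 hk (by omega) _ f' q g j2 b2).1 m2
              rw [j3, t.1]
              simp only [enc, if_true]
              omega
          · rcases hat with hat | ⟨m, n1, n2, f', n3, n4⟩
            · exact Or.inl hat.1
            · right
              have n4 : F (q.1, q.2) = enc (L m) f' := n4
              have hmk : m ≠ k := by
                rintro rfl; exact hnk _ n3
              have hLm := E.mono k m n1 n2
              have := le_enc (L m) f'
              rcases Nat.lt_or_ge (L k) (L m) with hl | hl
              · omega
              · have t := tieI.2 k m (by omega) n2 (by omega) s f q f' hs n3
                have hf' : f' = false := by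
                  by_contra hf
                  have := t.1 (by simpa using hf)
                  omega
                rw [hf'] at n4
                simp only [enc, Bool.false_eq_true, if_false] at n4
                omega
          · intro h0 r' c1 c2
            have hqK : q ∉ XX a K i := by
              rcases hat with hat | ⟨m, n1, n2, f', n3, n4⟩
              · exact hat.2
              · exfalso
                have := le_enc (L m) f'
                have := Lp m n2
                have : F q = 0 := h0
                omega
            apply h3.emp
            · exact fun hh => hA2.1 ((E.idl hk.le (i + 1)).2 _ _ _ _ hh c1 le_rfl hA2.2.1)
            · exact fun hh => hqK ((E.idl le_rfl i).2 _ _ _ _ hh c1 le_rfl hA2.2.1)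

structure Full (K : ℕ) (a L : ℕ → ℕ) (i : ℕ) (F : Cell → ℕ) : Prop where
  val : ∀ j < K, ∀ c f, sA a j i = some (c, f) → F c = enc (L j) f
  emp : ∀ c ∉ XX a K i, F c = 0

theorem Enum.ins (E : Enum K a L) (Lp : ∀ k < K, 1 ≤ L k) {k : ℕ} (hk : k < K)
    {T : List (List ℕ)} {F : Cell → ℕ} (hT : Rep T F) (hF : Full K a L (a k) F) :
    ∃ T' F' s', mixedInsLetter T (L k) = (T', s') ∧ Rep T' F' ∧ Full K a L (a k + 1) F' ∧
      ff a K (a k) = some s' := by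
  obtain ⟨e1, e2, e3⟩ := E.step_new hk
  have hXe : XX a k (a k + 1) = XX a k (a k) := by rw [XX_succ, e3]; rfl
  have hno : sA a k (a k) = none := st_none_iff.mpr le_rfl
  have hC : Cfg K a L (a k) k F := by
    refine ⟨?_, ?_, ?_⟩
    · rw [hXe]
      intro c hc
      obtain ⟨j, h1, f, h2⟩ := E.occ hk.le hc
      have hj : ff a j (a k) = none := by
        rw [ff_none_iff] at e3 ⊢
        exact fun m hm => e3 m (by omega)
      refine ⟨j, h1, f, ?_, hF.val j (by omega) c f h2⟩
      rcases E.step (show j < K by omega) h2 with h | h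
      · exact h.2.1
      · rw [hj] at h; cases h.1
    · intro c hc j h1 h2 f h3
      exact hF.val j h2 c f h3
    · intro c _ hc
      exact hF.emp c hc
  obtain ⟨hA, hX⟩ := E.add hk e1
  generalize hq : rowEnd (XX a k (a k)) 0 = q at *
  have hq1 : q.1 = 0 := by rw [← hq]; rfl
  obtain ⟨P1, P2⟩ := hC.place E Lp hk hT e1 (fun c f h => by rw [hno] at h; cases h)
  have hXi : XX a (k + 1) (a k) = XX a k (a k) := E.X_none hk hno
  have hval : enc (L k) false = 2 * L k := rfl
  have hne : ∀ c ∈ XX a K (a k), F c ≠ 0 := by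
    intro c hc
    obtain ⟨j, h1, f, h2⟩ := E.occ le_rfl hc
    rw [hF.val j h1 c f h2]
    have := le_enc (L j) f
    have := Lp j h1
    omega
  have hcard := hT.card (E.idl le_rfl (a k)) hne
  obtain ⟨T', F', s', g1, g2, g3, g4⟩ := E.claim Lp (show k + 1 ≤ K by omega) _ _ q (F q)
    (tsize T + 1) e2 P1 P2 (fun m _ h2 f' h => hF.val m h2 q f' h)
    (fun h => hF.emp q h) (by omega)
  refine ⟨T', F', s', ?_, g2, ⟨?_, ?_⟩, g4⟩
  · rw [← g1, mixedInsLetter, hval, ← hq1]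
    apply mixed_row hT _ hA.2.1
    · intro c' c1 c2
      have hm : (q.1, c') ∈ XX a k (a k + 1) := (E.idl hk.le _).2 _ _ _ _
        (hA.2.2.1 (by omega)) le_rfl (by omega) c1
      obtain ⟨j, j1, f', j2, j3⟩ := hC.new _ hm
      have := E.mono j k j1.le hk
      have := enc_le (L j) f'
      have := le_enc (L j) f'
      have := Lp j (by omega)
      omega
    · rcases hC.at E Lp hk.le hA.1 with hat | ⟨m, n1, n2, f', n3, n4⟩
      · exact Or.inl hat.1
      · right
        have n4 : F (q.1, q.2) = enc (L m) f' := n4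
        have hmk : m ≠ k := by
          rintro rfl; rw [hno] at n3; cases n3
        have hLm := E.mono k m n1 n2
        have := le_enc (L m) f'
        rcases Nat.lt_or_ge (L k) (L m) with hl | hl
        · omega
        · exfalso
          have := E.tm k m (by omega) n2 (by omega)
          rw [st_none_iff.mpr (by omega)] at n3
          cases n3
  · intro j hj c f h
    obtain ⟨j', h1, f', h2, h3⟩ := g3.new c (E.mem hj le_rfl h)
    obtain rfl := E.uniq hj h1 h h2
    rw [h] at h2
    cases h2
    exact h3
  · intro c hc
    exact g3.emp c hc (fun h => hc (XX_sub _ _ h))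

end HB

namespace HB

def aO (M : ℕ) (l : ℕ → ℕ) (n k : ℕ) : ℕ := (ordw M l n).getD k 0

theorem aO_wd (M : ℕ) (l : ℕ → ℕ) (n : ℕ) :
    wd (ordw M l n).length (aO M l n) = ordw M l n := (wd_getD _).symm

theorem ordw_sorted (M : ℕ) (l : ℕ → ℕ) (n : ℕ) :
    (ordw M l n).Pairwise (fun x y => l x < l y ∨ (l x = l y ∧ x < y)) := by
  induction n with
  | zero => simp [ordw]
  | succ n ih =>
    rw [ordw, List.pairwise_append]
    refine ⟨ih, ?_, ?_⟩
    · have h1 : (tms M l (n + 1)).Pairwise (· < ·) := List.Pairwise.filter _ List.pairwise_lt_range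
      refine h1.imp_of_mem ?_
      intro x y hx hy hxy
      rw [mem_tms] at hx hy
      right; omega
    · intro x hx y hy
      rw [mem_ordw] at hx
      rw [mem_tms] at hy
      left; omega

theorem aO_lt {M : ℕ} {l : ℕ → ℕ} {n j k : ℕ} (hjk : j < k) (hk : k < (ordw M l n).length) :
    l (aO M l n j) < l (aO M l n k) ∨ (l (aO M l n j) = l (aO M l n k) ∧ aO M l n j < aO M l n k) := by
  have := List.pairwise_iff_getElem.mp (ordw_sorted M l n) j k (by omega) hk hjk
  simp only [aO]
  rw [List.getD_eq_getElem _ _ (by omega : j < _), List.getD_eq_getElem _ _ hk]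
  exact this

theorem aO_mem {M : ℕ} {l : ℕ → ℕ} {n k : ℕ} (hk : k < (ordw M l n).length) :
    aO M l n k < M ∧ 1 ≤ l (aO M l n k) ∧ l (aO M l n k) ≤ n := by
  rw [← mem_ordw, aO, List.getD_eq_getElem _ _ hk]
  exact List.getElem_mem hk

theorem enum_ordw (M : ℕ) (l : ℕ → ℕ) (n : ℕ) :
    Enum (ordw M l n).length (aO M l n) (fun k => l (aO M l n k)) := by
  refine ⟨?_, ?_, ?_⟩
  · intro j k hj hk e
    rcases lt_trichotomy j k with h | h | h
    · have := aO_lt h hk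
      rw [e] at this; omega
    · exact h
    · have := aO_lt h hj
      rw [e] at this; omega
  · intro j k hjk hk
    rcases hjk.lt_or_eq with h | h
    · have := aO_lt h hk
      omega
    · rw [h]
  · intro j k hjk hk e
    have := aO_lt hjk hk
    omega

theorem aO_surj {n M : ℕ} {l : ℕ → ℕ} (h : YW n M l) {i : ℕ} (hi : i < M) :
    ∃ k < (ordw M l n).length, aO M l n k = i := by
  have : i ∈ ordw M l n := mem_ordw.mpr ⟨hi, h.pos i hi⟩
  obtain ⟨k, hk, e⟩ := List.getElem_of_mem this
  exact ⟨k, hk, by rw [aO, List.getD_eq_getElem _ _ hk, e]⟩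

theorem ff_aO (M : ℕ) (l : ℕ → ℕ) (n : ℕ) :
    ff (aO M l n) (ordw M l n).length = PB ∅ (ordw M l n) := by rw [ff, aO_wd]

theorem mixed_inv {n M : ℕ} {l : ℕ → ℕ} (h : YW n M l) : ∀ i ≤ M,
    (∃ F, Rep (mixedPQ (wd i l)).1 F ∧
      Full (ordw M l n).length (aO M l n) (fun k => l (aO M l n k)) i F) ∧
    tsize (mixedPQ (wd i l)).2 = i ∧
    ∃ G, Rep (mixedPQ (wd i l)).2 G ∧ IsFill 0 i (PB ∅ (ordw M l n)) G := by
  intro i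
  induction i with
  | zero =>
    intro _
    refine ⟨⟨fun _ => 0, ?_, ?_, fun _ _ => rfl⟩, ?_, fun _ => 0, ?_, ?_⟩
    · intro r j; simp [mixedPQ, wd]
    · intro j _ c f h; cases h
    · simp [mixedPQ, wd, tsize]
    · intro r j; simp [mixedPQ, wd]
    · intro c v; simp
  | succ i ih =>
    intro hi
    obtain ⟨⟨F, hF1, hF2⟩, hsz, G, hG1, hG2⟩ := ih (by omega)
    have hstep : mixedPQ (wd (i + 1) l) = ((mixedInsLetter (mixedPQ (wd i l)).1 (l i)).1,
        setBox (mixedPQ (wd i l)).2 (mixedInsLetter (mixedPQ (wd i l)).1 (l i)).2.1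
          ((mixedInsLetter (mixedPQ (wd i l)).1 (l i)).2.2 -
            (mixedInsLetter (mixedPQ (wd i l)).1 (l i)).2.1)
          (tsize (mixedPQ (wd i l)).2 + 1)) := by
      conv_lhs => rw [mixedPQ, wd_succ, List.foldl_append]
      rfl
    rw [hstep]
    generalize (mixedPQ (wd i l)).1 = P at *
    generalize (mixedPQ (wd i l)).2 = Q at *
    have E := enum_ordw M l n
    have Lp : ∀ k < (ordw M l n).length, 1 ≤ (fun k => l (aO M l n k)) k := fun k hk => (aO_mem hk).2.1
    obtain ⟨k, hk, e⟩ := aO_surj h (show i < M by omega)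
    rw [← e] at hF2
    obtain ⟨T', F', s, g1, g2, g3, g4⟩ := E.ins Lp hk hF1 hF2
    simp only [e] at g1 g3 g4
    rw [ff_aO] at g4
    rw [g1]
    have hval : Valid ∅ (PB ∅ (ordw M l n)) := PB_valid idl_empty ordw_nodup
    have hA := hval i s g4
    have hne : ∀ c ∈ shp ∅ (PB ∅ (ordw M l n)) i, G c ≠ 0 := by
      intro c hc
      rw [mem_shp_iff] at hc
      obtain hc | ⟨v, hv, hc⟩ := hc
      · simp at hc
      · have := (hG2 c v).mpr ⟨hv, hc⟩
        omega
    have h0 : G s = 0 := by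
      rcases hz : G s with _ | v
      · rfl
      · have := (hG2 s v).mp hz
        exact absurd (mem_shp_iff.mpr (Or.inr ⟨v, this.1, this.2⟩)) hA.1
    have hleft : ∀ c', s.1 ≤ c' → c' < s.2 → G (s.1, c') ≠ 0 := by
      intro c' h1 h2
      exact hne _ ((hval.idl idl_empty i).2 _ _ _ _ (hA.2.2.1 (by omega)) le_rfl (by omega) h1)
    refine ⟨⟨F', g2, g3⟩, ?_, Function.update G s (i + 1), ?_, ?_⟩
    · have hd := hA.2.1
      have h0' : G (s.1, s.1 + (s.2 - s.1)) = 0 := by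
        rw [show s.1 + (s.2 - s.1) = s.2 by omega]; exact h0
      have hl := hG1.len h0' (fun j hj => hleft _ (by omega) (by omega))
      have hT : s.1 ≤ Q.length := by
        rcases Nat.eq_zero_or_pos s.1 with e | e
        · omega
        · have := hG1.lenT (r := s.1 - 1) (j := s.2 - (s.1 - 1)) (by
            have := hne _ (hA.2.2.2 e)
            rwa [show s.1 - 1 + (s.2 - (s.1 - 1)) = s.2 by omega])
          omega
      rw [(setBox_new _ hT hl).2.1, hsz]
    · rw [hsz]
      exact hG1.set hA.2.1 (by omega) (fun _ => hleft) (fun _ h => hne _ (hA.2.2.2 h))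
    · intro c v
      by_cases ec : c = s
      · subst ec
        rw [Function.update_self]
        constructor
        · intro e
          obtain rfl : i = v := by omega
          exact ⟨by omega, g4⟩
        · rintro ⟨h1, h2⟩
          by_cases e : v < i
          · have := (hG2 c v).mpr ⟨e, h2⟩
            omega
          · omega
      · rw [Function.update_of_ne ec, hG2]
        constructor
        · rintro ⟨h1, h2⟩; exact ⟨by omega, h2⟩
        · rintro ⟨h1, h2⟩
          refine ⟨?_, h2⟩
          by_contra hlt
          obtain rfl : v = i := by omega
          rw [g4] at h2
          exact ec (Option.some.inj h2).symm

theorem mixed_fill {n M : ℕ} {l : ℕ → ℕ} (h : YW n M l) :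
    IsFill 0 M (PB ∅ (ordw M l n)) (toFunShifted (mixedQ (wd M l))) := by
  obtain ⟨-, -, G, h1, h2⟩ := mixed_inv h M le_rfl
  suffices e : toFunShifted (mixedQ (wd M l)) = G by rw [e]; exact h2
  funext c
  rw [toFunShifted]
  split_ifs with hc
  · rw [mixedQ, (h1 _ _).2, show c.1 + (c.2 - c.1) = c.2 by omega]
  · rcases hz : G c with _ | v
    · rfl
    · exfalso
      have := ((h2 c v).mp hz).2
      exact hc ((PB_valid idl_empty ordw_nodup) v _ this).2.1

theorem SqW.mixed_promote {n M : ℕ} {l : ℕ → ℕ} (h : SqW n M l)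
    (hD : shp ∅ (PB ∅ (ordw (M + 1) l n)) (M + 1) =
      shp ∅ (PB ∅ (ordw (M + 1) (pl n M l) n)) (M + 1)) :
    promote (M + 1) (toFunShifted (mixedQ (wd (M + 1) l))) =
      toFunShifted (mixedQ (wd (M + 1) (pl n M l))) := by
  have h1 := mixed_fill h.toYW
  have h2 := promote_link idl_empty (PB_valid idl_empty ordw_nodup) h.mixed_stream.1 h1
  exact h2.unique (mixed_fill h.pl_sq.toYW) (h.mixed_pro hD)

theorem main_of (hD : ∀ {n M : ℕ} {l l' : ℕ → ℕ}, SqW n M l → SqW n M l' →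
    shp ∅ (PB ∅ (ordw (M + 1) l n)) (M + 1) = shp ∅ (PB ∅ (ordw (M + 1) l' n)) (M + 1))
    (n : ℕ) (hn : 0 < n) (w : List ℕ) (hw : IsSquareWord n w) :
    promote (n ^ 2) (toFunStraight (rskQ w)) =
      toFunStraight (rskQ (cryEbar n (w.drop 1) ++ [1])) ∧
    promote (n ^ 2) (toFunShifted (mixedQ w)) =
      toFunShifted (mixedQ (cryEbar n (w.drop 1) ++ [1])) ∧
    (∀ v : List ℕ, IsSquareWord n v →
      toFunStraight (rskQ v) = promote (n ^ 2) (toFunStraight (rskQ w)) →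
      toFunShifted (mixedQ v) = promote (n ^ 2) (toFunShifted (mixedQ w))) := by
  obtain ⟨M, l, rfl, h⟩ := sq_data hn hw
  have hN : n ^ 2 = M + 1 := by rw [sq, h.sz]
  rw [hN, h.cryEbar]
  have c1 := rsk_promote h
  have c2 := h.mixed_promote (hD h h.pl_sq)
  refine ⟨c1, c2, ?_⟩
  intro v hv e
  obtain ⟨M', l', rfl, h'⟩ := sq_data hn hv
  obtain rfl : M' = M := by
    have := h.sz; have := h'.sz; omega
  rw [c1] at e
  rw [c2, rsk_det h'.toYW h.pl_sq.toYW e]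

end HB

namespace HB

structure Yam (n K : ℕ) (a L cp : ℕ → ℕ) : Prop extends Enum K a L where
  cplt : ∀ j k, j < k → k < K → L j = L k → cp j < cp k
  low : ∀ k < K, ∀ c < cp k, ∃ j < k, L j = L k ∧ cp j = c
  up : ∀ j < K, ∀ y, L j < y → y ≤ n → ∃ k < K, L k = y ∧ cp k = cp j ∧ a k < a j
  rng : ∀ k < K, 1 ≤ L k ∧ L k ≤ n

variable {n K : ℕ} {a L cp : ℕ → ℕ}

theorem Enum.hist (E : Enum K a L) {k i : ℕ} (hk : k < K) {q : Cell} {g : Bool}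
    (h : sA a k (i + 1) = some (q, g)) :
    (a k = i ∧ q = rowEnd (XX a k i) 0 ∧ g = false ∧ ff a (k + 1) i = some q) ∨
    (sA a k i = some (q, g) ∧ ff a k i ≠ some q ∧ ff a (k + 1) i = ff a k i) ∨
    ∃ p f, sA a k i = some (p, f) ∧ ff a k i = some p ∧ ff a (k + 1) i = some q ∧
      (RowMv a k i p q f g ∨ ColMv a k i p q f g) := by
  rcases hs : sA a k i with _ | ⟨p, f⟩
  · rw [st_none_iff] at hs
    by_cases e : i = a k
    · subst e
      obtain ⟨e1, e2, e3⟩ := E.step_new hk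
      rw [h] at e1
      simp only [Option.some.injEq, Prod.mk.injEq] at e1
      left
      refine ⟨rfl, e1.1, e1.2, ?_⟩
      rw [e2, e1.1]
    · rw [(step_abs (a := a) (k := k) (i := i) (by omega)).1] at h; cases h
  · right
    rcases E.step hk hs with ⟨b1, b2, b3⟩ | ⟨b1, q', g', b2, b3, b4⟩
    · rw [h] at b2
      simp only [Option.some.injEq, Prod.mk.injEq] at b2
      obtain ⟨rfl, rfl⟩ := b2
      exact Or.inl ⟨rfl, b1, b3⟩
    · rw [h] at b2
      simp only [Option.some.injEq, Prod.mk.injEq] at b2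
      obtain ⟨rfl, rfl⟩ := b2
      exact Or.inr ⟨p, f, rfl, b1, b3, b4⟩

theorem pres {k i : ℕ} (h : a k < i) : ∃ p f, sA a k i = some (p, f) := by
  rcases hs : sA a k i with _ | ⟨p, f⟩
  · exact absurd hs (st_some h)
  · exact ⟨p, f, rfl⟩

theorem pres_lt {k i : ℕ} {x : Cell × Bool} (h : sA a k i = some x) : a k < i := by
  by_contra hlt
  rw [st_none_iff.mpr (by omega)] at h
  cases h

theorem Enum.lt_of_tm (E : Enum K a L) {j k : ℕ} (hj : j < K) (hL : L j = L k)
    (h : a j < a k) : j < k := by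
  by_contra hlt
  rcases Nat.lt_or_ge k j with h2 | h2
  · have := E.tm k j h2 hj hL.symm
    omega
  · obtain rfl : j = k := by omega
    omega

theorem Enum.lt_of_L (E : Enum K a L) {j k : ℕ} (hj : j < K) (hL : L j < L k) : j < k := by
  by_contra hlt
  have := E.mono k j (by omega) hj
  omega

structure Inv1 (K : ℕ) (a cp : ℕ → ℕ) (i : ℕ) (k : ℕ) : Prop where
  pr : ∀ p, sA a k i = some (p, true) → p.1 = cp k
  un : ∀ p, sA a k i = some (p, false) → p.1 ≤ cp k ∧ cp k ≤ p.2 ∧ (p.1 = cp k → p.2 = cp k)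

def Inv2 (K : ℕ) (a L cp : ℕ → ℕ) (i : ℕ) : Prop :=
  ∀ y z, y < K → z < K → L z = L y + 1 → cp z = cp y → ∀ p f q, sA a y i = some (p, f) →
    sA a z i = some (q, false) → f = false ∧ p.1 < q.1

theorem Yam.chain (E : Yam n K a L cp) {i : ℕ} (h : Inv2 K a L cp i) {y : ℕ} (hy : y < K)
    {p : Cell} {f : Bool} (hp : sA a y i = some (p, f)) :
    ∀ d z, z < K → L z = L y + d + 1 → cp z = cp y → ∀ q, sA a z i = some (q, false) →
      f = false ∧ p.1 + d + 1 ≤ q.1 := by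
  intro d
  induction d with
  | zero =>
    intro z hz h1 h2 q h3
    have := h y z hy hz h1 h2 p f q hp h3
    exact ⟨this.1, by omega⟩
  | succ d ih =>
    intro z hz h1 h2 q h3
    obtain ⟨m, hm, m1, m2, m3⟩ := E.up y hy (L y + d + 1) (by omega) (by have := (E.rng z hz).2; omega)
    have := pres_lt hp
    obtain ⟨r, g, hr⟩ := pres (a := a) (k := m) (i := i) (by omega)
    have b := h m z hm hz (by omega) (by omega) r g q hr h3
    rw [b.1] at hr
    have c := ih m hm m1 m2 r hr
    exact ⟨c.1, by omega⟩

theorem Yam.step1 (E : Yam n K a L cp) {i : ℕ} (h1 : ∀ k < K, Inv1 K a cp i k)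
    (h2 : Inv2 K a L cp i) : ∀ k < K, Inv1 K a cp (i + 1) k := by
  intro k
  induction k using Nat.strong_induction_on with
  | _ k ih =>
  intro hk
  have hT := E.toEnum.tie (i + 1)
  have hI := E.toEnum.idl hk.le (i + 1)
  -- the previous copy
  have prev : 0 < cp k → a k ≤ i → ∃ m pm fm, m < k ∧ L m = L k ∧ cp m + 1 = cp k ∧
      sA a m (i + 1) = some (pm, fm) := by
    intro hc hi
    obtain ⟨m, m1, m2, m3⟩ := E.low k hk (cp k - 1) (by omega)
    have := E.tm m k m1 hk m2
    obtain ⟨pm, fm, hm⟩ := pres (a := a) (k := m) (i := i + 1) (by omega)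
    exact ⟨m, pm, fm, m1, m2, by omega, hm⟩
  constructor
  · intro q hq
    rcases E.toEnum.hist hk hq with ⟨b1, b2, b3, b4⟩ | ⟨b1, b2, b3⟩ | ⟨p, f, b1, b2, b3, b4⟩
    · cases b3
    · exact (h1 k hk).pr q b1
    · rcases b4 with ⟨m1, m2, m3, m4, m5, m6⟩ | ⟨m1, m2, m3, m4, m5⟩
      · cases m2
      · have hrow : p.1 = cp k := by
          cases f with
          | true => exact (h1 k hk).pr p b1
          | false =>
            have := (h1 k hk).un p b1
            have : p.1 = p.2 := by simpa using m1
            omega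
        rcases Nat.eq_zero_or_pos (cp k) with e | e
        · omega
        · obtain ⟨m, pm, fm, n1, n2, n3, n4⟩ := prev e (pres_lt b1).le
          have t := (hT.2 m k n1 hk n2 pm fm q true n4 hq).1 rfl
          rw [t.1] at n4
          have := (ih m n1 (by omega)).pr pm n4
          omega
  · intro q hq
    rcases E.toEnum.hist hk hq with ⟨b1, b2, b3, b4⟩ | ⟨b1, b2, b3⟩ | ⟨p, f, b1, b2, b3, b4⟩
    · have hq1 : q.1 = 0 := by rw [b2]; rfl
      have hq2 : q = rowEnd (XX a k (i + 1)) 0 := by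
        have : ff a k i = none := by rw [← b1]; exact E.toEnum.fresh hk
        rw [b2, XX_succ, this]; rfl
      have hcol : cp k ≤ q.2 := by
        rcases Nat.eq_zero_or_pos (cp k) with e | e
        · omega
        · obtain ⟨m, pm, fm, n1, n2, n3, n4⟩ := prev e b1.le
          have hpm := E.toEnum.mem n1 hk.le n4
          have hd := (E.toEnum.add (by omega) n4).1.2.1
          have : cp m ≤ pm.2 := by
            cases fm with
            | true => have := (ih m n1 (by omega)).pr pm n4; omega
            | false => exact ((ih m n1 (by omega)).un pm n4).2.1
          have := rowEnd_gt hI (r := 0) (r' := pm.1) (c := pm.2) hpm (Nat.zero_le _)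
          rw [← hq2] at this
          omega
      refine ⟨by omega, hcol, fun e => ?_⟩
      by_contra hne
      have e0 : (0, 0) ∈ XX a k i := by
        obtain ⟨r1, r2, r3, r4⟩ := rowEnd_spec (XX a k i) 0
        rw [← b2] at r4
        exact r4 0 le_rfl (by omega)
      obtain ⟨j, j1, f, j2⟩ := E.toEnum.occ hk.le e0
      have j3 := pres_lt j2
      have j4 := E.mono j k j1.le hk
      by_cases e3 : L j = L k
      · have := E.cplt j k j1 hk e3; omega
      · obtain ⟨m, n1, n2, n3, n4⟩ := E.up j (by omega) (L k) (by omega) (E.rng k hk).2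
        have := E.toEnum.lt_of_tm n1 n2 (by omega)
        have := E.cplt m k this hk n2
        omega
    · exact (h1 k hk).un q b1
    · rcases b4 with ⟨m1, m2, m3, m4, m5, m6⟩ | ⟨m1, m2, m3, m4, m5⟩
      · subst m1
        have u := (h1 k hk).un p b1
        have hlt : p.1 < cp k := by
          rcases u.1.lt_or_eq with e | e
          · exact e
          · have := u.2.2 e; omega
        have hqd := (E.toEnum.add hk hq).1.2.1
        have hcol : cp k ≤ q.2 := by
          rcases Nat.lt_or_ge q.1 (cp k) with e | e
          · obtain ⟨m, pm, fm, n1, n2, n3, n4⟩ := prev (by omega) (pres_lt b1).le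
            have hpm := E.toEnum.mem n1 hk.le n4
            have hd := (E.toEnum.add (by omega) n4).1.2.1
            cases fm with
            | true =>
              have := (ih m n1 (by omega)).pr pm n4
              have := rowEnd_gt hI (r := p.1 + 1) (r' := pm.1) (c := pm.2) hpm (by omega)
              rw [← m4] at this
              omega
            | false =>
              have t := (hT.2 m k n1 hk n2 pm false q false n4 hq).2 rfl
              have := ((ih m n1 (by omega)).un pm n4).2.1
              omega
          · omega
        refine ⟨by omega, hcol, fun e => ?_⟩
        by_contra hne
        have e0 : (cp k, cp k) ∈ XX a k (i + 1) := by
          obtain ⟨r1, r2, r3, r4⟩ := rowEnd_spec (XX a k (i + 1)) (p.1 + 1)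
          rw [← m4] at r4
          rw [← e, m5]
          exact r4 _ le_rfl (by omega)
        obtain ⟨j, j1, f, j2⟩ := E.toEnum.occ hk.le e0
        have jf : f = false := by
          cases f with
          | true => have := hT.1 j (by omega) _ j2; simp only at this; omega
          | false => rfl
        subst jf
        have ju := (ih j j1 (by omega)).un _ j2
        simp only at ju
        have j4 := E.mono j k j1.le hk
        by_cases e3 : L j = L k
        · have := E.cplt j k j1 hk e3; omega
        · have ch : ∀ p' f', sA a j i = some (p', f') → p'.1 + 1 < cp k := by
            intro p' f' hp'
            have := E.chain h2 (show j < K by omega) hp' (L k - L j - 1) k hk (by omega) (by omega) p b1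
            omega
          rcases E.toEnum.hist (by omega) j2 with ⟨b1, b2, b3, b4⟩ | ⟨b1, b2, b3⟩ | ⟨p, f, b1, b2, b3, b4⟩
          · have : cp k = 0 := by
              have := congrArg Prod.fst b2
              exact this
            omega
          · have := ch _ _ b1
            simp only at this
            omega
          · have := ch _ _ b1
            rcases b4 with ⟨m1, m2, m3, m4, m5, m6⟩ | ⟨m1, m2, m3, m4, m5⟩
            · simp only at m5; omega
            · simp only at m5; omega
      · cases m2

theorem Enum.sameRow (E : Enum K a L) {k i : ℕ} (hk : k < K) {q s : Cell} {g : Bool}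
    (hq : sA a k i = some (q, g)) (hs : ff a k i = some s) (hr : s.1 = q.1) : s = q := by
  have b1 := (E.arr hk.le hs).1
  have b2 := (E.add hk hq).1
  have c1 := rowEnd_eq (E.idl hk.le i) b1 (r := q.1) hr
  have c2 := rowEnd_eq (E.idl hk.le i) b2 (r := q.1) rfl
  rw [← c1, c2]

/-- the arrival stays in its row -/
theorem Enum.stay (E : Enum K a L) {j k i ρ : ℕ} (hjk : j ≤ k) (hk : k ≤ K)
    (h0 : ∃ s, ff a j i = some s ∧ s.1 = ρ)
    (h : ∀ m, j ≤ m → m < k → ∀ p f q g, sA a m i = some (p, f) → p.1 = ρ →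
      sA a m (i + 1) = some (q, g) → (RowMv a m i p q f g ∨ ColMv a m i p q f g) → q.1 = ρ) :
    ∃ s, ff a k i = some s ∧ s.1 = ρ := by
  induction k, hjk using Nat.le_induction with
  | base => exact h0
  | succ k hjk ih =>
    obtain ⟨s, h1, h2⟩ := ih (by omega) (fun m hm hm' => h m hm (by omega))
    rcases hs : sA a k i with _ | ⟨p, f⟩
    · rw [st_none_iff] at hs
      by_cases e : i = a k
      · subst e; rw [E.fresh (by omega)] at h1; cases h1
      · exact ⟨s, by rw [(step_abs (a := a) (k := k) (i := i) (by omega)).2, h1], h2⟩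
    · rcases E.step (show k < K by omega) hs with ⟨b1, b2, b3⟩ | ⟨b1, q, g, b2, b3, b4⟩
      · exact ⟨s, by rw [b3, h1], h2⟩
      · rw [h1] at b1
        have b1 : s = p := Option.some.inj b1
        subst b1
        exact ⟨q, b3, h k hjk (by omega) s f q g hs h2 b2 b4⟩

theorem Yam.step2 (E : Yam n K a L cp) {i : ℕ} (h1 : ∀ k < K, Inv1 K a cp i k)
    (h1' : ∀ k < K, Inv1 K a cp (i + 1) k)
    (h2 : Inv2 K a L cp i) : Inv2 K a L cp (i + 1) := by
  intro j k hj hk hL hcp p' f' q' hp' hq'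
  have hjk : j < k := E.toEnum.lt_of_L hj (by omega)
  have hT := E.toEnum.tie i
  have hak : a k < a j := by
    obtain ⟨m, n1, n2, n3, n4⟩ := E.up j hj (L k) (by omega) (E.rng k hk).2
    have : m = k := by
      rcases lt_trichotomy m k with e | e | e
      · have := E.cplt m k e hk n2; omega
      · exact e
      · have := E.cplt k m e n1 n2.symm; omega
    rw [← this]; exact n4
  have between : ∀ m, j < m → m < k → L m = L j ∨ (L m = L k ∧ cp m < cp k) := by
    intro m m1 m2
    have x1 := E.mono j m m1.le (by omega)
    have x2 := E.mono m k m2.le hk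
    by_cases e : L m = L j
    · exact Or.inl e
    · exact Or.inr ⟨by omega, E.cplt m k m2 hk (by omega)⟩
  have haj := pres_lt hp'
  -- history of `z`
  have hz : ∃ q, sA a k i = some (q, false) ∧ ((q' = q ∧ ff a k i ≠ some q) ∨ q'.1 = q.1 + 1) := by
    rcases E.toEnum.hist hk hq' with ⟨b1, b2, b3, b4⟩ | ⟨b1, b2, b3⟩ | ⟨p, f, b1, b2, b3, b4⟩
    · omega
    · exact ⟨q', b1, Or.inl ⟨rfl, b2⟩⟩
    · rcases b4 with ⟨m1, m2, m3, m4, m5, m6⟩ | ⟨m1, m2, m3, m4, m5⟩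
      · subst m1
        exact ⟨p, b1, Or.inr m5⟩
      · cases m2
  obtain ⟨q, hq, hmv⟩ := hz
  rcases E.toEnum.hist hj hp' with ⟨b1, b2, b3, b4⟩ | ⟨b1, b2, b3⟩ | ⟨p, f, b1, b2, b3, b4⟩
  · -- `y` is new
    refine ⟨b3, ?_⟩
    have hp0 : p'.1 = 0 := by rw [b2]; rfl
    rw [hp0]
    by_contra hlt
    rcases hmv with ⟨e, hne⟩ | e
    · obtain ⟨s, s1, s2⟩ := E.toEnum.stay (i := i) (ρ := 0) (show j + 1 ≤ k from hjk) hk.le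
        ⟨p', b4, hp0⟩ (by
          intro m m1 m2 p0 f0 q0 g0 z1 z2 z3 z4
          have hm1 := pres_lt z1
          rcases between m (by omega) m2 with e1 | ⟨e1, e2⟩
          · have := E.tm j m (by omega) (by omega) e1.symm
            omega
          · rcases z4 with ⟨c1, c2, c3, c4, c5, c6⟩ | ⟨c1, c2, c3, c4, c5⟩
            · exfalso
              obtain ⟨y, y1, y2, y3⟩ := E.low j hj (cp m) (by omega)
              have := E.tm y j y1 hj y2
              obtain ⟨py, fy, hy⟩ := pres (a := a) (k := y) (i := i) (by omega)
              rw [c1] at z1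
              have := h2 y m (by omega) (by omega) (by omega) (by omega) py fy p0 hy z1
              omega
            · omega)
      have := E.toEnum.sameRow hk hq s1 (by rw [s2, ← e]; omega)
      rw [this] at s1
      exact hne s1
    · omega
  · have := h2 j k hj hk hL hcp p' f' q b1 hq
    refine ⟨this.1, ?_⟩
    rcases hmv with ⟨e, hne⟩ | e
    · rw [e]; exact this.2
    · omega
  · have hlt := h2 j k hj hk hL hcp p f q b1 hq
    obtain ⟨rfl, hlt⟩ := hlt
    have uj := (h1 j hj).un p b1
    have uk := (h1 k hk).un q hq
    rcases b4 with ⟨m1, m2, m3, m4, m5, m6⟩ | ⟨m1, m2, m3, m4, m5⟩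
    · refine ⟨m2, ?_⟩
      by_contra hge
      have hrow : q.1 = p.1 + 1 := by
        rcases hmv with ⟨e, hne⟩ | e
        · rw [e] at hge; omega
        · omega
      rcases hmv with ⟨e, hne⟩ | e
      · obtain ⟨s, s1, s2⟩ := E.toEnum.stay (i := i) (ρ := p.1 + 1) (show j + 1 ≤ k from hjk) hk.le
          ⟨p', b3, m5⟩ (by
            intro m n1 n2 p0 f0 q0 g0 z1 z2 z3 z4
            have hm1 := pres_lt z1
            rcases between m (by omega) n2 with e1 | ⟨e1, e2⟩
            · exfalso
              have := (hT.2 j m (by omega) (by omega) e1.symm p false p0 f0 b1 z1).2 rfl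
              omega
            · have um := h1 m (by omega)
              rcases z4 with ⟨c1, c2, c3, c4, c5, c6⟩ | ⟨c1, c2, c3, c4, c5⟩
              · exfalso
                subst c1
                have um' := um.un p0 z1
                obtain ⟨y, y1, y2, y3⟩ := E.low j hj (cp m) (by omega)
                have ay := E.tm y j y1 hj y2
                have aj := pres_lt b1
                obtain ⟨py, fy, hy⟩ := pres (a := a) (k := y) (i := i) (by omega)
                obtain ⟨rfl, i2⟩ := h2 y m (by omega) (by omega) (by omega) (by omega) py fy p0 hy z1
                have uy := (h1 y (by omega)).un py hy
                have ty := (hT.2 y j y1 hj y2 py false p false hy b1).2 rfl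
                have hyr : py.1 = p.1 := by omega
                rcases E.toEnum.last y1.le hj.le b2 with hl | ⟨t, t1, t2, gt, t3, t4⟩
                · have := E.toEnum.sameRow (by omega) hy hl hyr.symm
                  rw [this] at ty; omega
                · have x1 := E.mono y t t1 (by omega)
                  have x2 := E.mono t j t2.le hj
                  have atj := E.tm t j t2 hj (by omega)
                  rcases t4 with t4 | ⟨pt, ft, t4, t5, t6⟩
                  · omega
                  · have tt := hT.2 t j t2 hj (by omega) pt ft p false t4 b1
                    rcases t6 with ⟨d1, d2, d3, d4, d5, d6⟩ | ⟨d1, d2, d3, d4, d5⟩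
                    · have := tt.2 d1; omega
                    · rcases t1.lt_or_eq with t1 | t1
                      · have ty2 := hT.2 y t t1 (by omega) (by omega) py false pt ft hy t4
                        rcases d1 with d1 | d1
                        · have := (ty2.1 d1).1; cases this
                        · have := ty2.2 rfl
                          have := (E.toEnum.add (by omega) hy).1.2.1
                          omega
                      · subst t1
                        rw [hy] at t4
                        simp only [Option.some.injEq, Prod.mk.injEq] at t4
                        obtain ⟨rfl, rfl⟩ := t4
                        rcases d1 with d1 | d1
                        · cases d1
                        · omega
              · subst c2
                have w := (h1' m (by omega)).pr q0 z3
                cases f0 with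
                | true => have := um.pr p0 z1; omega
                | false =>
                  have := um.un p0 z1
                  have : p0.1 = p0.2 := by simpa using c1
                  omega)
        have := E.toEnum.sameRow hk hq s1 (by omega)
        rw [this] at s1
        exact hne s1
      · omega
    · exfalso
      have : p.1 = p.2 := by simpa using m1
      omega

theorem Yam.inv (E : Yam n K a L cp) (i : ℕ) : (∀ k < K, Inv1 K a cp i k) ∧ Inv2 K a L cp i := by
  induction i with
  | zero =>
    refine ⟨fun k _ => ⟨fun p h => (by cases h), fun p h => (by cases h)⟩, ?_⟩
    intro y z _ _ _ _ p f q h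
    cases h
  | succ i ih =>
    have := E.step1 ih.1 ih.2
    exact ⟨this, E.step2 ih.1 this ih.2⟩

end HB

namespace HB

variable {n K : ℕ} {a L cp : ℕ → ℕ}

theorem Enum.diag (E : Enum K a L) (hp : ∀ k < K, 1 ≤ L k) (i : ℕ) :
    ∀ r, ∀ k < K, ∀ f, sA a k i = some ((r, r), f) → r + 1 ≤ L k := by
  intro r
  induction r with
  | zero => intro k hk f _; exact hp k hk
  | succ r ih =>
    intro k hk f h
    have hT := E.tie i
    have hA := (E.add hk h).1
    have h1 : (r, r + 1) ∈ XX a k i := hA.2.2.2 (by simp)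
    have h2 : (r, r) ∈ XX a k i := (E.idl hk.le i).2 _ _ _ _ h1 le_rfl (by omega) le_rfl
    obtain ⟨j, hj, g, hg⟩ := E.occ hk.le h2
    have a1 := ih j (by omega) g hg
    have a2 := E.mono j k hj.le hk
    rcases a2.lt_or_eq with a3 | a3
    · omega
    · exfalso
      cases g with
      | true => have := hT.1 j (by omega) _ hg; simp at this
      | false =>
        have := (hT.2 j k hj hk a3 _ _ _ _ hg h).2 rfl
        simp at this

theorem Enum.rowle (E : Enum K a L) (hp : ∀ k < K, 1 ≤ L k) {i k : ℕ} (hk : k < K) {p : Cell}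
    {f : Bool} (h : sA a k i = some (p, f)) : p.1 + 1 ≤ L k := by
  have h1 : p ∈ XX a (k + 1) i := E.mem (Nat.lt_succ_self k) hk h
  have hI := E.idl (show k + 1 ≤ K from hk) i
  have h2 : (p.1, p.1) ∈ XX a (k + 1) i :=
    hI.2 p.1 p.2 _ _ h1 le_rfl (hI.1 _ _ h1) le_rfl
  obtain ⟨j, hj, g, hg⟩ := E.occ hk h2
  have a1 := E.diag hp i _ j (by omega) g hg
  have a2 := E.mono j k (by omega) hk
  omega

theorem yam_of {n N : ℕ} {l : ℕ → ℕ} (h : YW n N l) :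
    Yam n (ordw N l n).length (aO N l n) (fun k => l (aO N l n k))
      (fun k => cn l (l (aO N l n k)) (aO N l n k)) where
  toEnum := enum_ordw N l n
  cplt := by
    intro j k hjk hk e
    have ht := (enum_ordw N l n).tm j k hjk hk e
    try simp only at e ⊢
    have := cn_mono l (l (aO N l n j)) (show aO N l n j + 1 ≤ aO N l n k from ht)
    rw [cn_succ, if_pos rfl] at this
    rw [← e]
    omega
  low := by
    intro k hk c hc
    obtain ⟨v, v1, v2, v3⟩ := exists_copy hc
    obtain ⟨j, j1, j2⟩ := aO_surj h (i := v) (by have := (aO_mem hk).1; omega)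
    refine ⟨j, ?_, ?_, ?_⟩
    · exact (enum_ordw N l n).lt_of_tm j1 (by simp only [j2, v2]) (by rw [j2]; exact v1)
    · simp only [j2, v2]
    · simp only [j2, v2, v3]
  up := by
    intro j hj y hy hyn
    try simp only at hy
    obtain ⟨m1, m2, m3⟩ := aO_mem hj
    have c1 := h.chain (i := aO N l n j + 1) m1 m2 hy.le hyn
    rw [cn_succ, if_pos rfl] at c1
    obtain ⟨v, v1, v2, v3⟩ := exists_copy (show cn l (l (aO N l n j)) (aO N l n j) <
      cn l y (aO N l n j + 1) by omega)
    have hne : v ≠ aO N l n j := by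
      rintro rfl
      omega
    obtain ⟨k, k1, k2⟩ := aO_surj h (i := v) (by omega)
    refine ⟨k, k1, ?_, ?_, ?_⟩
    · simp only [k2, v2]
    · simp only [k2, v2, v3]
    · rw [k2]; omega
  rng := fun k hk => (aO_mem hk).2

theorem SqW.row {n M : ℕ} {l : ℕ → ℕ} (h : SqW n M l) {k : ℕ}
    (hk : k < (ordw (M + 1) l n).length) {p : Cell} {f : Bool}
    (hp : sA (aO (M + 1) l n) k (M + 1) = some (p, f)) :
    p.1 = min (cn l (l (aO (M + 1) l n k)) (aO (M + 1) l n k)) (l (aO (M + 1) l n k) - 1) := by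
  have E := yam_of h.toYW
  obtain ⟨i1, i2⟩ := E.inv (M + 1)
  have hr := E.toEnum.rowle (fun k hk => (E.rng k hk).1) hk hp
  have hrg := E.rng k hk
  try simp only at hr hrg
  cases f with
  | true =>
    have := (i1 k hk).pr p hp
    try simp only at this
    omega
  | false =>
    have hu := (i1 k hk).un p hp
    try simp only at hu
    rcases Nat.lt_or_ge 1 (l (aO (M + 1) l n k)) with h1 | h1
    · have hm := (aO_mem hk).1
      have c1 : cn l (l (aO (M + 1) l n k)) (aO (M + 1) l n k) < cn l 1 (M + 1) := by
        rw [h.tot 1 le_rfl h.npos]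
        have ht := h.tot _ hrg.1 hrg.2
        have := cn_mono l (l (aO (M + 1) l n k)) (show aO (M + 1) l n k + 1 ≤ M + 1 from hm)
        rw [cn_succ, if_pos rfl] at this
        omega
      obtain ⟨v, v1, v2, v3⟩ := exists_copy c1
      obtain ⟨y, y1, y2⟩ := aO_surj h.toYW v1
      obtain ⟨q, g, hq⟩ := pres (a := aO (M + 1) l n) (k := y) (i := M + 1) (by omega)
      have := (E.chain i2 y1 hq (l (aO (M + 1) l n k) - 2) k hk
        (by simp only [y2, v2]; omega) (by simp only [y2, v2, v3]) p hp).2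
      omega
    · omega

theorem SqW.rowcard {n M : ℕ} {l : ℕ → ℕ} (h : SqW n M l) (r : ℕ) :
    ((XX (aO (M + 1) l n) (ordw (M + 1) l n).length (M + 1)).filter (fun c => c.1 = r)).card =
      ((Finset.Icc 1 n ×ˢ Finset.range n).filter (fun p => min p.2 (p.1 - 1) = r)).card := by
  have E := yam_of h.toYW
  set K := (ordw (M + 1) l n).length with hK
  set a := aO (M + 1) l n with ha
  have hpres : ∀ k < K, ∃ p f, sA a k (M + 1) = some (p, f) := fun k hk => pres (aO_mem hk).1
  trans ((Finset.range K).filter (fun k => min (cn l (l (a k)) (a k)) (l (a k) - 1) = r)).card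
  · symm
    refine Finset.card_nbij (fun k => ((sA a k (M + 1)).getD ((0, 0), false)).1) ?_ ?_ ?_
    · intro k hk
      simp only [Finset.coe_filter, Finset.mem_range, Finset.mem_filter, Set.mem_ofPred_eq] at hk ⊢
      obtain ⟨p, f, hp⟩ := hpres k hk.1
      rw [hp]
      refine ⟨E.toEnum.mem hk.1 le_rfl hp, ?_⟩
      rw [← hk.2]
      exact h.row hk.1 hp
    · intro j hj k hk e
      simp only [Finset.coe_filter, Finset.mem_range, Set.mem_ofPred_eq] at hj hk
      obtain ⟨p, f, hp⟩ := hpres j hj.1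
      obtain ⟨q, g, hq⟩ := hpres k hk.1
      simp only [hp, hq, Option.getD_some] at e
      subst e
      exact E.toEnum.uniq hj.1 hk.1 hp hq
    · intro c hc
      simp only [Finset.coe_filter, Set.mem_ofPred_eq] at hc
      obtain ⟨j, hj, f, hf⟩ := E.toEnum.occ le_rfl hc.1
      refine ⟨j, ?_, by simp only [hf, Option.getD_some]⟩
      simp only [Finset.coe_filter, Finset.mem_range, Set.mem_ofPred_eq]
      exact ⟨hj, by rw [← hc.2]; exact (h.row hj hf).symm⟩
  · refine Finset.card_nbij (fun k => (l (a k), cn l (l (a k)) (a k))) ?_ ?_ ?_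
    · intro k hk
      simp only [Finset.coe_filter, Finset.mem_range, Finset.mem_filter, Set.mem_ofPred_eq,
        Finset.mem_product, Finset.mem_Icc] at hk ⊢
      obtain ⟨m1, m2⟩ := aO_mem hk.1
      refine ⟨⟨m2, ?_⟩, hk.2⟩
      have := cn_mono l (l (a k)) (show a k + 1 ≤ M + 1 from m1)
      rw [cn_succ, if_pos rfl, h.tot _ m2.1 m2.2] at this
      omega
    · intro j hj k hk e
      simp only [Finset.coe_filter, Finset.mem_range, Set.mem_ofPred_eq] at hj hk
      simp only [Prod.mk.injEq] at e
      rcases lt_trichotomy j k with x | x | x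
      · have := E.cplt j k x hk.1 e.1
        try simp only at this
        omega
      · exact x
      · have := E.cplt k j x hj.1 e.1.symm
        try simp only at this
        omega
    · rintro ⟨x, c⟩ hc
      simp only [Finset.coe_filter, Set.mem_ofPred_eq, Finset.mem_product, Finset.mem_Icc,
        Finset.mem_range] at hc
      obtain ⟨v, v1, v2, v3⟩ := exists_copy (l := l) (x := x) (i := M + 1) (k := c)
        (by rw [h.tot _ hc.1.1.1 hc.1.1.2]; exact hc.1.2)
      obtain ⟨k, k1, k2⟩ := aO_surj h.toYW v1
      have k3 : a k = v := k2
      refine ⟨k, ?_, by simp only [k3, v2, v3]⟩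
      simp only [Finset.coe_filter, Finset.mem_range, Set.mem_ofPred_eq, k3, v2, v3]
      exact ⟨k1, hc.2⟩

theorem idl_rowcard {X : Finset Cell} (hX : Idl X) (r : ℕ) :
    (X.filter (fun c => c.1 = r)).card = (rowEnd X r).2 - r := by
  obtain ⟨e1, e2, e3, e4⟩ := rowEnd_spec X r
  have : X.filter (fun c => c.1 = r) = (Finset.Ico r (rowEnd X r).2).image (fun c => (r, c)) := by
    ext ⟨x, c⟩
    simp only [Finset.mem_filter, Finset.mem_image, Finset.mem_Ico, Prod.mk.injEq]
    constructor
    · rintro ⟨h, rfl⟩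
      exact ⟨c, ⟨hX.1 _ _ h, rowEnd_gt hX h le_rfl⟩, rfl, rfl⟩
    · rintro ⟨c, ⟨h1, h2⟩, rfl, rfl⟩
      exact ⟨e4 _ h1 h2, rfl⟩
  rw [this, Finset.card_image_of_injective _ (fun x y e => (Prod.mk.inj e).2), Nat.card_Ico]

theorem idl_mem_iff {X : Finset Cell} (hX : Idl X) (r c : ℕ) :
    (r, c) ∈ X ↔ r ≤ c ∧ c - r < (X.filter (fun c => c.1 = r)).card := by
  rw [idl_rowcard hX]
  obtain ⟨e1, e2, e3, e4⟩ := rowEnd_spec X r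
  constructor
  · intro h
    have h1 := hX.1 _ _ h
    have h2 := rowEnd_gt hX h le_rfl
    exact ⟨h1, by omega⟩
  · rintro ⟨h1, h2⟩
    exact e4 c h1 (by omega)

theorem final_shape {n M : ℕ} {l l' : ℕ → ℕ} (h : SqW n M l) (h' : SqW n M l') :
    shp ∅ (PB ∅ (ordw (M + 1) l n)) (M + 1) = shp ∅ (PB ∅ (ordw (M + 1) l' n)) (M + 1) := by
  rw [← ff_aO, ← ff_aO]
  change XX _ _ _ = XX _ _ _
  ext ⟨r, c⟩
  rw [idl_mem_iff ((enum_ordw (M + 1) l n).idl le_rfl _),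
    idl_mem_iff ((enum_ordw (M + 1) l' n).idl le_rfl _), h.rowcard, h'.rowcard]

end HB

/-- (Petersen–Serrano, Theorem 3.5.)  Let `w = w₁ ⋯ w_(n²)` be a square word of order `n`,
let `ŵ = w₂ ⋯ w_(n²)`, and let `ē = e₁ ∘ ⋯ ∘ e_(n-1)` (applying `e_(n-1)` first).  Then
`p(Q(w)) = Q(ē(ŵ)1)` and `p(Q'(w)) = Q'(ē(ŵ)1)`, where `p` is jeu de taquin promotion.
In other words, Haiman's bijection `H : SYT(n × n) → SYT'(2n-1, 2n-3, …, 1)`, defined by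
`H(Q(w)) = Q'(w)` for square words `w`, commutes with promotion: `p(H(Q)) = H(p(Q))`
(last conjunct, with `Q = Q(w)` and `p(Q) = Q(v)`). -/
theorem haiman_bijection_commutes_with_promotion
    (n : ℕ) (hn : 0 < n) (w : List ℕ) (hw : IsSquareWord n w) :
    promote (n ^ 2) (toFunStraight (rskQ w)) =
      toFunStraight (rskQ (cryEbar n (w.drop 1) ++ [1])) ∧
    promote (n ^ 2) (toFunShifted (mixedQ w)) =
      toFunShifted (mixedQ (cryEbar n (w.drop 1) ++ [1])) ∧
    (∀ v : List ℕ, IsSquareWord n v →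
      toFunStraight (rskQ v) = promote (n ^ 2) (toFunStraight (rskQ w)) →
      toFunShifted (mixedQ v) = promote (n ^ 2) (toFunShifted (mixedQ w))) := by
  exact HB.main_of HB.final_shape n hn w hw
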